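/- If G is a subcubic graph of girth at least 5, then ν_ur(G) ≥ (n(G) − κ_G(𝒢) − κ_G(𝒢₃) − κ_G({H₁,H₂}))/3, where κ_G(ℋ) denotes the number of connected components of G that are isomorphic to a member of the family ℋ. -/

import Mathlib

open SimpleGraph

namespace URPaper

/-- `M` is a matching in the simple graph `G`: a finite set of edges of `G`
that are pairwise vertex-disjoint. -/
def IsMatchingSet {V : Type*} (G : SimpleGraph V) (M : Finset (Sym2 V)) : Prop :=
  (∀ e ∈ M, e ∈ G.edgeSet) ∧
    ∀ e ∈ M, ∀ f ∈ M, e ≠ f → ∀ v : V, v ∈ e → v ∉ f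

/-- The set of vertices covered by a set of edges. -/
def covered {V : Type*} (M : Finset (Sym2 V)) : Set V := {v | ∃ e ∈ M, v ∈ e}

/-- A matching `M` in `G` is uniquely restricted if no other matching of `G`
covers exactly the same set of vertices. -/
def IsURMatching {V : Type*} (G : SimpleGraph V) (M : Finset (Sym2 V)) : Prop :=
  IsMatchingSet G M ∧
    ∀ M' : Finset (Sym2 V), IsMatchingSet G M' → covered M' = covered M → M' = M

/-- The matching number `ν(G)`: the maximum size of a matching in `G`. -/
noncomputable def nu {V : Type*} (G : SimpleGraph V) : ℕ :=
  sSup {k | ∃ M : Finset (Sym2 V), IsMatchingSet G M ∧ M.card = k}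

/-- The uniquely restricted matching number `ν_ur(G)`: the maximum size of a
uniquely restricted matching in `G`. -/
noncomputable def nuUR {V : Type*} (G : SimpleGraph V) : ℕ :=
  sSup {k | ∃ M : Finset (Sym2 V), IsURMatching G M ∧ M.card = k}

/-- `D_G`: the set of vertices missed by at least one maximum matching of `G`. -/
def gallaiD {V : Type*} (G : SimpleGraph V) : Set V :=
  {v | ∃ M : Finset (Sym2 V), IsMatchingSet G M ∧ M.card = nu G ∧ v ∉ covered M}

/-- `A_G`: the set of vertices outside `D_G` having a neighbor in `D_G`. -/
def gallaiA {V : Type*} (G : SimpleGraph V) : Set V :=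
  {v | v ∉ gallaiD G ∧ ∃ u ∈ gallaiD G, G.Adj v u}

/-- `C_G = V(G) \ (A_G ∪ D_G)`. -/
def gallaiC {V : Type*} (G : SimpleGraph V) : Set V :=
  {v | v ∉ gallaiD G ∧ v ∉ gallaiA G}

/-- Membership in the family `𝒯`: trees `T` with `ν(T) = (n(T) - 1)/3`
(equivalently `3 ν(T) + 1 = n(T)`) such that every vertex of `A_T` has degree
at most `3` in `T`. -/
def MemT {V : Type*} (T : SimpleGraph V) : Prop :=
  T.IsTree ∧ (∀ v ∈ gallaiA T, (T.neighborSet v).ncard ≤ 3) ∧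
    3 * nu T + 1 = Nat.card V

/-- The graph obtained from `T` by contracting the set `S` to a single new
vertex (the vertex `none`), all other vertices being kept. -/
def contractSet {V : Type*} (T : SimpleGraph V) (S : Set V) :
    SimpleGraph (Option {x : V // x ∉ S}) where
  Adj a b :=
    match a, b with
    | some x, some y => T.Adj x y
    | some x, none => ∃ u ∈ S, T.Adj (x : V) u
    | none, some y => ∃ u ∈ S, T.Adj (y : V) u
    | none, none => False
  symm := by
    refine ⟨?_⟩
    rintro (_ | x) (_ | y) h
    · exact h
    · exact h
    · exact h
    · exact T.adj_symm h
  loopless := by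
    refine ⟨?_⟩
    rintro (_ | x) h
    · exact h
    · exact T.loopless.irrefl _ h

/-- The graph `BG1` from the paper, given by an explicit edge list. -/
def BG1 : SimpleGraph (Fin 10) :=
  SimpleGraph.fromEdgeSet {s(0,4), s(1,4), s(0,5), s(2,5), s(0,6), s(3,6), s(1,7), s(2,7), s(1,8), s(3,8), s(2,9), s(3,9)}

/-- The graph `BG2` from the paper, given by an explicit edge list. -/
def BG2 : SimpleGraph (Fin 13) :=
  SimpleGraph.fromEdgeSet {s(0,4), s(1,4), s(0,5), s(2,5), s(0,6), s(3,6), s(1,7), s(2,7), s(1,8), s(3,8), s(2,9), s(3,9), s(10,6), s(10,7), s(11,8), s(11,5), s(12,4), s(12,9)}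

/-- The graph `BG3` from the paper, given by an explicit edge list. -/
def BG3 : SimpleGraph (Fin 16) :=
  SimpleGraph.fromEdgeSet {s(0,1), s(1,2), s(2,3), s(3,4), s(4,5), s(5,0), s(6,7), s(7,8), s(8,9), s(9,10), s(10,11), s(11,6), s(12,0), s(12,6), s(13,2), s(13,8), s(14,4), s(14,10), s(15,12), s(15,13), s(15,14)}

/-- The graph `BG4` from the paper, given by an explicit edge list. -/
def BG4 : SimpleGraph (Fin 19) :=
  SimpleGraph.fromEdgeSet {s(0,1), s(1,2), s(2,3), s(3,4), s(4,5), s(5,0), s(6,7), s(7,8), s(8,9), s(9,10), s(10,11), s(11,6), s(12,0), s(13,1), s(14,2), s(15,3), s(16,4), s(17,5), s(12,6), s(13,7), s(14,8), s(15,9), s(16,10), s(17,11), s(18,12), s(18,14), s(18,16)}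

/-- The graph `BG5` from the paper, given by an explicit edge list. -/
def BG5 : SimpleGraph (Fin 16) :=
  SimpleGraph.fromEdgeSet {s(0,4), s(1,4), s(0,5), s(2,5), s(0,6), s(3,6), s(1,7), s(2,7), s(1,8), s(3,8), s(2,9), s(3,9), s(10,6), s(10,7), s(11,8), s(11,5), s(12,4), s(12,9), s(13,14), s(14,15), s(13,10), s(13,11), s(15,12)}

/-- The graph `BG6` from the paper, given by an explicit edge list. -/
def BG6 : SimpleGraph (Fin 19) :=
  SimpleGraph.fromEdgeSet {s(0,4), s(1,4), s(0,5), s(2,5), s(0,6), s(3,6), s(1,7), s(2,7), s(1,8), s(3,8), s(2,9), s(3,9), s(10,6), s(10,7), s(11,8), s(11,5), s(12,4), s(12,9), s(13,14), s(14,15), s(15,16), s(16,17), s(17,18), s(18,13), s(13,10), s(15,11), s(17,12)}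

/-- The graph `BG7` from the paper, given by an explicit edge list. -/
def BG7 : SimpleGraph (Fin 19) :=
  SimpleGraph.fromEdgeSet {s(0,1), s(1,2), s(2,3), s(3,4), s(4,5), s(5,0), s(6,7), s(7,8), s(8,9), s(9,10), s(10,11), s(11,6), s(12,0), s(12,6), s(13,2), s(13,8), s(14,4), s(14,10), s(15,12), s(15,13), s(15,14), s(17,16), s(16,18), s(17,9), s(17,5), s(18,3), s(18,11)}

/-- The graph `BG8` from the paper, given by an explicit edge list. -/
def BG8 : SimpleGraph (Fin 22) :=
  SimpleGraph.fromEdgeSet {s(0,1), s(1,2), s(2,3), s(3,4), s(4,5), s(5,0), s(6,7), s(7,8), s(8,9), s(9,10), s(10,11), s(11,6), s(12,0), s(13,1), s(14,2), s(15,3), s(16,4), s(17,5), s(12,6), s(13,7), s(14,8), s(15,9), s(16,10), s(17,11), s(18,12), s(18,14), s(18,16), s(19,20), s(20,21), s(19,13), s(19,15), s(21,17)}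

/-- The graph `BG9` from the paper, given by an explicit edge list. -/
def BG9 : SimpleGraph (Fin 25) :=
  SimpleGraph.fromEdgeSet {s(0,1), s(1,2), s(2,3), s(3,4), s(4,5), s(5,0), s(6,7), s(7,8), s(8,9), s(9,10), s(10,11), s(11,6), s(12,0), s(13,1), s(14,2), s(15,3), s(16,4), s(17,5), s(12,6), s(13,7), s(14,8), s(15,9), s(16,10), s(17,11), s(18,12), s(18,14), s(18,16), s(19,20), s(20,21), s(21,22), s(22,23), s(23,24), s(24,19), s(19,13), s(21,15), s(23,17)}

/-- The graph `GraphH1` from the paper, given by an explicit edge list. -/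
def GraphH1 : SimpleGraph (Fin 14) :=
  SimpleGraph.fromEdgeSet {s(0,4), s(1,4), s(0,5), s(2,5), s(0,6), s(3,6), s(1,7), s(2,7), s(1,8), s(3,8), s(2,9), s(3,9), s(10,6), s(10,7), s(11,8), s(11,5), s(12,4), s(12,9), s(13,10), s(13,11), s(13,12)}

/-- The graph `GraphH2` from the paper, given by an explicit edge list. -/
def GraphH2 : SimpleGraph (Fin 20) :=
  SimpleGraph.fromEdgeSet {s(0,1), s(1,2), s(2,3), s(3,4), s(4,5), s(5,0), s(6,7), s(7,8), s(8,9), s(9,10), s(10,11), s(11,6), s(12,0), s(13,1), s(14,2), s(15,3), s(16,4), s(17,5), s(12,6), s(13,7), s(14,8), s(15,9), s(16,10), s(17,11), s(18,12), s(18,14), s(18,16), s(19,13), s(19,15), s(19,17)}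

/-- Membership in the family `ℬ = {G₁, …, G₉}`, up to isomorphism. -/
def IsBlockB : ∀ (X : Type), SimpleGraph X → Prop := fun _ H =>
  Nonempty (H ≃g BG1) ∨ Nonempty (H ≃g BG2) ∨ Nonempty (H ≃g BG3) ∨
  Nonempty (H ≃g BG4) ∨ Nonempty (H ≃g BG5) ∨ Nonempty (H ≃g BG6) ∨
  Nonempty (H ≃g BG7) ∨ Nonempty (H ≃g BG8) ∨ Nonempty (H ≃g BG9)

/-- Membership in the family `ℬ_c = {G₁, G₂, G₃, G₄}`, up to isomorphism. -/
def IsBlockBc : ∀ (X : Type), SimpleGraph X → Prop := fun _ H =>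
  Nonempty (H ≃g BG1) ∨ Nonempty (H ≃g BG2) ∨ Nonempty (H ≃g BG3) ∨ Nonempty (H ≃g BG4)

/-- `G` (on vertex set `W`) arises from the tree `T` (on vertex set `V`) by
replacing every vertex of `S` by a graph from the family `𝓑`.  The map `π`
sends every vertex of `G` to the vertex of `T` it corresponds to:
* every fiber over a vertex outside `S` is a single vertex, and on these
  vertices `π` is an isomorphism with the corresponding induced subgraph of `T`;
* the fiber over a vertex `s ∈ S` induces a graph of the family `𝓑`;
* there are no edges between the fibers of two distinct vertices of `S`;
* for `s ∈ S` and `v ∉ S`, there is exactly one edge of `G` between the two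
  fibers if `sv ∈ E(T)` and none otherwise;
* each vertex of a fiber over `s ∈ S` has at most one neighbor outside this
  fiber (distinct attachment vertices), and a vertex of such a fiber having a
  neighbor outside the fiber has exactly two neighbors inside it
  (attachment only at vertices of degree `2` of the replacing graph). -/
def ArisesFrom (𝓑 : ∀ (X : Type), SimpleGraph X → Prop) {W V : Type}
    (G : SimpleGraph W) (T : SimpleGraph V) (S : Set V) (π : W → V) : Prop :=
  Function.Surjective π ∧
  (∀ v ∉ S, ∀ w w' : W, π w = v → π w' = v → w = w') ∧
  (∀ w w' : W, π w ∉ S → π w' ∉ S → (G.Adj w w' ↔ T.Adj (π w) (π w'))) ∧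
  (∀ s ∈ S, 𝓑 _ (G.induce (π ⁻¹' {s}))) ∧
  (∀ s ∈ S, ∀ s' ∈ S, s ≠ s' → ∀ w w' : W, π w = s → π w' = s' → ¬ G.Adj w w') ∧
  (∀ s ∈ S, ∀ v ∉ S, T.Adj s v →
    ∃! p : W × W, π p.1 = s ∧ π p.2 = v ∧ G.Adj p.1 p.2) ∧
  (∀ s ∈ S, ∀ v ∉ S, ¬ T.Adj s v →
    ∀ w w' : W, π w = s → π w' = v → ¬ G.Adj w w') ∧
  (∀ s ∈ S, ∀ w : W, π w = s → ∀ w₁ w₂ : W, π w₁ ≠ s → π w₂ ≠ s →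
    G.Adj w w₁ → G.Adj w w₂ → w₁ = w₂) ∧
  (∀ s ∈ S, ∀ w : W, π w = s → ∀ w' : W, π w' ≠ s → G.Adj w w' →
    (G.neighborSet w ∩ π ⁻¹' {s}).ncard = 2)

/-- Membership in the family `𝒢`: graphs arising from a tree `T ∈ 𝒯` by
replacing each vertex of a subset `S ⊆ D_T` by a graph of the family `ℬ`. -/
def InCalG {W : Type} (G : SimpleGraph W) : Prop :=
  ∃ (V : Type) (T : SimpleGraph V) (S : Set V) (π : W → V),
    Finite V ∧ MemT T ∧ S ⊆ gallaiD T ∧ ArisesFrom IsBlockB G T S π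

/-- `κ_G(P)`: the number of connected components of `G` whose induced graph
satisfies the (isomorphism invariant) predicate `P`. -/
noncomputable def kappa {W : Type} (G : SimpleGraph W)
    (P : ∀ (X : Type), SimpleGraph X → Prop) : ℕ :=
  Nat.card {c : G.ConnectedComponent // P _ (G.induce c.supp)}

/-- Membership in `𝒢₃`: cubic graphs of girth at least `5`. -/
def IsCubicGirth5 : ∀ (X : Type), SimpleGraph X → Prop := fun _ H =>
  (∀ v, (H.neighborSet v).ncard = 3) ∧ 5 ≤ H.egirth

/-- Being isomorphic to `H₁` or `H₂`. -/
def IsH1orH2 : ∀ (X : Type), SimpleGraph X → Prop := fun _ H =>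
  Nonempty (H ≃g GraphH1) ∨ Nonempty (H ≃g GraphH2)

section Aux
open Classical

variable {W : Type} (G : SimpleGraph W)

def PM (S : Finset W) (f : W → W) : Prop :=
  ∀ w ∈ S, f w ∈ S ∧ G.Adj w (f w) ∧ f (f w) = w

def UPM (S : Finset W) : Prop :=
  ∃ f, PM G S f ∧ ∀ g, PM G S g → ∀ w ∈ S, g w = f w

variable {G}

lemma PM.even {S : Finset W} {f : W → W} (h : PM G S f) : Even S.card := by
  have key : ∑ _w ∈ S, (1 : ZMod 2) = 0 := by
    refine Finset.sum_involution (fun a _ => f a) ?_ ?_ ?_ ?_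
    · intro a _; decide
    · intro a ha _ he
      have := (h a ha).2.1
      rw [he] at this; exact G.loopless.irrefl _ this
    · intro a ha; exact (h a ha).1
    · intro a ha; exact (h a ha).2.2
  rw [Finset.sum_const, nsmul_eq_mul, mul_one] at key
  exact (ZMod.natCast_eq_zero_iff_even).1 key

lemma UPM_empty : UPM G (∅ : Finset W) := ⟨id, by simp [PM], by simp⟩

lemma UPM_pendant {S : Finset W} {u v : W} (h : UPM G S) (hu : u ∉ S) (hv : v ∉ S)
    (huv : G.Adj u v) (hn : ∀ s ∈ S, ¬ G.Adj u s) : UPM G (insert u (insert v S)) := by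
  obtain ⟨f, hf, huniq⟩ := h
  have hne : u ≠ v := huv.ne
  refine ⟨fun w => if w = u then v else if w = v then u else f w, ?_, ?_⟩
  · intro w hw
    have hS : ∀ s ∈ S, s ≠ u ∧ s ≠ v := fun s hs =>
      ⟨fun h => hu (h ▸ hs), fun h => hv (h ▸ hs)⟩
    simp only [Finset.mem_insert] at hw
    rcases hw with rfl | rfl | hw
    · simp [huv, hne.symm]
    · simp [huv.symm, hne.symm]
    · have h1 := hS w hw
      have h2 := hS _ (hf w hw).1
      have h3 := hf w hw
      simp [h1, h2, h3]
  · intro g hg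
    have hgu : g u = v := by
      have h1 := hg u (by simp)
      simp only [Finset.mem_insert] at h1
      rcases h1 with ⟨h1 | h1 | h1, h2, _⟩
      · rw [h1] at h2; exact absurd h2 (G.loopless.irrefl _)
      · exact h1
      · exact absurd h2 (hn _ h1)
    have hgv : g v = u := by rw [← hgu]; exact (hg u (by simp)).2.2
    have hgS : PM G S g := by
      intro w hw
      have h1 := hg w (by simp [hw])
      refine ⟨?_, h1.2⟩
      have h2 := h1.1
      simp only [Finset.mem_insert] at h2
      rcases h2 with h2 | h2 | h2
      · have := h1.2.2; rw [h2, hgu] at this; exact absurd hw (this ▸ hv)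
      · have := h1.2.2; rw [h2, hgv] at this; exact absurd hw (this ▸ hu)
      · exact h2
    intro w hw
    simp only [Finset.mem_insert] at hw
    by_cases h1 : w = u
    · simp [h1, hgu]
    by_cases h2 : w = v
    · simp [h2, hgv, hne.symm]
    simp only [h1, h2, if_false]
    rcases hw with hw | hw | hw
    · exact absurd hw h1
    · exact absurd hw h2
    · exact huniq g hgS w hw

lemma UPM_union {A B : Finset W} (hA : UPM G A) (hB : UPM G B) (hd : Disjoint A B)
    (hb : ∀ a ∈ A, ∀ b ∈ B, ∀ a' ∈ A, ∀ b' ∈ B, G.Adj a b → G.Adj a' b' → a = a' ∧ b = b') :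
    UPM G (A ∪ B) := by
  obtain ⟨f, hf, hfu⟩ := hA
  obtain ⟨g, hg, hgu⟩ := hB
  have hBA : ∀ b ∈ B, b ∉ A := fun b hb ha => (Finset.disjoint_left.1 hd ha hb)
  refine ⟨fun w => if w ∈ A then f w else g w, ?_, ?_⟩
  · intro w hw
    by_cases h : w ∈ A
    · have := hf w h
      simp [h, this]
    · have hw' : w ∈ B := by simpa [h] using hw
      have := hg w hw'
      simp [h, this, hBA _ this.1]
  · intro k hk
    have keyA : ∀ w ∈ A, k w ∈ A := by
      by_contra hcon
      push Not at hcon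
      obtain ⟨x, hx, hkx⟩ := hcon
      have hx1 := hk x (by simp [hx])
      have hkxB : k x ∈ B := by simpa [hkx] using hx1.1
      have : PM G (A.erase x) k := by
        intro w hw
        simp only [Finset.mem_erase] at hw
        have h1 := hk w (by simp [hw.2])
        refine ⟨?_, h1.2⟩
        have h2 : k w ∈ A := by
          by_contra h3
          have h4 : k w ∈ B := by simpa [h3] using h1.1
          exact hw.1 (hb w hw.2 _ h4 x hx _ hkxB h1.2.1 hx1.2.1).1
        refine Finset.mem_erase.2 ⟨?_, h2⟩
        intro h3
        apply hkx
        rw [← h3, h1.2.2]; exact hw.2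
      have e1 := this.even
      have e2 := hf.even
      rw [Finset.card_erase_of_mem hx] at e1
      have : 0 < A.card := Finset.card_pos.2 ⟨x, hx⟩
      rcases e1 with ⟨a, ha⟩; rcases e2 with ⟨b, hb⟩; omega
    have hkA : PM G A k := fun w hw => ⟨keyA w hw, (hk w (by simp [hw])).2⟩
    have hkB : PM G B k := by
      intro w hw
      have h1 := hk w (by simp [hw])
      refine ⟨?_, h1.2⟩
      have h2 : k w ∉ A := by
        intro h3
        have := keyA _ h3
        rw [h1.2.2] at this
        exact hBA w hw this
      simpa [h2] using h1.1
    intro w hw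
    by_cases h : w ∈ A
    · simp [h, hfu k hkA w h]
    · have hw' : w ∈ B := by simpa [h] using hw
      simp [h, hgu k hkB w hw']

lemma UPM_bridge {A B : Finset W} {x y : W} (hA : UPM G A) (hB : UPM G B)
    (hxA : x ∉ A) (hyB : y ∉ B) (hd : Disjoint (insert x A) (insert y B)) (hxy : G.Adj x y)
    (hb : ∀ a ∈ insert x A, ∀ b ∈ insert y B, G.Adj a b → a = x ∧ b = y) :
    UPM G (insert x A ∪ insert y B) := by
  have hAe : Even A.card := by obtain ⟨f, hf, _⟩ := hA; exact hf.even
  have hA' := hA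
  obtain ⟨f, hf, hfu⟩ := hA
  obtain ⟨g, hg, hgu⟩ := hB
  have hBA : ∀ b ∈ insert y B, b ∉ insert x A := fun b hb ha => (Finset.disjoint_left.1 hd ha hb)
  have hyx : y ≠ x := hxy.ne.symm
  have hAy : ∀ a ∈ A, a ≠ x ∧ a ≠ y ∧ a ∉ B := fun a ha =>
    ⟨fun h => hxA (h ▸ ha), fun h => hBA y (by simp) (h ▸ (by simp [ha])),
      fun h => hBA a (by simp [h]) (by simp [ha])⟩
  have hBy : ∀ a ∈ B, a ≠ x ∧ a ≠ y ∧ a ∉ A := fun a ha =>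
    ⟨fun h => hBA a (by simp [ha]) (by simp [h]), fun h => hyB (h ▸ ha),
      fun h => hBA a (by simp [ha]) (by simp [h])⟩
  refine ⟨fun w => if w = x then y else if w = y then x else if w ∈ A then f w else g w, ?_, ?_⟩
  · intro w hw
    simp only [Finset.mem_union, Finset.mem_insert] at hw
    rcases hw with (rfl | hw) | (rfl | hw)
    · simp [hxy, hyx]
    · have h1 := hAy w hw
      have h2 := hAy _ (hf w hw).1
      have h3 := hf w hw
      simp [h1, h2, h3, hw]
    · simp [hxy.symm, hyx]
    · have h1 := hBy w hw
      have h2 := hBy _ (hg w hw).1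
      have h3 := hg w hw
      simp [h1, h2, h3]
  · intro k hk
    have hkx : k x = y := by
      by_contra hne
      have : PM G (insert x A) k := by
        intro w hw
        have h1 := hk w (Finset.mem_union_left _ hw)
        refine ⟨?_, h1.2⟩
        by_contra h2
        have h3 : k w ∈ insert y B := by
          rcases Finset.mem_union.1 h1.1 with h | h
          · exact absurd h h2
          · exact h
        have h4 := hb w hw _ h3 h1.2.1
        apply hne
        rw [← h4.1]; exact h4.2
      have e1 := this.even
      rw [Finset.card_insert_of_notMem hxA] at e1
      rcases e1 with ⟨a, ha⟩; rcases hAe with ⟨b, hb⟩; omega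
    have hky : k y = x := by rw [← hkx]; exact (hk x (by simp)).2.2
    have hkA : PM G A k := by
      intro w hw
      have h1 := hk w (by simp [hw])
      refine ⟨?_, h1.2⟩
      by_contra h2
      have h3 := h1.1
      simp only [Finset.mem_union, Finset.mem_insert] at h3
      rcases h3 with (h3 | h3) | h3
      · have := h1.2.2; rw [h3, hkx] at this; exact (hAy w hw).2.1 this.symm
      · exact h2 h3
      · exact (hAy w hw).1 (hb w (by simp [hw]) _ (by simpa using h3) h1.2.1).1
    have hkB : PM G B k := by
      intro w hw
      have h1 := hk w (by simp [hw])
      refine ⟨?_, h1.2⟩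
      by_contra h2
      have h3 := h1.1
      simp only [Finset.mem_union, Finset.mem_insert] at h3
      rcases h3 with h3 | (h3 | h3)
      · exact (hBy w hw).2.1 (hb _ (by simpa using h3) w (by simp [hw]) h1.2.1.symm).2
      · have := h1.2.2; rw [h3, hky] at this; exact (hBy w hw).1 this.symm
      · exact h2 h3
    intro w hw
    simp only [Finset.mem_union, Finset.mem_insert] at hw
    rcases hw with (rfl | hw) | (rfl | hw)
    · simp [hkx]
    · have h1 := hAy w hw
      simp [h1, hw, hfu k hkA w hw]
    · simp [hky, hyx]
    · have h1 := hBy w hw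
      simp [h1, hgu k hkB w hw]

variable (G) in
noncomputable def nuS (X : Finset W) : ℕ :=
  (X.powerset.filter (fun S => UPM G S)).sup (fun S => S.card / 2)

lemma exists_nuS (X : Finset W) : ∃ S, S ⊆ X ∧ UPM G S ∧ S.card = 2 * nuS G X := by
  have hne : (X.powerset.filter (fun S => UPM G S)).Nonempty :=
    ⟨∅, by simp [UPM_empty]⟩
  obtain ⟨S, hS, h⟩ := Finset.exists_mem_eq_sup _ hne (fun S => S.card / 2)
  simp only [Finset.mem_filter, Finset.mem_powerset] at hS
  refine ⟨S, hS.1, hS.2, ?_⟩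
  obtain ⟨f, hf, _⟩ := hS.2
  obtain ⟨k, hk⟩ := hf.even
  unfold nuS; rw [h]; omega

lemma le_nuS {X S : Finset W} (h : S ⊆ X) (hS : UPM G S) {k : ℕ} (hk : 2 * k ≤ S.card) :
    k ≤ nuS G X := by
  have : S.card / 2 ≤ nuS G X :=
    Finset.le_sup (f := fun S : Finset W => S.card / 2) (by simp [h, hS])
  omega

lemma nuS_mono {X Y : Finset W} (h : X ⊆ Y) : nuS G X ≤ nuS G Y := by
  obtain ⟨S, h1, h2, h3⟩ := exists_nuS (G := G) X
  exact le_nuS (h1.trans h) h2 h3.ge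

lemma nuS_pendant {X Y : Finset W} {u v : W} (hu : u ∉ X) (hv : v ∉ X) (huY : u ∈ Y) (hvY : v ∈ Y)
    (hXY : X ⊆ Y) (huv : G.Adj u v) (hn : ∀ s ∈ X, ¬ G.Adj u s) : nuS G X + 1 ≤ nuS G Y := by
  obtain ⟨S, h1, h2, h3⟩ := exists_nuS (G := G) X
  have hu' : u ∉ S := fun h => hu (h1 h)
  have hv' : v ∉ S := fun h => hv (h1 h)
  have := UPM_pendant h2 hu' hv' huv (fun s hs => hn s (h1 hs))
  refine le_nuS ?_ this ?_
  · intro w hw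
    simp only [Finset.mem_insert] at hw
    rcases hw with rfl | rfl | hw
    exacts [huY, hvY, hXY (h1 hw)]
  · rw [Finset.card_insert_of_notMem, Finset.card_insert_of_notMem hv']
    · omega
    · simp [huv.ne, hu']

variable (G) in
noncomputable def e (A B : Finset W) : ℕ := ((A ×ˢ B).filter (fun p => G.Adj p.1 p.2)).card

variable (G) in
noncomputable def d (X : Finset W) : ℤ := X.card - 3 * nuS G X

lemma e_comm (A B : Finset W) : e G A B = e G B A := by
  unfold e
  refine Finset.card_bij (fun p _ => (p.2, p.1)) ?_ ?_ ?_
  · simp only [Finset.mem_filter, Finset.mem_product]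
    rintro ⟨a, b⟩ h; exact ⟨⟨h.1.2, h.1.1⟩, h.2.symm⟩
  · rintro ⟨a, b⟩ _ ⟨c, d⟩ _ h; simp at h; simp [h]
  · simp only [Finset.mem_filter, Finset.mem_product]
    rintro ⟨a, b⟩ h; exact ⟨(b, a), ⟨⟨h.1.2, h.1.1⟩, h.2.symm⟩, rfl⟩

lemma e_union_left {A B : Finset W} (C : Finset W) (h : Disjoint A B) :
    e G (A ∪ B) C = e G A C + e G B C := by
  unfold e
  rw [Finset.union_product, Finset.filter_union, Finset.card_union_of_disjoint]
  refine Finset.disjoint_filter_filter ?_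
  exact Finset.disjoint_product.2 (Or.inl h)

lemma e_union_right {A B : Finset W} (C : Finset W) (h : Disjoint A B) :
    e G C (A ∪ B) = e G C A + e G C B := by
  rw [e_comm, e_union_left C h, e_comm A, e_comm B]

lemma e_eq_zero {A B : Finset W} : e G A B = 0 ↔ ∀ a ∈ A, ∀ b ∈ B, ¬ G.Adj a b := by
  unfold e
  rw [Finset.card_eq_zero, Finset.filter_eq_empty_iff]
  constructor
  · intro h a ha b hb; exact h (Finset.mk_mem_product ha hb)
  · rintro h ⟨a, b⟩ hab; exact h a (Finset.mem_product.1 hab).1 b (Finset.mem_product.1 hab).2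

lemma e_mono {A B A' B' : Finset W} (hA : A ⊆ A') (hB : B ⊆ B') : e G A B ≤ e G A' B' :=
  Finset.card_le_card (Finset.filter_subset_filter _ (Finset.product_subset_product hA hB))

lemma e_pos {A B : Finset W} {a b : W} (ha : a ∈ A) (hb : b ∈ B) (h : G.Adj a b) :
    1 ≤ e G A B :=
  Finset.card_pos.2 ⟨(a, b), by simp [ha, hb, h]⟩

lemma e_ge_one {A B : Finset W} (h : 1 ≤ e G A B) : ∃ a ∈ A, ∃ b ∈ B, G.Adj a b := by
  by_contra hc
  push Not at hc
  have := e_eq_zero.2 hc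
  omega

lemma e_le_one {A B : Finset W} (h : e G A B ≤ 1) {a a' b b' : W} (ha : a ∈ A) (hb : b ∈ B)
    (hab : G.Adj a b) (ha' : a' ∈ A) (hb' : b' ∈ B) (hab' : G.Adj a' b') : a = a' ∧ b = b' := by
  have := Finset.card_le_one.1 h (a, b) (by simp [ha, hb, hab]) (a', b') (by simp [ha', hb', hab'])
  simpa using this

lemma e_single (x : W) (B : Finset W) : e G {x} B = (B.filter (G.Adj x)).card := by
  unfold e
  refine Finset.card_bij (fun p _ => p.2) ?_ ?_ ?_
  · simp only [Finset.mem_filter, Finset.mem_product, Finset.mem_singleton]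
    rintro ⟨a, b⟩ ⟨⟨rfl, h⟩, h2⟩; exact ⟨h, h2⟩
  · simp only [Finset.mem_filter, Finset.mem_product, Finset.mem_singleton]
    rintro ⟨a, b⟩ ⟨⟨rfl, h⟩, h2⟩ ⟨a', b'⟩ ⟨⟨rfl, h'⟩, h2'⟩ h3; simp at h3; simp [h3]
  · intro b hb; simp at hb; exact ⟨(x, b), by simp [hb], rfl⟩

lemma e_single_insert_adj {x b : W} {B : Finset W} (hb : b ∉ B) (h : G.Adj x b) :
    e G {x} (insert b B) = e G {x} B + 1 := by
  rw [e_single, e_single, Finset.filter_insert, if_pos h, Finset.card_insert_of_notMem (by simp [hb])]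

lemma e_single_single {x y : W} : e G {x} {y} = if G.Adj x y then 1 else 0 := by
  rw [e_single, Finset.filter_singleton]; split_ifs <;> simp

lemma nuS_union {A B Y : Finset W} (hd : Disjoint A B) (hY : A ∪ B ⊆ Y) (he : e G A B ≤ 1) :
    nuS G A + nuS G B ≤ nuS G Y := by
  obtain ⟨S, h1, h2, h3⟩ := exists_nuS (G := G) A
  obtain ⟨T, k1, k2, k3⟩ := exists_nuS (G := G) B
  have hd' : Disjoint S T := Finset.disjoint_of_subset_left h1 (Finset.disjoint_of_subset_right k1 hd)
  refine le_nuS ((Finset.union_subset_union h1 k1).trans hY) (UPM_union h2 k2 hd' ?_) ?_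
  · intro a ha b hb a' ha' b' hb' h h'
    exact e_le_one he (h1 ha) (k1 hb) h (h1 ha') (k1 hb') h'
  · rw [Finset.card_union_of_disjoint hd']; omega

lemma nuS_bridge {A B Y : Finset W} {x y : W}
    (hxA : x ∉ A) (hyB : y ∉ B) (hd : Disjoint (insert x A) (insert y B))
    (hY : insert x A ∪ insert y B ⊆ Y) (hxy : G.Adj x y)
    (hb : ∀ a ∈ insert x A, ∀ b ∈ insert y B, G.Adj a b → a = x ∧ b = y) :
    nuS G A + nuS G B + 1 ≤ nuS G Y := by
  obtain ⟨S, h1, h2, h3⟩ := exists_nuS (G := G) A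
  obtain ⟨T, k1, k2, k3⟩ := exists_nuS (G := G) B
  have i1 := Finset.insert_subset_insert x h1
  have i2 := Finset.insert_subset_insert y k1
  have hd' : Disjoint (insert x S) (insert y T) :=
    Finset.disjoint_of_subset_left i1 (Finset.disjoint_of_subset_right i2 hd)
  have := UPM_bridge h2 k2 (fun h => hxA (h1 h)) (fun h => hyB (k1 h)) hd' hxy
    (fun a ha b hb' h => hb a (i1 ha) b (i2 hb') h)
  refine le_nuS ((Finset.union_subset_union i1 i2).trans hY) this ?_
  rw [Finset.card_union_of_disjoint hd', Finset.card_insert_of_notMem (fun h => hxA (h1 h)),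
    Finset.card_insert_of_notMem (fun h => hyB (k1 h))]; omega

lemma d_empty : d G (∅ : Finset W) = 0 := by
  obtain ⟨S, h1, h2, h3⟩ := exists_nuS (G := G) ∅
  have := Finset.card_le_card h1
  simp at this
  unfold d; simp; simp [this] at h3; omega

lemma d_single (x : W) : d G {x} = 1 := by
  obtain ⟨S, h1, h2, h3⟩ := exists_nuS (G := G) {x}
  have := Finset.card_le_card h1
  simp at this
  unfold d; simp; omega

lemma d_union {A B : Finset W} (hd : Disjoint A B) (he : e G A B ≤ 1) :
    d G (A ∪ B) ≤ d G A + d G B := by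
  have := nuS_union (G := G) hd subset_rfl he
  unfold d; rw [Finset.card_union_of_disjoint hd]; push_cast; omega

end Aux

def b1 : List (List ℕ) :=
  [[], [], [], [], [0, 1], [0, 2], [0, 3], [1, 2], [1, 3], [2, 3]]

def b2 : List (List ℕ) :=
  [[], [], [], [], [0, 1], [0, 2], [0, 3], [1, 2], [1, 3], [2, 3], [6, 7], [5, 8], [4, 9]]

def b3 : List (List ℕ) :=
  [[], [0], [1], [2], [3], [0, 4], [], [6], [7], [8], [9], [6, 10], [0, 6], [2, 8], [4, 10], [12,
  13, 14]]

def b4 : List (List ℕ) :=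
  [[], [0], [1], [2], [3], [0, 4], [], [6], [7], [8], [9], [6, 10], [0, 6], [1, 7], [2, 8], [3,
  9], [4, 10], [5, 11], [12, 14, 16]]

def b5 : List (List ℕ) :=
  [[], [], [], [], [0, 1], [0, 2], [0, 3], [1, 2], [1, 3], [2, 3], [6, 7], [5, 8], [4, 9], [10,
  11], [13], [12, 14]]

def b6 : List (List ℕ) :=
  [[], [], [], [], [0, 1], [0, 2], [0, 3], [1, 2], [1, 3], [2, 3], [6, 7], [5, 8], [4, 9], [10],
  [13], [11, 14], [15], [12, 16], [13, 17]]

def b7 : List (List ℕ) :=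
  [[], [0], [1], [2], [3], [0, 4], [], [6], [7], [8], [9], [6, 10], [0, 6], [2, 8], [4, 10], [12,
  13, 14], [], [5, 9, 16], [3, 11, 16]]

def b8 : List (List ℕ) :=
  [[], [0], [1], [2], [3], [0, 4], [], [6], [7], [8], [9], [6, 10], [0, 6], [1, 7], [2, 8], [3,
  9], [4, 10], [5, 11], [12, 14, 16], [13, 15], [19], [17, 20]]

def b9 : List (List ℕ) :=
  [[], [0], [1], [2], [3], [0, 4], [], [6], [7], [8], [9], [6, 10], [0, 6], [1, 7], [2, 8], [3,
  9], [4, 10], [5, 11], [12, 14, 16], [13], [19], [15, 20], [21], [17, 22], [19, 23]]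

def bH1 : List (List ℕ) :=
  [[], [], [], [], [0, 1], [0, 2], [0, 3], [1, 2], [1, 3], [2, 3], [6, 7], [5, 8], [4, 9], [10,
  11, 12]]

def bH2 : List (List ℕ) :=
  [[], [0], [1], [2], [3], [0, 4], [], [6], [7], [8], [9], [6, 10], [0, 6], [1, 7], [2, 8], [3,
  9], [4, 10], [5, 11], [12, 14, 16], [13, 15, 17]]

def bclaw : List (List ℕ) :=
  [[], [0], [0], [0]]

def certs : List (List (ℕ × ℕ)) := [
  [(7, 8), (13, 15), (12, 0), (1, 16), (18, 17), (5, 4), (11, 10)],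
  [(1, 0), (12, 15), (13, 8), (7, 16), (18, 17), (3, 4), (14, 10)],
  [(7, 6), (13, 2), (12, 0), (1, 16), (19, 17), (21, 18), (5, 4), (14, 10)],
  [(1, 2), (12, 15), (13, 8), (7, 17), (18, 16), (5, 4), (14, 10)],
  [(5, 0), (17, 18), (16, 1), (2, 13), (8, 9), (12, 15), (14, 10)],
  [(17, 18), (3, 2), (16, 1), (0, 12), (6, 11), (14, 15), (13, 8)],
  [(11, 6), (7, 8), (9, 16), (18, 17), (12, 15), (5, 4), (13, 2)],
  [(7, 8), (9, 10), (11, 16), (18, 17), (14, 4), (3, 2), (5, 0)],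
  [(9, 2), (8, 1), (7, 12), (14, 10), (4, 0), (13, 11)],
  [(7, 2), (9, 3), (8, 12), (14, 10), (15, 11), (5, 0)],
  [(8, 3), (7, 2), (9, 12), (15, 11), (13, 10), (6, 0)],
  [(5, 2), (6, 3), (9, 12), (15, 11), (13, 10), (8, 1)],
  [(11, 10), (9, 8), (7, 18), (20, 16), (19, 17), (3, 2), (14, 15), (12, 0)],
  [(1, 0), (11, 10), (12, 15), (13, 8), (14, 4), (9, 18), (21, 17), (19, 16)],
  [(1, 0), (12, 6), (13, 8), (5, 4), (14, 10), (11, 18), (21, 17), (20, 16)],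
  [(8, 3), (7, 2), (9, 10), (4, 0), (12, 11)],
  [(5, 0), (6, 3), (9, 10), (12, 11), (4, 1)],
  [(9, 3), (6, 0), (5, 10), (8, 1), (12, 11)],
  [(4, 0), (7, 2), (5, 10), (8, 3), (12, 11)],
  [(11, 12), (0, 6), (10, 7), (2, 9), (1, 8)],
  [(4, 0), (5, 2), (7, 10), (12, 11), (8, 3)],
  [(4, 0), (5, 2), (7, 11), (13, 10), (15, 12), (8, 3)],
  [(11, 6), (9, 8), (7, 16), (18, 17), (5, 0), (1, 2), (13, 15)],
  [(5, 0), (3, 2), (1, 16), (19, 17), (21, 18), (11, 10), (14, 15), (7, 8)],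
  [(5, 4), (1, 2), (3, 16), (18, 17), (11, 10), (12, 15), (9, 8)],
  [(1, 2), (3, 4), (5, 16), (18, 17), (7, 8), (13, 15), (11, 10)],
  [(1, 0), (3, 4), (5, 16), (20, 18), (21, 17), (14, 10), (12, 6), (13, 8)],
  [(20, 21), (18, 11), (6, 12), (19, 1), (0, 5), (2, 13), (15, 14), (8, 9)],
  [(4, 1), (7, 2), (5, 10), (14, 12), (13, 11), (9, 3)],
  [(9, 2), (6, 0), (4, 1), (7, 11), (8, 12), (13, 10)],
  [(9, 10), (7, 6), (11, 18), (21, 17), (19, 16), (1, 2), (3, 4), (14, 15)],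
  [(2, 5), (11, 8), (3, 6), (0, 4), (10, 13), (12, 17), (14, 19), (16, 20), (18, 21)],
  [(20, 21), (19, 7), (2, 13), (8, 9), (17, 5), (4, 14), (15, 12), (6, 11)],
  [(11, 6), (14, 4), (3, 2), (13, 8), (7, 20), (17, 5), (0, 1), (21, 23), (19, 22)],
  [(14, 4), (13, 8), (9, 17), (5, 0), (3, 18), (12, 6), (1, 19)],
  [(4, 5), (9, 15), (14, 2), (17, 11), (6, 12), (0, 1), (13, 19), (24, 27), (26, 22), (21, 20),
  (25, 29)]]

def perms : List (List ℕ) := [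
  [1, 7, 2, 9, 3, 8, 10, 13, 11, 15, 12, 14, 4, 5, 6, 0],
  [0, 5, 2, 9, 3, 6, 10, 13, 11, 15, 12, 14, 4, 7, 8, 1],
  [0, 4, 1, 8, 3, 6, 10, 13, 11, 15, 12, 14, 5, 7, 9, 2],
  [0, 4, 1, 7, 2, 5, 10, 13, 11, 15, 12, 14, 6, 8, 9, 3],
  [4, 5, 8, 9, 0, 1, 10, 11, 2, 3, 12, 7, 6],
  [4, 6, 7, 9, 0, 1, 10, 11, 3, 2, 12, 8, 5],
  [5, 6, 7, 8, 0, 2, 10, 11, 3, 1, 12, 9, 4],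
  [0, 1, 2, 3, 4, 5, 6, 7, 8, 9, 10, 11, 12, 13, 15, 14],
  [0, 1, 2, 3, 4, 5, 6, 7, 8, 9, 10, 11, 12, 13, 16, 14, 18, 15, 17],
  [0, 1, 2, 3, 4, 5, 6, 7, 8, 9, 10, 11, 12, 13],
  [0, 2, 1, 3, 5, 4, 6, 7, 9, 8, 10, 12, 11, 13, 15, 14],
  [0, 3, 1, 2, 6, 4, 5, 8, 9, 7, 11, 12, 10, 13, 15, 14],
  [1, 0, 12, 6, 7, 16, 3, 4, 14, 10, 9, 17, 2, 5, 15, 11, 8, 18, 13],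
  [1, 2, 13, 8, 7, 16, 5, 4, 14, 10, 11, 17, 0, 3, 15, 9, 6, 18, 12],
  [0, 5, 4, 3, 2, 1, 6, 11, 10, 9, 8, 7, 12, 14, 13, 15, 18, 16, 17],
  [4, 3, 2, 1, 0, 5, 10, 9, 8, 7, 6, 11, 14, 13, 12, 15, 18, 17, 16],
  [5, 0, 12, 6, 11, 17, 3, 2, 13, 8, 9, 16, 4, 1, 15, 7, 10, 18, 14],
  [0, 1, 2, 3, 4, 5, 6, 7, 8, 9, 10, 11, 12, 13, 14, 15, 18, 17, 16],
  [0, 1, 2, 3, 4, 5, 6, 7, 8, 9, 10, 11, 12, 13, 14, 15, 16, 17, 18, 19, 21, 20],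
  [0, 1, 2, 3, 4, 5, 6, 7, 8, 9, 10, 11, 12, 13, 14, 15, 16, 17, 18, 19, 22, 20, 24, 21, 23],
  [0, 1, 2, 3, 4, 5, 6, 7, 8, 9, 10, 11, 12, 13, 14, 15, 16, 17, 18, 19],
  [2, 1, 0, 5, 4, 3, 8, 7, 6, 11, 10, 9, 14, 13, 12, 17, 16, 15, 18, 19, 21, 20],
  [0, 5, 4, 3, 2, 1, 6, 11, 10, 9, 8, 7, 12, 17, 16, 15, 14, 13, 18, 19, 21, 20],
  [0, 4, 5, 6, 1, 2, 3, 7, 8, 9]]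

def blocks : List (List (List ℕ)) := [b1, b2, b3, b4, b5, b6, b7, b8, b9]

def cores : List (List (List ℕ)) := bclaw :: blocks

def edgeB (g : List (List ℕ)) (i j : ℕ) : Bool := (g.getD j []).contains i

def adjB (g : List (List ℕ)) (i j : ℕ) : Bool :=
  bif Nat.blt i j then edgeB g i j else bif Nat.blt j i then edgeB g j i else false

def certOK (g : List (List ℕ)) : List (ℕ × ℕ) → Bool
  | [] => true
  | p :: c => Nat.blt p.1 g.length && Nat.blt p.2 g.length && adjB g p.1 p.2 &&
      c.all (fun q => p.1 != q.1 && p.1 != q.2 && p.2 != q.1 && p.2 != q.2 &&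
        !adjB g p.1 q.1 && !adjB g p.1 q.2) && certOK g c

def isoOK (g t : List (List ℕ)) (q : List ℕ) : Bool :=
  q.length == g.length && t.length == g.length && q.all (fun i => Nat.blt i g.length) &&
    decide q.Nodup &&
    (List.range g.length).all (fun j => (List.range j).all (fun i =>
      edgeB t i j == adjB g (q.getD i 0) (q.getD j 0)))

def okG (targets : List (List (List ℕ))) (g : List (List ℕ)) : Bool :=
  certs.any (fun c => Nat.ble g.length (3 * c.length) && certOK g c) ||
    perms.any (fun q => targets.any (fun t => isoOK g t q))

def av (g : List (List ℕ)) : List ℕ :=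
  (List.range g.length).filter (fun i => Nat.ble ((List.range g.length).countP (adjB g i)) 2)

def comm (g : List (List ℕ)) (i j : ℕ) : Bool :=
  (List.range g.length).any (fun k => adjB g i k && adjB g j k)

def gP3 (g : List (List ℕ)) (a b c : ℕ) : List (List ℕ) :=
  g ++ [[a, b]] ++ [[c]] ++ [[g.length, g.length + 1]]

def gP4 (g : List (List ℕ)) (a b c d : ℕ) : List (List ℕ) :=
  g ++ [[a, b]] ++ [[c, d]] ++ [[g.length, g.length + 1]]

def gHex (g : List (List ℕ)) (a b c : ℕ) : List (List ℕ) :=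
  g ++ [[a]] ++ [[b]] ++ [[c]] ++ [[g.length, g.length + 1]] ++ [[g.length, g.length + 2]] ++
    [[g.length + 1, g.length + 2]]

def gR (g : List (List ℕ)) (a b c : ℕ) : List (List ℕ) := g ++ [[a, b, c]]

def chkP3 : Bool := cores.all fun g => (av g).all fun a => (av g).all fun b => (av g).all fun c =>
  Nat.ble b a || c == a || c == b || comm g a b || okG blocks (gP3 g a b c)

def chkP4 : Bool := blocks.all fun g => (av g).all fun a => (av g).all fun b =>
  Nat.ble b a || comm g a b || (av g).all fun c => Nat.ble c a || c == b || (av g).all fun d =>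
    Nat.ble d c || d == b || comm g c d || okG blocks (gP4 g a b c d)

def chkHex : Bool := cores.all fun g => (av g).all fun a => (av g).all fun b =>
  Nat.ble b a || (av g).all fun c => Nat.ble c b || okG blocks (gHex g a b c)

def cubicB (g : List (List ℕ)) : Bool :=
  (List.range g.length).all (fun i => (List.range g.length).countP (adjB g i) == 3)

def chkR : Bool := cores.all fun g => (av g).all fun a => (av g).all fun b =>
  Nat.ble b a || (av g).all fun c => Nat.ble c b || comm g a b || !cubicB (gR g a b c) ||
    okG [bH1, bH2] (gR g a b c)

lemma chkP3_true : chkP3 = true := by decide +kernel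
lemma chkP4_true : chkP4 = true := by decide +kernel
lemma chkHex_true : chkHex = true := by decide +kernel
lemma chkR_true : chkR = true := by decide +kernel
lemma blocks_mod : ∀ g ∈ blocks, g.length % 3 = 1 := by decide +kernel
lemma blocks_deg : ∀ g ∈ blocks, ∀ i < g.length,
    2 ≤ (List.range g.length).countP (adjB g i) := by decide +kernel

section Real
open Classical
variable {W : Type} {G : SimpleGraph W}

lemma adjB_comm (g : List (List ℕ)) (i j : ℕ) : adjB g i j = adjB g j i := by
  unfold adjB
  rcases lt_trichotomy i j with h | h | h
  · have : ¬ j < i := by omega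
    simp [Nat.blt_eq, h, this, Bool.cond_eq_ite]
  · subst h; rfl
  · have : ¬ i < j := by omega
    simp [Nat.blt_eq, h, this, Bool.cond_eq_ite]

lemma adjB_self (g : List (List ℕ)) (i : ℕ) : adjB g i i = false := by
  simp [adjB, Bool.cond_eq_ite, Nat.blt_eq]

lemma adjB_lt (g : List (List ℕ)) {i j : ℕ} (h : i < j) : adjB g i j = edgeB g i j := by
  simp [adjB, Bool.cond_eq_ite, Nat.blt_eq, h]

variable (G) in
structure Realizes (g : List (List ℕ)) (f : ℕ → W) (X : Finset W) : Prop where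
  mem : ∀ w, w ∈ X ↔ ∃ i < g.length, f i = w
  inj : ∀ i j, i < g.length → j < g.length → f i = f j → i = j
  adj : ∀ i j, i < g.length → j < g.length → (G.Adj (f i) (f j) ↔ adjB g i j = true)

lemma Realizes.card {g : List (List ℕ)} {f : ℕ → W} {X : Finset W} (h : Realizes G g f X) :
    X.card = g.length := by
  have : X = (Finset.range g.length).image f := by
    ext w; rw [h.mem]; simp
  rw [this, Finset.card_image_of_injOn]
  · simp
  · intro i hi j hj hij; exact h.inj i j (by simpa using hi) (by simpa using hj) hij

lemma Realizes.mem' {g : List (List ℕ)} {f : ℕ → W} {X : Finset W} (h : Realizes G g f X)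
    {i : ℕ} (hi : i < g.length) : f i ∈ X := (h.mem _).2 ⟨i, hi, rfl⟩

lemma Realizes.degEq {g : List (List ℕ)} {f : ℕ → W} {X : Finset W} (h : Realizes G g f X)
    {i : ℕ} (hi : i < g.length) :
    (List.range g.length).countP (adjB g i) = e G {f i} X := by
  rw [e_single]
  have h1 : X.filter (G.Adj (f i)) =
      ((Finset.range g.length).filter (fun j => adjB g i j = true)).image f := by
    ext w
    simp only [Finset.mem_filter, Finset.mem_image, Finset.mem_range, h.mem]
    constructor
    · rintro ⟨⟨j, hj, rfl⟩, ha⟩; exact ⟨j, ⟨hj, (h.adj i j hi hj).1 ha⟩, rfl⟩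
    · rintro ⟨j, ⟨hj, ha⟩, rfl⟩; exact ⟨⟨j, hj, rfl⟩, (h.adj i j hi hj).2 ha⟩
  rw [h1, Finset.card_image_of_injOn]
  · rw [List.countP_eq_length_filter, Finset.card_def, Finset.filter_val, Finset.range_val,
      Multiset.range, Multiset.filter_coe, Multiset.coe_card]
    congr 1
    apply List.filter_congr
    intro x _
    simp
  · intro a ha b hb hab
    simp at ha hb
    exact h.inj a b ha.1 hb.1 hab

lemma Realizes.add {g : List (List ℕ)} {f : ℕ → W} {X : Finset W} (h : Realizes G g f X)
    (nb : List ℕ) {t : W} (ht : t ∉ X) (hnb : ∀ i ∈ nb, i < g.length)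
    (hadj : ∀ z ∈ X, G.Adj t z ↔ ∃ i ∈ nb, f i = z) :
    ∃ f', Realizes G (g ++ [nb]) f' (insert t X) ∧ f' g.length = t ∧
      ∀ i < g.length, f' i = f i := by
  have hf : ∀ i < g.length, (if i = g.length then t else f i) = f i := fun i hi => by
    rw [if_neg (by omega)]
  have hlast : ∀ i < g.length, edgeB (g ++ [nb]) i g.length = true ↔ i ∈ nb := by
    intro i hi
    simp [edgeB, List.getD_eq_getElem?_getD]
  have hold : ∀ i j, j < g.length → edgeB (g ++ [nb]) i j = edgeB g i j := by
    intro i j hj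
    simp [edgeB, List.getD_eq_getElem?_getD, List.getElem?_append_left hj]
  have hkey : ∀ i < g.length, G.Adj t (f i) ↔ i ∈ nb := by
    intro i hi
    rw [hadj _ (h.mem' hi)]
    constructor
    · rintro ⟨j, hj, hji⟩; rwa [← h.inj j i (hnb j hj) hi hji]
    · intro hi'; exact ⟨i, hi', rfl⟩
  refine ⟨fun i => if i = g.length then t else f i, ⟨?_, ?_, ?_⟩, by simp, hf⟩
  · intro w
    rw [Finset.mem_insert, h.mem]
    constructor
    · rintro (rfl | ⟨i, hi, rfl⟩)
      · exact ⟨g.length, by simp, by simp⟩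
      · exact ⟨i, by simp; omega, hf i hi⟩
    · rintro ⟨i, hi, rfl⟩
      by_cases hh : i = g.length
      · left; simp [hh]
      · right; exact ⟨i, by simp at hi; omega, by simp [hh]⟩
  · intro i j hi hj hij
    simp only [List.length_append, List.length_singleton] at hi hj
    by_cases h1 : i = g.length <;> by_cases h2 : j = g.length
    · omega
    · simp only [h1, h2, if_true, if_false] at hij
      exact absurd (hij ▸ h.mem' (by omega)) ht
    · simp only [h1, h2, if_true, if_false] at hij
      exact absurd (hij ▸ h.mem' (by omega)) ht
    · simp only [h1, h2, if_false] at hij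
      exact h.inj i j (by omega) (by omega) hij
  · intro i j hi hj
    simp only [List.length_append, List.length_singleton] at hi hj
    by_cases h1 : i = g.length <;> by_cases h2 : j = g.length
    · subst h1; rw [h2]; simp [adjB_self]
    · subst h1
      simp only [h2, if_true, if_false]
      rw [adjB_comm, adjB_lt _ (by omega), hlast j (by omega)]
      exact hkey j (by omega)
    · subst h2
      simp only [h1, if_true, if_false]
      rw [adjB_lt _ (by omega), hlast i (by omega), G.adj_comm]
      exact hkey i (by omega)
    · simp only [h1, h2, if_false]
      rw [h.adj i j (by omega) (by omega)]
      unfold adjB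
      rw [hold i j (by omega), hold j i (by omega)]

noncomputable def verts (f : ℕ → W) : List (ℕ × ℕ) → Finset W
  | [] => ∅
  | p :: c => insert (f p.1) (insert (f p.2) (verts f c))

lemma mem_verts {f : ℕ → W} {c : List (ℕ × ℕ)} {w : W} (h : w ∈ verts f c) :
    ∃ q ∈ c, w = f q.1 ∨ w = f q.2 := by
  induction c with
  | nil => simp [verts] at h
  | cons p c ih =>
    simp only [verts, Finset.mem_insert] at h
    rcases h with h | h | h
    · exact ⟨p, by simp, Or.inl h⟩
    · exact ⟨p, by simp, Or.inr h⟩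
    · obtain ⟨q, hq, h⟩ := ih h
      exact ⟨q, by simp [hq], h⟩

lemma certOK_sound {g : List (List ℕ)} {f : ℕ → W} {X : Finset W} (h : Realizes G g f X)
    (c : List (ℕ × ℕ)) (hc : certOK g c = true) :
    UPM G (verts f c) ∧ verts f c ⊆ X ∧ (verts f c).card = 2 * c.length ∧
      ∀ q ∈ c, q.1 < g.length ∧ q.2 < g.length := by
  induction c with
  | nil => exact ⟨UPM_empty, by simp [verts], by simp [verts], by simp⟩
  | cons p c ih =>
    simp only [certOK, Bool.and_eq_true, Nat.blt_eq, List.all_eq_true, bne_iff_ne, ne_eq,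
      Bool.not_eq_true'] at hc
    obtain ⟨⟨⟨⟨h1, h2⟩, h3⟩, h4⟩, h5⟩ := hc
    obtain ⟨i1, i2, i3, i4⟩ := ih h5
    have hu : f p.1 ∉ verts f c := by
      intro hm
      obtain ⟨q, hq, hh⟩ := mem_verts hm
      have := h4 q hq
      rcases hh with hh | hh
      · exact this.1.1.1.1.1 (h.inj _ _ h1 (i4 q hq).1 hh)
      · exact this.1.1.1.1.2 (h.inj _ _ h1 (i4 q hq).2 hh)
    have hv : f p.2 ∉ verts f c := by
      intro hm
      obtain ⟨q, hq, hh⟩ := mem_verts hm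
      have := h4 q hq
      rcases hh with hh | hh
      · exact this.1.1.1.2 (h.inj _ _ h2 (i4 q hq).1 hh)
      · exact this.1.1.2 (h.inj _ _ h2 (i4 q hq).2 hh)
    have hadj : G.Adj (f p.1) (f p.2) := (h.adj _ _ h1 h2).2 h3
    refine ⟨UPM_pendant i1 hu hv hadj ?_, ?_, ?_, ?_⟩
    · intro s hs ha
      obtain ⟨q, hq, hh⟩ := mem_verts hs
      have := h4 q hq
      rcases hh with rfl | rfl
      · have h6 := (h.adj _ _ h1 (i4 q hq).1).1 ha
        rw [this.1.2] at h6; exact absurd h6 (by simp)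
      · have h6 := (h.adj _ _ h1 (i4 q hq).2).1 ha
        rw [this.2] at h6; exact absurd h6 (by simp)
    · intro w hw
      simp only [verts, Finset.mem_insert] at hw
      rcases hw with rfl | rfl | hw
      exacts [h.mem' h1, h.mem' h2, i2 hw]
    · simp only [verts]
      rw [Finset.card_insert_of_notMem, Finset.card_insert_of_notMem hv, i3]
      · simp; ring
      · simp [hadj.ne, hu]
    · intro q hq
      rcases List.mem_cons.1 hq with rfl | hq
      · exact ⟨h1, h2⟩
      · exact i4 q hq

lemma isoOK_sound {g t : List (List ℕ)} {q : List ℕ} {f : ℕ → W} {X : Finset W}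
    (h : Realizes G g f X) (hq : isoOK g t q = true) : ∃ f', Realizes G t f' X := by
  simp only [isoOK, Bool.and_eq_true, beq_iff_eq, List.all_eq_true, Nat.blt_eq,
    decide_eq_true_eq, List.mem_range] at hq
  obtain ⟨⟨⟨⟨h1, h2⟩, h3⟩, h4⟩, h5⟩ := hq
  have hlt : ∀ i < g.length, q.getD i 0 < g.length := by
    intro i hi
    rw [List.getD_eq_getElem _ _ (by omega)]
    exact h3 _ (List.getElem_mem _)
  have hinj : ∀ i j, i < g.length → j < g.length → q.getD i 0 = q.getD j 0 → i = j := by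
    intro i j hi hj hij
    rw [List.getD_eq_getElem _ _ (by omega), List.getD_eq_getElem _ _ (by omega)] at hij
    exact (List.Nodup.getElem_inj_iff h4).1 hij
  refine ⟨fun i => f (q.getD i 0), ⟨?_, ?_, ?_⟩⟩
  · intro w
    constructor
    · intro hw
      by_contra hcon
      have hsub : (Finset.range g.length).image (fun i => f (q.getD i 0)) ⊆ X.erase w := by
        intro z hz
        simp only [Finset.mem_image, Finset.mem_range] at hz
        obtain ⟨i, hi, rfl⟩ := hz
        refine Finset.mem_erase.2 ⟨?_, h.mem' (hlt i hi)⟩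
        intro hh; exact hcon ⟨i, by omega, hh⟩
      have := Finset.card_le_card hsub
      rw [Finset.card_image_of_injOn, Finset.card_erase_of_mem hw, h.card] at this
      · have := Finset.card_pos.2 ⟨w, hw⟩
        rw [h.card] at this
        simp at *; omega
      · intro a ha b hb hab
        simp only [Finset.coe_range, Set.mem_Iio] at ha hb
        exact hinj a b ha hb (h.inj _ _ (hlt a ha) (hlt b hb) hab)
    · rintro ⟨i, hi, rfl⟩
      exact h.mem' (hlt i (by omega))
  · intro i j hi hj hij
    exact hinj i j (by omega) (by omega) (h.inj _ _ (hlt i (by omega)) (hlt j (by omega)) hij)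
  · intro i j hi hj
    rw [h.adj _ _ (hlt i (by omega)) (hlt j (by omega))]
    rcases lt_trichotomy i j with hh | hh | hh
    · rw [adjB_lt t hh, h5 j (by omega) i hh]
    · subst hh; simp [adjB_self]
    · rw [adjB_comm t, adjB_lt t hh, h5 i (by omega) j hh, adjB_comm]

lemma okG_sound {g : List (List ℕ)} {T : List (List (List ℕ))} {f : ℕ → W} {X : Finset W}
    (h : Realizes G g f X) (hq : okG T g = true) : d G X ≤ 0 ∨ ∃ t ∈ T, ∃ f', Realizes G t f' X := by
  simp only [okG, Bool.or_eq_true, List.any_eq_true, Bool.and_eq_true, Nat.ble_eq] at hq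
  rcases hq with ⟨c, _, hc1, hc2⟩ | ⟨q, _, t, ht, hq⟩
  · left
    obtain ⟨h1, h2, h3, _⟩ := certOK_sound h c hc2
    have := le_nuS h2 h1 h3.ge
    have := h.card
    unfold d; omega
  · right; exact ⟨t, ht, isoOK_sound h hq⟩

def listGraph (n : ℕ) (g : List (List ℕ)) : SimpleGraph (Fin n) where
  Adj i j := adjB g i j = true
  symm := ⟨fun i j h => by rw [adjB_comm]; exact h⟩
  loopless := ⟨fun i h => by rw [adjB_self] at h; exact absurd h (by simp)⟩

lemma Realizes.iso {g : List (List ℕ)} {f : ℕ → W} {X : Finset W} (h : Realizes G g f X)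
    {n : ℕ} (hn : g.length = n) (P : Set W) (hP : ∀ w, w ∈ P ↔ w ∈ X) :
    Nonempty (G.induce P ≃g listGraph n g) := by
  have hb : Function.Bijective (fun i : Fin n => (⟨f i, (hP _).2 (h.mem' (by omega))⟩ : P)) := by
    constructor
    · intro i j hij
      simp only [Subtype.mk.injEq] at hij
      exact Fin.ext (h.inj i j (by omega) (by omega) hij)
    · rintro ⟨w, hw⟩
      obtain ⟨i, hi, rfl⟩ := (h.mem w).1 ((hP w).1 hw)
      exact ⟨⟨i, by omega⟩, rfl⟩
  refine ⟨(RelIso.symm ⟨Equiv.ofBijective _ hb, ?_⟩)⟩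
  intro i j
  exact h.adj i j (by omega) (by omega)

end Real

set_option synthInstance.maxSize 4000
set_option synthInstance.maxHeartbeats 0
set_option maxRecDepth 100000
lemma eqb1 : BG1 = listGraph 10 b1 := by
  ext a b; simp only [BG1, fromEdgeSet_adj, Set.mem_insert_iff, Set.mem_singleton_iff, listGraph]; revert a b; decide +kernel
lemma eqb2 : BG2 = listGraph 13 b2 := by
  ext a b; simp only [BG2, fromEdgeSet_adj, Set.mem_insert_iff, Set.mem_singleton_iff, listGraph]; revert a b; decide +kernel
lemma eqb3 : BG3 = listGraph 16 b3 := by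
  ext a b; simp only [BG3, fromEdgeSet_adj, Set.mem_insert_iff, Set.mem_singleton_iff, listGraph]; revert a b; decide +kernel
lemma eqb4 : BG4 = listGraph 19 b4 := by
  ext a b; simp only [BG4, fromEdgeSet_adj, Set.mem_insert_iff, Set.mem_singleton_iff, listGraph]; revert a b; decide +kernel
lemma eqb5 : BG5 = listGraph 16 b5 := by
  ext a b; simp only [BG5, fromEdgeSet_adj, Set.mem_insert_iff, Set.mem_singleton_iff, listGraph]; revert a b; decide +kernel
lemma eqb6 : BG6 = listGraph 19 b6 := by
  ext a b; simp only [BG6, fromEdgeSet_adj, Set.mem_insert_iff, Set.mem_singleton_iff, listGraph]; revert a b; decide +kernel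
lemma eqb7 : BG7 = listGraph 19 b7 := by
  ext a b; simp only [BG7, fromEdgeSet_adj, Set.mem_insert_iff, Set.mem_singleton_iff, listGraph]; revert a b; decide +kernel
lemma eqb8 : BG8 = listGraph 22 b8 := by
  ext a b; simp only [BG8, fromEdgeSet_adj, Set.mem_insert_iff, Set.mem_singleton_iff, listGraph]; revert a b; decide +kernel
lemma eqb9 : BG9 = listGraph 25 b9 := by
  ext a b; simp only [BG9, fromEdgeSet_adj, Set.mem_insert_iff, Set.mem_singleton_iff, listGraph]; revert a b; decide +kernel
lemma eqH1 : GraphH1 = listGraph 14 bH1 := by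
  ext a b; simp only [GraphH1, fromEdgeSet_adj, Set.mem_insert_iff, Set.mem_singleton_iff, listGraph]; revert a b; decide +kernel
lemma eqH2 : GraphH2 = listGraph 20 bH2 := by
  ext a b; simp only [GraphH2, fromEdgeSet_adj, Set.mem_insert_iff, Set.mem_singleton_iff, listGraph]; revert a b; decide +kernel

lemma Realizes.isBlockB {W : Type} {G : SimpleGraph W} {g : List (List ℕ)} (hg : g ∈ blocks)
    {f : ℕ → W} {X : Finset W} (h : Realizes G g f X)
    (P : Set W) (hP : ∀ w, w ∈ P ↔ w ∈ X) : IsBlockB _ (G.induce P) := by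
  unfold IsBlockB
  rw [eqb1, eqb2, eqb3, eqb4, eqb5, eqb6, eqb7, eqb8, eqb9]
  simp only [blocks, List.mem_cons, List.not_mem_nil, or_false] at hg
  rcases hg with rfl | rfl | rfl | rfl | rfl | rfl | rfl | rfl | rfl
  · exact Or.inl (h.iso rfl P hP)
  · exact Or.inr (Or.inl (h.iso rfl P hP))
  · exact Or.inr (Or.inr (Or.inl (h.iso rfl P hP)))
  · exact Or.inr (Or.inr (Or.inr (Or.inl (h.iso rfl P hP))))
  · exact Or.inr (Or.inr (Or.inr (Or.inr (Or.inl (h.iso rfl P hP)))))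
  · exact Or.inr (Or.inr (Or.inr (Or.inr (Or.inr (Or.inl (h.iso rfl P hP))))))
  · exact Or.inr (Or.inr (Or.inr (Or.inr (Or.inr (Or.inr (Or.inl (h.iso rfl P hP)))))))
  · exact Or.inr (Or.inr (Or.inr (Or.inr (Or.inr (Or.inr (Or.inr (Or.inl (h.iso rfl P hP))))))))
  · exact Or.inr (Or.inr (Or.inr (Or.inr (Or.inr (Or.inr (Or.inr (Or.inr (h.iso rfl P hP))))))))

section Struct
open Classical
variable {W : Type} {G : SimpleGraph W}

variable (G) in
structure Sub5 : Prop where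
  deg : ∀ (x : W) (B : Finset W), e G {x} B ≤ 3
  tri : ∀ a b c, G.Adj a b → G.Adj b c → ¬ G.Adj a c
  c4 : ∀ a b c d, G.Adj a b → G.Adj b c → G.Adj c d → G.Adj d a → a = c ∨ b = d

variable (G) in
def Conn (Y : Finset W) : Prop :=
  Y.Nonempty ∧ ∀ A ⊆ Y, A.Nonempty → A ≠ Y → 1 ≤ e G A (Y \ A)

variable (G) in
def IsBlk (X : Finset W) : Prop := ∃ g ∈ blocks, ∃ f, Realizes G g f X

variable (G) in
inductive Bad : Finset W → Prop
  | single (x : W) : Bad {x}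
  | block (X : Finset W) (h : IsBlk G X) : Bad X
  | join (v : W) (X₁ X₂ X₃ : Finset W) (h₁ : Bad X₁) (h₂ : Bad X₂) (h₃ : Bad X₃)
      (v₁ : v ∉ X₁) (v₂ : v ∉ X₂) (v₃ : v ∉ X₃)
      (d₁₂ : Disjoint X₁ X₂) (d₁₃ : Disjoint X₁ X₃) (d₂₃ : Disjoint X₂ X₃)
      (e₁₂ : e G X₁ X₂ = 0) (e₁₃ : e G X₁ X₃ = 0) (e₂₃ : e G X₂ X₃ = 0)
      (e₁ : e G {v} X₁ = 1) (e₂ : e G {v} X₂ = 1) (e₃ : e G {v} X₃ = 1) :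
      Bad (insert v (X₁ ∪ X₂ ∪ X₃))

lemma Bad.card_mod {X : Finset W} (h : Bad G X) : X.card % 3 = 1 := by
  induction h with
  | single x => simp
  | block X h =>
    obtain ⟨g, hg, f, hf⟩ := h
    rw [hf.card]; exact blocks_mod g hg
  | join v X₁ X₂ X₃ h₁ h₂ h₃ v₁ v₂ v₃ d₁₂ d₁₃ d₂₃ _ _ _ _ _ _ i₁ i₂ i₃ =>
    rw [Finset.card_insert_of_notMem (by simp [v₁, v₂, v₃]),
      Finset.card_union_of_disjoint (by simp [Finset.disjoint_union_left, d₁₃, d₂₃]),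
      Finset.card_union_of_disjoint d₁₂]
    omega

variable (G) in
def IHyp (N : ℕ) : Prop := ∀ Z : Finset W, Z.card < N → Conn G Z → (∃ w ∈ Z, e G {w} Z ≤ 2) →
  d G Z ≤ 1 ∧ (d G Z = 1 → Bad G Z)

lemma e_split {A B : Finset W} (C : Finset W) (h : A ⊆ B) :
    e G C B = e G C A + e G C (B \ A) := by
  rw [← e_union_right C Finset.disjoint_sdiff, Finset.union_sdiff_of_subset h]

lemma e_split' {A B : Finset W} (C : Finset W) (h : A ⊆ B) :
    e G B C = e G A C + e G (B \ A) C := by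
  rw [e_comm, e_split C h, e_comm C, e_comm C]

lemma e_sub_split {C B X : Finset W} (h : C ⊆ B) (h' : B ⊆ X) :
    e G C (X \ C) = e G C (B \ C) + e G C (X \ B) := by
  rw [← e_union_right C (Finset.disjoint_left.2 (by simp +contextual))]
  congr 1; ext x; simp only [Finset.mem_sdiff, Finset.mem_union]
  have := @h x; have := @h' x; tauto

lemma bd_compl {A Y : Finset W} (h : A ⊆ Y) : e G (Y \ A) (Y \ (Y \ A)) = e G A (Y \ A) := by
  rw [Finset.sdiff_sdiff_eq_self h, e_comm]

lemma bd_add {A X Y : Finset W} (h : A ⊆ X) (h' : X ⊆ Y) (h0 : e G A (X \ A) = 0) :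
    e G X (Y \ X) = e G A (Y \ A) + e G (X \ A) (Y \ (X \ A)) := by
  rw [e_sub_split h h', e_sub_split Finset.sdiff_subset h', Finset.sdiff_sdiff_eq_self h, e_comm (X \ A) A,
    h0, e_split' _ h]
  omega

lemma comp_exists (X : Finset W) {x : W} (hx : x ∈ X) :
    ∃ A ⊆ X, x ∈ A ∧ Conn G A ∧ e G A (X \ A) = 0 := by
  induction hn : X.card using Nat.strong_induction_on generalizing X with
  | _ n ih =>
    by_cases hc : Conn G X
    · exact ⟨X, subset_rfl, hx, hc, by simp [e_eq_zero]⟩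
    · have : ∃ A ⊆ X, A.Nonempty ∧ A ≠ X ∧ e G A (X \ A) = 0 := by
        by_contra hcon
        push Not at hcon
        exact hc ⟨⟨x, hx⟩, fun A h1 h2 h3 => by have := hcon A h1 h2 h3; omega⟩
      obtain ⟨A, hA, hne, hneq, h0⟩ := this
      have : ∃ B ⊆ X, x ∈ B ∧ B ≠ X ∧ e G B (X \ B) = 0 := by
        by_cases hxA : x ∈ A
        · exact ⟨A, hA, hxA, hneq, h0⟩
        · refine ⟨X \ A, Finset.sdiff_subset, by simp [hx, hxA], ?_, by rw [bd_compl hA]; exact h0⟩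
          intro h
          obtain ⟨a, ha⟩ := hne
          have := hA ha
          rw [← h] at this
          simp [ha] at this
      obtain ⟨B, hB, hxB, hneq, h0⟩ := this
      obtain ⟨C, hC, hxC, hcC, hC0⟩ := ih B.card
        (hn ▸ Finset.card_lt_card (Finset.ssubset_iff_subset_ne.2 ⟨hB, hneq⟩)) B hxB rfl
      refine ⟨C, hC.trans hB, hxC, hcC, ?_⟩
      rw [e_sub_split hC hB, hC0]
      have := e_mono (G := G) hC (subset_refl (X \ B))
      omega

lemma d_split {A X : Finset W} (h : A ⊆ X) (h0 : e G A (X \ A) = 0) :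
    d G X ≤ d G A + d G (X \ A) := by
  have := d_union (G := G) (A := A) (B := X \ A) Finset.disjoint_sdiff (by omega)
  rwa [Finset.union_sdiff_of_subset h] at this

lemma d_mod (X : Finset W) : ∃ k : ℤ, d G X = X.card - 3 * k := ⟨nuS G X, rfl⟩

/-- degree of a vertex with an edge leaving the set -/
lemma deg_le_two (hG : Sub5 G) {A : Finset W} {x y : W} (h : G.Adj x y) (hy : y ∉ A) :
    e G {x} A ≤ 2 := by
  have := hG.deg x (insert y A)
  rw [e_single_insert_adj hy h] at this
  omega

lemma comp_good (hG : Sub5 G) {Y A : Finset W} (hY : Conn G Y) (ih : IHyp G Y.card)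
    (hA : Conn G A) (hAY : A ⊆ Y) (hne : A ≠ Y) : d G A ≤ 1 ∧ (d G A = 1 → Bad G A) := by
  refine ih A (Finset.card_lt_card (Finset.ssubset_iff_subset_ne.2 ⟨hAY, hne⟩)) hA ?_
  obtain ⟨a, ha, b, hb, hab⟩ := e_ge_one (hY.2 A hAY hA.1 hne)
  exact ⟨a, ha, deg_le_two hG hab (Finset.mem_sdiff.1 hb).2⟩

lemma extract (hG : Sub5 G) {Y : Finset W} (hY : Conn G Y) (ih : IHyp G Y.card) (X : Finset W)
    (hXY : X ⊆ Y) (hne : X ≠ Y) (hd : 1 ≤ d G X) :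
    ∃ A ⊆ X, Conn G A ∧ e G A (X \ A) = 0 ∧ d G A = 1 ∧ Bad G A := by
  induction hn : X.card using Nat.strong_induction_on generalizing X with
  | _ n ih2 =>
    have hX : X.Nonempty := by
      rw [Finset.nonempty_iff_ne_empty]; rintro rfl; rw [d_empty] at hd; omega
    obtain ⟨x, hx⟩ := hX
    obtain ⟨A, hA, hxA, hAc, hA0⟩ := comp_exists (G := G) X hx
    have hAne : A ≠ Y := by rintro rfl; exact hne (Finset.Subset.antisymm hXY hA)
    obtain ⟨h1, h2⟩ := comp_good hG hY ih hAc (hA.trans hXY) hAne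
    by_cases hdA : d G A = 1
    · exact ⟨A, hA, hAc, hA0, hdA, h2 hdA⟩
    · have := d_split hA hA0
      have hss : X \ A ⊂ X := by
        refine Finset.ssubset_iff_subset_ne.2 ⟨Finset.sdiff_subset, ?_⟩
        intro h; rw [← h] at hx; simp [hxA] at hx
      obtain ⟨B, hB, k1, k2, k3, k4⟩ := ih2 _ (hn ▸ Finset.card_lt_card hss) (X \ A)
        (Finset.sdiff_subset.trans hXY)
        (by rintro h; rw [h] at hss; exact hss.2 hXY) (by omega) rfl
      refine ⟨B, hB.trans Finset.sdiff_subset, k1, ?_, k3, k4⟩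
      rw [e_sub_split hB Finset.sdiff_subset, k2, Finset.sdiff_sdiff_eq_self hA]
      have := e_mono (G := G) hB (subset_refl A)
      rw [e_comm (X \ A) A] at this
      omega

lemma count (hG : Sub5 G) {Y : Finset W} (hY : Conn G Y) (ih : IHyp G Y.card) (t : ℕ)
    (ht : ∀ A ⊆ Y, A.Nonempty → A ≠ Y → t ≤ e G A (Y \ A)) (X : Finset W)
    (hXY : X ⊆ Y) (hne : X ≠ Y) : (t : ℤ) * d G X ≤ e G X (Y \ X) := by
  induction hn : X.card using Nat.strong_induction_on generalizing X with
  | _ n ih2 =>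
    rcases X.eq_empty_or_nonempty with rfl | ⟨x, hx⟩
    · rw [d_empty]; simp
    obtain ⟨A, hA, hxA, hAc, hA0⟩ := comp_exists (G := G) X hx
    have hAne : A ≠ Y := by rintro rfl; exact hne (Finset.Subset.antisymm hXY hA)
    obtain ⟨h1, h2⟩ := comp_good hG hY ih hAc (hA.trans hXY) hAne
    have := d_split hA hA0
    have hss : X \ A ⊂ X := by
      refine Finset.ssubset_iff_subset_ne.2 ⟨Finset.sdiff_subset, ?_⟩
      intro h; rw [← h] at hx; simp [hxA] at hx
    have h3 := ih2 _ (hn ▸ Finset.card_lt_card hss) (X \ A)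
        (Finset.sdiff_subset.trans hXY)
        (by rintro h; rw [h] at hss; exact hss.2 hXY) rfl
    have h4 := ht A (hA.trans hXY) hAc.1 hAne
    have h5 := bd_add hA hXY hA0
    have h6 : (t : ℤ) * d G X ≤ t * 1 + t * d G (X \ A) := by
      rw [← mul_add]
      exact mul_le_mul_of_nonneg_left (by omega) (by positivity)
    rw [h5]; push_cast; omega

lemma erase_bd {H : Finset W} {x : W} (hx : x ∈ H) :
    e G (H.erase x) (H \ H.erase x) = e G {x} H := by
  have h1 : H \ H.erase x = {x} := by
    ext z; simp only [Finset.mem_sdiff, Finset.mem_erase, Finset.mem_singleton]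
    constructor
    · tauto
    · rintro rfl; exact ⟨hx, by simp⟩
  rw [h1, e_comm, e_split {x} (Finset.erase_subset x H), h1, e_single_single, if_neg (G.loopless.irrefl x)]
  omega

lemma IHyp.mono {m n : ℕ} (h : IHyp G n) (hmn : m ≤ n) : IHyp G m :=
  fun Z hZ => h Z (by omega)

lemma lemF (hG : Sub5 G) {H : Finset W} (hH : Conn G H) (ih : IHyp G H.card) (hc : d G H = 1)
    {x : W} (hx : x ∈ H) (hdx : e G {x} H ≤ 2) : d G (H.erase x) ≤ 0 := by
  have h := count hG hH ih 1 hH.2 (H.erase x) (Finset.erase_subset _ _)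
    (by intro h; rw [← h] at hx; simp at hx)
  rw [erase_bd hx] at h
  have h1 := Finset.card_erase_of_mem hx
  have h2 := Finset.card_pos.2 ⟨x, hx⟩
  obtain ⟨k, hk⟩ := d_mod (G := G) H
  obtain ⟨l, hl⟩ := d_mod (G := G) (H.erase x)
  push_cast at h
  omega

lemma side_conn {Y A : Finset W} (hY : Conn G Y) (hAY : A ⊆ Y) (hA : A.Nonempty) (hne : A ≠ Y)
    (hb : e G A (Y \ A) = 1) : Conn G A := by
  refine ⟨hA, fun A' h1 h2 h3 => ?_⟩
  by_contra hcon
  have h0 : e G A' (A \ A') = 0 := by omega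
  have h4 := bd_add h1 hAY h0
  have h5 := hY.2 A' (h1.trans hAY) h2 (by rintro rfl; exact hne (Finset.Subset.antisymm hAY h1))
  have h6 := hY.2 (A \ A') (Finset.sdiff_subset.trans hAY)
    (by rw [Finset.sdiff_nonempty]; exact fun h => h3 (Finset.Subset.antisymm h1 h))
    (by rintro h; apply hne; apply Finset.Subset.antisymm hAY; rw [← h]; exact Finset.sdiff_subset)
  omega

lemma bridge_nu {Y A : Finset W} (hAY : A ⊆ Y) {x y : W} (hx : x ∈ A) (hy : y ∈ Y \ A)
    (hxy : G.Adj x y) (hb : e G A (Y \ A) = 1) :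
    d G Y ≤ d G (A.erase x) + d G ((Y \ A).erase y) - 1 := by
  have hA' : insert x (A.erase x) = A := Finset.insert_erase hx
  have hB' : insert y ((Y \ A).erase y) = Y \ A := Finset.insert_erase hy
  have := nuS_bridge (G := G) (A := A.erase x) (B := (Y \ A).erase y) (Y := Y) (x := x) (y := y)
    (by simp) (by simp) (by rw [hA', hB']; exact Finset.disjoint_sdiff)
    (by rw [hA', hB', Finset.union_sdiff_of_subset hAY]) hxy
    (by rw [hA', hB']; intro a ha b hb' hab; exact e_le_one hb.le ha hb' hab hx hy hxy)
  have h1 := Finset.card_erase_of_mem hx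
  have h2 := Finset.card_erase_of_mem hy
  have h3 := Finset.card_pos.2 ⟨x, hx⟩
  have h4 := Finset.card_pos.2 ⟨y, hy⟩
  have h5 := Finset.card_sdiff_add_card_eq_card hAY
  unfold d; omega

lemma bridge_half (hG : Sub5 G) {Y A : Finset W} (hY : Conn G Y) (ih : IHyp G Y.card) (hAY : A ⊆ Y)
    (hA : A.Nonempty) (hne : A ≠ Y) (hb : e G A (Y \ A) = 1) (hdA : d G A = 1)
    (hdY : d G Y = 1) (hdB : d G (Y \ A) ≤ 0) : Bad G Y := by
  obtain ⟨x, hx, y, hy, hxy⟩ := e_ge_one hb.ge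
  have hnuY := bridge_nu hAY hx hy hxy hb
  have hcA := side_conn hY hAY hA hne hb
  have hlt : A.card < Y.card := Finset.card_lt_card (Finset.ssubset_iff_subset_ne.2 ⟨hAY, hne⟩)
  have hyA : y ∉ A := (Finset.mem_sdiff.1 hy).2
  have hxB : x ∉ Y \ A := by simp [hx]
  have hF := lemF hG hcA (ih.mono hlt.le) hdA hx (deg_le_two hG hxy hyA)
  have hbadA := (comp_good hG hY ih hcA hAY hne).2 hdA
  set B := Y \ A with hB
  have hBY : B ⊆ Y := Finset.sdiff_subset
  have hBne : B ≠ Y := by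
    intro h; exact hxB (h ▸ hAY hx)
  have hYB : Y \ B = A := Finset.sdiff_sdiff_eq_self hAY
  have hbB : e G B (Y \ B) = 1 := by rw [hYB, e_comm]; exact hb
  have hcB := side_conn hY hBY ⟨y, hy⟩ hBne hbB
  set X := B.erase y with hX
  have hXB : X ⊆ B := Finset.erase_subset _ _
  have hXneB : X ≠ B := fun h => by have := h ▸ hy; simp [hX] at this
  have hXne : X ≠ Y := by rintro h; exact hXneB (Finset.Subset.antisymm hXB (h ▸ hBY))
  have hdX : 2 ≤ d G X := by omega
  have hbX : e G X (B \ X) ≤ 2 := by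
    rw [erase_bd hy]; exact deg_le_two hG hxy.symm hxB
  obtain ⟨B₁, hB1, c1, z1, d1, bad1⟩ := extract hG hY ih X (hXB.trans hBY) hXne (by omega)
  have hs1 := d_split hB1 z1
  have hX1 : X \ B₁ ⊆ X := Finset.sdiff_subset
  obtain ⟨B₂, hB2, c2, z2, d2, bad2⟩ := extract hG hY ih (X \ B₁) (hX1.trans (hXB.trans hBY))
    (by rintro h; exact hXne (Finset.Subset.antisymm (hXB.trans hBY) (h ▸ hX1))) (by omega)
  have q1 := bd_add hB1 hXB z1
  have q2 := bd_add hB2 (hX1.trans hXB) z2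
  have nB : ∀ Z ⊆ X, Z ≠ B := fun Z hZ h => hXneB (Finset.Subset.antisymm hXB (h ▸ hZ))
  have p1 := hcB.2 B₁ (hB1.trans hXB) c1.1 (nB _ hB1)
  have p2 := hcB.2 B₂ (hB2.trans (hX1.trans hXB)) c2.1 (nB _ (hB2.trans hX1))
  have hR : (X \ B₁) \ B₂ = ∅ := by
    by_contra hcon
    have := hcB.2 ((X \ B₁) \ B₂) (Finset.sdiff_subset.trans (hX1.trans hXB))
      (Finset.nonempty_iff_ne_empty.2 hcon) (nB _ (Finset.sdiff_subset.trans hX1))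
    omega
  have r1 : e G B₁ (B \ B₁) = 1 := by omega
  have r2 : e G B₂ (B \ B₂) = 1 := by omega
  have hXeq : X = B₁ ∪ B₂ := by
    have h1 : X \ B₁ = B₂ := Finset.Subset.antisymm (Finset.sdiff_eq_empty_iff_subset.1 hR) hB2
    rw [← h1, Finset.union_sdiff_of_subset hB1]
  have hX2 : X \ B₁ = B₂ := Finset.Subset.antisymm (Finset.sdiff_eq_empty_iff_subset.1 hR) hB2
  have hyX : B \ X = {y} := by
    ext z; simp only [hX, Finset.mem_sdiff, Finset.mem_erase, Finset.mem_singleton]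
    constructor
    · tauto
    · rintro rfl; exact ⟨hy, by simp⟩
  have hz1 := e_sub_split (G := G) hB1 hXB
  have hz2 := e_sub_split (G := G) (hB2.trans hX1) hXB
  rw [hyX, e_comm _ {y}] at hz1 hz2
  have hd12 : Disjoint B₁ B₂ := by rw [← hX2]; exact Finset.disjoint_sdiff
  have hX3 : X \ B₂ = B₁ := by
    rw [hXeq, Finset.union_sdiff_right, Finset.sdiff_eq_self_of_disjoint hd12]
  rw [hX3, e_comm B₂ B₁] at hz2
  rw [hX2] at hz1 z1
  have hdA' : Disjoint A B := Finset.disjoint_sdiff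
  have hAX : e G A X = 0 := by
    rw [e_eq_zero]; intro a ha b hbX' hab
    have := (e_le_one hb.le ha (hXB hbX') hab hx hy hxy).2
    subst this; simp [hX] at hbX'
  have hAsub : ∀ Z ⊆ X, e G A Z = 0 := fun Z hZ => by
    have := e_mono (G := G) (subset_refl A) hZ; omega
  have hyeA : e G {y} A = 1 := by
    have h1 := e_split (G := G) A (show {y} ⊆ B by simpa using hy)
    have : B \ {y} = X := by rw [hX, Finset.sdiff_singleton_eq_erase]
    rw [this, hAX, hb, e_comm] at h1; omega
  have hYeq : Y = insert y (A ∪ B₁ ∪ B₂) := by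
    rw [Finset.union_assoc, ← hXeq, ← Finset.union_insert, hX, Finset.insert_erase hy,
      Finset.union_sdiff_of_subset hAY]
  rw [hYeq]
  have hB2X : B₂ ⊆ X := hB2.trans hX1
  refine Bad.join y A B₁ B₂ hbadA bad1 bad2 hyA (fun h => ?_) (fun h => ?_)
    (Finset.disjoint_of_subset_right (hB1.trans hXB) hdA')
    (Finset.disjoint_of_subset_right (hB2X.trans hXB) hdA') hd12
    (hAsub _ hB1) (hAsub _ hB2X) z1 hyeA ?_ ?_
  · have := hB1 h; simp [hX] at this
  · have := hB2X h; simp [hX] at this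
  · omega
  · omega

lemma bridge_lemma (hG : Sub5 G) {Y A : Finset W} (hY : Conn G Y) (ih : IHyp G Y.card) (hAY : A ⊆ Y)
    (hA : A.Nonempty) (hne : A ≠ Y) (hb : e G A (Y \ A) ≤ 1) :
    d G Y ≤ 1 ∧ (d G Y = 1 → Bad G Y) := by
  replace hb : e G A (Y \ A) = 1 := le_antisymm hb (hY.2 A hAY hA hne)
  obtain ⟨x, hx, y, hy, hxy⟩ := e_ge_one hb.ge
  have hnuY := bridge_nu hAY hx hy hxy hb
  have hcA := side_conn hY hAY hA hne hb
  have hltA : A.card < Y.card := Finset.card_lt_card (Finset.ssubset_iff_subset_ne.2 ⟨hAY, hne⟩)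
  have hyA : y ∉ A := (Finset.mem_sdiff.1 hy).2
  have hxB : x ∉ Y \ A := by simp [hx]
  have hBY : Y \ A ⊆ Y := Finset.sdiff_subset
  have hBne : Y \ A ≠ Y := by
    intro h; exact hxB (by rw [h]; exact hAY hx)
  have hbB : e G (Y \ A) (Y \ (Y \ A)) = 1 := by rw [bd_compl hAY]; exact hb
  have hcB := side_conn hY hBY ⟨y, hy⟩ hBne hbB
  have hltB : (Y \ A).card < Y.card :=
    Finset.card_lt_card (Finset.ssubset_iff_subset_ne.2 ⟨hBY, hBne⟩)
  have gA := (comp_good hG hY ih hcA hAY hne).1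
  have gB := (comp_good hG hY ih hcB hBY hBne).1
  have hd := d_union (G := G) (A := A) (B := Y \ A) Finset.disjoint_sdiff hb.le
  rw [Finset.union_sdiff_of_subset hAY] at hd
  by_cases kA : d G A = 1 <;> by_cases kB : d G (Y \ A) = 1
  · have f1 := lemF hG hcA (ih.mono hltA.le) kA hx (deg_le_two hG hxy hyA)
    have f2 := lemF hG hcB (ih.mono hltB.le) kB hy (deg_le_two hG hxy.symm hxB)
    exact ⟨by omega, fun h => by omega⟩
  · exact ⟨by omega, fun h => bridge_half hG hY ih hAY hA hne hb kA h (by omega)⟩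
  · refine ⟨by omega, fun h => bridge_half hG hY ih hBY ⟨y, hy⟩ hBne hbB kB h ?_⟩
    rw [Finset.sdiff_sdiff_eq_self hAY]; omega
  · exact ⟨by omega, fun h => by omega⟩

end Struct

section Struct2
open Classical
variable {W : Type} {G : SimpleGraph W}

variable (G) in
def BL (Y : Finset W) : Prop := ∀ A ⊆ Y, A.Nonempty → A ≠ Y → 2 ≤ e G A (Y \ A)

lemma two_edges {A B : Finset W} (h : e G A B = 2) : ∃ a₁ b₁ a₂ b₂, a₁ ∈ A ∧ b₁ ∈ B ∧ a₂ ∈ A ∧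
    b₂ ∈ B ∧ G.Adj a₁ b₁ ∧ G.Adj a₂ b₂ ∧ (a₁, b₁) ≠ (a₂, b₂) ∧
    ∀ a ∈ A, ∀ b ∈ B, G.Adj a b → (a = a₁ ∧ b = b₁) ∨ (a = a₂ ∧ b = b₂) := by
  obtain ⟨⟨a₁, b₁⟩, ⟨a₂, b₂⟩, hne, heq⟩ := Finset.card_eq_two.1 h
  have key : ∀ p : W × W, (p.1 ∈ A ∧ p.2 ∈ B ∧ G.Adj p.1 p.2) ↔ p = (a₁, b₁) ∨ p = (a₂, b₂) := by
    intro p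
    have := Finset.ext_iff.1 heq p
    simpa [and_assoc] using this
  have k1 := (key (a₁, b₁)).2 (by simp)
  have k2 := (key (a₂, b₂)).2 (by simp)
  refine ⟨a₁, b₁, a₂, b₂, k1.1, k1.2.1, k2.1, k2.2.1, k1.2.2, k2.2.2, hne, ?_⟩
  intro a ha b hb hab
  simpa using (key (a, b)).1 ⟨ha, hb, hab⟩

lemma single_two {Y : Finset W} {p : W} (h : 2 ≤ e G {p} (Y \ {p})) {x y : W}
    (hN : ∀ z ∈ Y, G.Adj p z → z = x ∨ z = y) : G.Adj p x ∧ G.Adj p y := by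
  rw [e_single] at h
  obtain ⟨a, ha, b, hb, hab⟩ := Finset.one_lt_card.1 h
  simp only [Finset.mem_filter, Finset.mem_sdiff] at ha hb
  have h1 := hN a ha.1.1 ha.2
  have h2 := hN b hb.1.1 hb.2
  rcases h1 with rfl | rfl <;> rcases h2 with rfl | rfl
  · exact absurd rfl hab
  · exact ⟨ha.2, hb.2⟩
  · exact ⟨hb.2, ha.2⟩
  · exact absurd rfl hab

lemma twocut (hG : Sub5 G) {Y : Finset W} (hY : Conn G Y) (ih : IHyp G Y.card) (hBL : BL G Y)
    (hdY : 1 ≤ d G Y) (X : Finset W) (hXY : X ⊆ Y) (hne : X ≠ Y) (hb : e G X (Y \ X) ≤ 2)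
    (hc : X.card % 3 = 1) : ∃ p, X = {p} := by
  induction hn : X.card using Nat.strong_induction_on generalizing X with
  | _ n ih2 =>
    have hXne : X.Nonempty := by rw [← Finset.card_pos]; omega
    replace hb : e G X (Y \ X) = 2 := le_antisymm hb (hBL X hXY hXne hne)
    obtain ⟨x₁, y₁, x₂, y₂, hx1, hy1, hx2, hy2, ha1, ha2, hpne, hall⟩ := two_edges hb
    have hy1X : y₁ ∉ X := (Finset.mem_sdiff.1 hy1).2
    have hy2X : y₂ ∉ X := (Finset.mem_sdiff.1 hy2).2
    have hy1Y : y₁ ∈ Y := (Finset.mem_sdiff.1 hy1).1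
    have hy2Y : y₂ ∈ Y := (Finset.mem_sdiff.1 hy2).1
    by_cases hxx : x₁ = x₂
    · subst hxx
      refine ⟨x₁, ?_⟩
      by_contra hcon
      have hyy : y₁ ≠ y₂ := fun h => hpne (by rw [h])
      have h1 : (X.erase x₁).Nonempty := by
        rw [Finset.nonempty_iff_ne_empty]
        intro h
        rw [Finset.erase_eq_empty_iff] at h
        rcases h with h | h
        · rw [h] at hx1; simp at hx1
        · exact hcon h
      have h2 := hBL (X.erase x₁) ((Finset.erase_subset _ _).trans hXY) h1
        (by intro h; rw [← h] at hy1Y; exact hy1X (Finset.mem_of_mem_erase hy1Y))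
      rw [e_sub_split (Finset.erase_subset _ _) hXY, erase_bd hx1] at h2
      have h3 : e G (X.erase x₁) (Y \ X) = 0 := by
        rw [e_eq_zero]; intro a ha b hb hab
        rcases hall a (Finset.mem_of_mem_erase ha) b hb hab with h | h <;>
        · rw [h.1] at ha; simp at ha
      have h4 := hG.deg x₁ (insert y₁ (insert y₂ X))
      rw [e_single_insert_adj (by simp [hyy, hy1X]) ha1, e_single_insert_adj hy2X ha2] at h4
      omega
    · exfalso
      set A := (X.erase x₁).erase x₂ with hA
      set B := (Y \ X).erase y₁ with hB
      have hAX : A ⊆ X := (Finset.erase_subset _ _).trans (Finset.erase_subset _ _)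
      have hx2' : x₂ ∈ X.erase x₁ := by simp [Ne.symm hxx, hx2]
      have cA1 : A.card = _ := Finset.card_erase_of_mem hx2'
      have cA2 := Finset.card_erase_of_mem hx1
      have cA0 := Finset.card_pos.2 ⟨_, hx2'⟩
      have cA00 := Finset.card_pos.2 ⟨_, hx1⟩
      have cB : B.card = _ := Finset.card_erase_of_mem hy1
      have cB0 := Finset.card_pos.2 ⟨_, hy1⟩
      have cY := Finset.card_sdiff_add_card_eq_card hXY
      -- nu
      have hins : insert x₁ A = X.erase x₂ := by
        rw [hA, Finset.erase_right_comm, Finset.insert_erase (by simp [hxx, hx1])]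
      have hinsB : insert y₁ B = Y \ X := Finset.insert_erase hy1
      have hnu := nuS_bridge (G := G) (A := A) (B := B) (Y := Y) (x := x₁) (y := y₁)
        (by simp [hA]) (by simp [hB])
        (by rw [hins, hinsB]
            exact Finset.disjoint_of_subset_left (Finset.erase_subset _ _) Finset.disjoint_sdiff)
        (by rw [hins, hinsB]
            exact Finset.union_subset ((Finset.erase_subset _ _).trans hXY) Finset.sdiff_subset)
        ha1
        (by rw [hins, hinsB]
            intro a ha b hb hab
            rcases hall a (Finset.mem_of_mem_erase ha) b hb hab with h | h
            · exact h
            · rw [h.1] at ha; simp at ha)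
      have hdle : d G Y ≤ d G A + d G B := by unfold d; omega
      -- bound on B
      have hBY : B ⊆ Y := (Finset.erase_subset _ _).trans Finset.sdiff_subset
      have hBne : B ≠ Y := by intro h; rw [← h] at hy1Y; simp [hB] at hy1Y
      have hbB : e G B (Y \ B) ≤ 3 := by
        rw [e_sub_split (Finset.erase_subset _ _) Finset.sdiff_subset, erase_bd hy1,
          Finset.sdiff_sdiff_eq_self hXY]
        change _ + e G B X ≤ 3
        have h1 : e G {y₁} (Y \ X) ≤ 2 := deg_le_two hG ha1.symm (by simp [hx1])
        have h2 := e_split' (G := G) X (show {y₁} ⊆ Y \ X by simpa using hy1)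
        have h3 : 1 ≤ e G {y₁} X := e_pos (by simp) hx1 ha1.symm
        rw [Finset.sdiff_singleton_eq_erase, ← hB, e_comm, hb] at h2
        omega
      have hdB := count hG hY ih 2 hBL B hBY hBne
      have hAY := hAX.trans hXY
      have hAne : A ≠ Y := by intro h; exact hy1X (hAX (h ▸ hy1Y))
      have hA0 : e G A (Y \ X) = 0 := by
        rw [e_eq_zero]; intro a ha b hb hab
        rcases hall a (hAX ha) b hb hab with h | h <;>
        · rw [h.1] at ha; simp [hA] at ha
      have hXA : X \ A = {x₁, x₂} := by
        ext z; simp only [hA, Finset.mem_sdiff, Finset.mem_erase, Finset.mem_insert,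
          Finset.mem_singleton]
        constructor
        · rintro ⟨h1, h2⟩; by_contra hcon; push Not at hcon; exact h2 ⟨hcon.2, hcon.1, h1⟩
        · rintro (rfl | rfl) <;> simp [*]
      have hbA : e G A (Y \ A) ≤ 4 := by
        rw [e_sub_split hAX hXY, hA0, hXA, e_comm, Finset.insert_eq, e_union_left _ (by simpa using hxx)]
        have h1 : e G {x₁} A ≤ 2 := deg_le_two hG ha1 (fun h => hy1X (hAX h))
        have h2 : e G {x₂} A ≤ 2 := deg_le_two hG ha2 (fun h => hy2X (hAX h))
        omega
      have hdA := count hG hY ih 2 hBL A hAY hAne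
      obtain ⟨k, hk⟩ := d_mod (G := G) A
      have hdA2 : d G A = 2 := by push_cast at hdA hdB; omega
      obtain ⟨A₁, s1, c1, z1, d1, -⟩ := extract hG hY ih A hAY hAne (by omega)
      have hs1 := d_split s1 z1
      have hAA : A \ A₁ ⊆ A := Finset.sdiff_subset
      have hNA : ∀ Z ⊆ A, Z ≠ Y := fun Z hZ h => hAne (Finset.Subset.antisymm hAY (h ▸ hZ))
      obtain ⟨A₂, s2, c2, z2, d2, -⟩ := extract hG hY ih (A \ A₁) (hAA.trans hAY) (hNA _ hAA) (by omega)
      have q1 := bd_add s1 hAY z1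
      have q2 := bd_add s2 (hAA.trans hAY) z2
      have p1 := hBL A₁ (s1.trans hAY) c1.1 (hNA _ s1)
      have p2 := hBL A₂ (s2.trans (hAA.trans hAY)) c2.1 (hNA _ (s2.trans hAA))
      have hltA : A.card < n := by omega
      have l1 := Finset.card_le_card s1
      have l2 := Finset.card_le_card (s2.trans hAA)
      obtain ⟨k1, hk1⟩ := d_mod (G := G) A₁
      obtain ⟨k2, hk2⟩ := d_mod (G := G) A₂
      obtain ⟨p, rfl⟩ := ih2 _ (by omega) A₁ (s1.trans hAY) (hNA _ s1) (by omega) (by omega) rfl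
      obtain ⟨q, rfl⟩ := ih2 _ (by omega) A₂ (s2.trans (hAA.trans hAY)) (hNA _ (s2.trans hAA)) (by omega) (by omega) rfl
      have hzone : ∀ r ∈ A, (∀ z ∈ A, ¬ G.Adj r z) → ∀ z ∈ Y, G.Adj r z → z = x₁ ∨ z = x₂ := by
        intro r hr h z hz hrz
        by_contra hcon
        push Not at hcon
        by_cases hzX : z ∈ X
        · exact h z (by simp [hA, hzX, hcon.1, hcon.2]) hrz
        · exact e_eq_zero.1 hA0 r hr z (by simp [hz, hzX]) hrz
      have hpA : p ∈ A := s1 (by simp)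
      have hqA' : q ∈ A \ {p} := s2 (by simp)
      have hqA : q ∈ A := hAA hqA'
      have hp : ∀ z ∈ A, ¬ G.Adj p z := by
        intro z hz hpz
        refine e_eq_zero.1 z1 p (by simp) z ?_ hpz
        simp [hz, hpz.ne.symm]
      have hq : ∀ z ∈ A, ¬ G.Adj q z := by
        intro z hz hqz
        by_cases hzp : z = p
        · subst hzp; exact hp q hqA hqz.symm
        · refine e_eq_zero.1 z2 q (by simp) z ?_ hqz
          simp [hz, hqz.ne.symm, hzp]
      have f1 := single_two p1 (hzone p hpA hp)
      have f2 := single_two p2 (hzone q hqA hq)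
      have hpq : q ≠ p := by simpa [hqA] using hqA'
      rcases hG.c4 p x₁ q x₂ f1.1 f2.1.symm f2.2 f1.2.symm with h | h
      · exact hpq h.symm
      · exact hxx h

lemma Bad.join_bd (hG : Sub5 G) {Y : Finset W} {v : W} {X₁ X₂ X₃ : Finset W}
      (v₁ : v ∉ X₁) (v₂ : v ∉ X₂) (v₃ : v ∉ X₃)
      (d₁₂ : Disjoint X₁ X₂) (d₁₃ : Disjoint X₁ X₃) (d₂₃ : Disjoint X₂ X₃)
      (e₁₂ : e G X₁ X₂ = 0) (e₁₃ : e G X₁ X₃ = 0) (e₂₃ : e G X₂ X₃ = 0)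
      (e₁ : e G {v} X₁ = 1) (e₂ : e G {v} X₂ = 1) (e₃ : e G {v} X₃ = 1)
      (hXY : insert v (X₁ ∪ X₂ ∪ X₃) ⊆ Y) :
    e G X₁ (Y \ X₁) + e G X₂ (Y \ X₂) + e G X₃ (Y \ X₃) =
      e G (insert v (X₁ ∪ X₂ ∪ X₃)) (Y \ insert v (X₁ ∪ X₂ ∪ X₃)) + 3 := by
  set X := insert v (X₁ ∪ X₂ ∪ X₃) with hX
  have dv : Disjoint {v} (X₁ ∪ X₂ ∪ X₃) := by simp [v₁, v₂, v₃]
  have d3 : Disjoint (X₁ ∪ X₂) X₃ := by simp [Finset.disjoint_union_left, d₁₃, d₂₃]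
  have hXe : X = {v} ∪ (X₁ ∪ X₂ ∪ X₃) := by rw [hX, Finset.insert_eq]
  have h0 : e G {v} (Y \ X) = 0 := by
    have h1 := hG.deg v Y
    rw [e_split {v} hXY, hXe, e_union_right _ dv, e_union_right _ d3, e_union_right _ d₁₂] at h1
    rw [hXe]; omega
  have hb : e G X (Y \ X) = e G X₁ (Y \ X) + e G X₂ (Y \ X) + e G X₃ (Y \ X) := by
    conv_lhs => rw [hXe, e_union_left _ dv, e_union_left _ d3, e_union_left _ d₁₂, ← hXe, h0]
    omega
  have s1 : X₁ ⊆ X := by intro z hz; simp [hX, hz]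
  have s2 : X₂ ⊆ X := by intro z hz; simp [hX, hz]
  have s3 : X₃ ⊆ X := by intro z hz; simp [hX, hz]
  have aux : ∀ P Q : Finset W, X = P ∪ Q → Disjoint P Q → X \ P = Q := by
    intro P Q h1 h2; rw [h1, Finset.union_sdiff_cancel_left h2]
  have t1 : X \ X₁ = {v} ∪ (X₂ ∪ X₃) := aux _ _
    (by ext z; simp only [hX, Finset.mem_union, Finset.mem_insert, Finset.mem_singleton]; clear * -; tauto)
    (by simp [Finset.disjoint_union_right, d₁₂, d₁₃, v₁])
  have t2 : X \ X₂ = {v} ∪ (X₁ ∪ X₃) := aux _ _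
    (by ext z; simp only [hX, Finset.mem_union, Finset.mem_insert, Finset.mem_singleton]; clear * -; tauto)
    (by simp [Finset.disjoint_union_right, d₁₂.symm, d₂₃, v₂])
  have t3 : X \ X₃ = {v} ∪ (X₁ ∪ X₂) := aux _ _
    (by ext z; simp only [hX, Finset.mem_union, Finset.mem_insert, Finset.mem_singleton]; clear * -; tauto)
    (by simp [Finset.disjoint_union_right, d₁₃.symm, d₂₃.symm, v₃])
  rw [e_sub_split s1 hXY, e_sub_split s2 hXY, e_sub_split s3 hXY, hb, t1, t2, t3,
    e_union_right X₁ (show Disjoint {v} (X₂ ∪ X₃) by simp [v₂, v₃]),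
    e_union_right X₂ (show Disjoint {v} (X₁ ∪ X₃) by simp [v₁, v₃]),
    e_union_right X₃ (show Disjoint {v} (X₁ ∪ X₂) by simp [v₁, v₂]), e_union_right _ d₂₃, e_union_right _ d₁₃,
    e_union_right _ d₁₂, e_comm X₁ {v}, e_comm X₂ {v}, e_comm X₃ {v}, e_comm X₂ X₁, e_comm X₃ X₁,
    e_comm X₃ X₂]
  omega

variable (G) in
def Core (X : Finset W) : Prop := ∃ g ∈ cores, ∃ f, Realizes G g f X

lemma e_single_mem {x y : W} (h : e G {x} {y} = 1) : G.Adj x y := by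
  rw [e_single_single] at h; by_contra hc; simp [hc] at h

lemma e_single_not {x y : W} (h : e G {x} {y} = 0) : ¬ G.Adj x y := by
  rw [e_single_single] at h; intro hc; simp [hc] at h

lemma claw_core {v a b c : W} (va : G.Adj v a) (vb : G.Adj v b) (vc : G.Adj v c)
    (ab : ¬ G.Adj a b) (ac : ¬ G.Adj a c) (bc : ¬ G.Adj b c) (nab : a ≠ b) (nac : a ≠ c)
    (nbc : b ≠ c) : Core G (insert v ({a} ∪ {b} ∪ {c})) := by
  refine ⟨bclaw, by simp [cores], fun i => if i = 0 then v else if i = 1 then a else if i = 2 then b else c, ?_, ?_, ?_⟩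
  · intro w
    have : bclaw.length = 4 := rfl
    rw [this]
    simp only [Finset.mem_insert, Finset.mem_union, Finset.mem_singleton]
    constructor
    · rintro (rfl | (rfl | rfl) | rfl)
      exacts [⟨0, by simp, by simp⟩, ⟨1, by simp, by simp⟩, ⟨2, by simp, by simp⟩, ⟨3, by simp, by simp⟩]
    · rintro ⟨i, hi, rfl⟩
      interval_cases i <;> simp
  · intro i j hi hj hij
    have : bclaw.length = 4 := rfl
    rw [this] at hi hj
    have := va.ne; have := vb.ne; have := vc.ne
    interval_cases i <;> interval_cases j <;> simp_all [eq_comm]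
  · intro i j hi hj
    have : bclaw.length = 4 := rfl
    rw [this] at hi hj
    have h1 := va.symm; have h2 := vb.symm; have h3 := vc.symm
    have ba : ¬ G.Adj b a := fun h => ab h.symm
    have ca : ¬ G.Adj c a := fun h => ac h.symm
    have cb : ¬ G.Adj c b := fun h => bc h.symm
    interval_cases i <;> interval_cases j <;> simp [*] <;> decide

lemma e3 (hG : Sub5 G) {Y : Finset W} (hY : Conn G Y) (ih : IHyp G Y.card) (hBL : BL G Y)
    (hdY : 1 ≤ d G Y) {X : Finset W} (hX : Bad G X) (hXY : X ⊆ Y) (hne : X ≠ Y)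
    (hb : e G X (Y \ X) ≤ 3) : (∃ p, X = {p}) ∨ Core G X := by
  cases hX with
  | single x => exact Or.inl ⟨x, rfl⟩
  | block X h =>
    obtain ⟨g, hg, f, hf⟩ := h
    exact Or.inr ⟨g, by simp [cores, hg], f, hf⟩
  | join v X₁ X₂ X₃ h₁ h₂ h₃ v₁ v₂ v₃ d₁₂ d₁₃ d₂₃ e₁₂ e₁₃ e₂₃ e₁ e₂ e₃ =>
    right
    have hbd := Bad.join_bd hG v₁ v₂ v₃ d₁₂ d₁₃ d₂₃ e₁₂ e₁₃ e₂₃ e₁ e₂ e₃ hXY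
    have s1 : X₁ ⊆ Y := fun z hz => hXY (by simp [hz])
    have s2 : X₂ ⊆ Y := fun z hz => hXY (by simp [hz])
    have s3 : X₃ ⊆ Y := fun z hz => hXY (by simp [hz])
    have hv : v ∈ Y := hXY (by simp)
    have n1 : X₁ ≠ Y := by rintro rfl; exact v₁ hv
    have n2 : X₂ ≠ Y := by rintro rfl; exact v₂ hv
    have n3 : X₃ ≠ Y := by rintro rfl; exact v₃ hv
    have c1 := h₁.card_mod
    have c2 := h₂.card_mod
    have c3 := h₃.card_mod
    have b1 := hBL X₁ s1 (Finset.card_pos.1 (by omega)) n1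
    have b2 := hBL X₂ s2 (Finset.card_pos.1 (by omega)) n2
    have b3 := hBL X₃ s3 (Finset.card_pos.1 (by omega)) n3
    obtain ⟨a, rfl⟩ := twocut hG hY ih hBL hdY X₁ s1 n1 (by omega) c1
    obtain ⟨b, rfl⟩ := twocut hG hY ih hBL hdY X₂ s2 n2 (by omega) c2
    obtain ⟨c, rfl⟩ := twocut hG hY ih hBL hdY X₃ s3 n3 (by omega) c3
    exact claw_core (e_single_mem e₁) (e_single_mem e₂) (e_single_mem e₃) (e_single_not e₁₂)
      (e_single_not e₁₃) (e_single_not e₂₃) (by simpa using d₁₂) (by simpa using d₁₃)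
      (by simpa using d₂₃)

lemma e4 (hG : Sub5 G) {Y : Finset W} (hY : Conn G Y) (ih : IHyp G Y.card) (hBL : BL G Y)
    (hdY : 1 ≤ d G Y) {X : Finset W} (hX : Bad G X) (hXY : X ⊆ Y) (hne : X ≠ Y)
    (hb : e G X (Y \ X) = 4) : (∃ p, X = {p}) ∨ IsBlk G X ∨
      ∃ v l m Z, X = insert v ({l} ∪ {m} ∪ Z) ∧ Bad G Z ∧ v ∉ Z ∧ l ∉ Z ∧ m ∉ Z ∧ l ≠ m ∧
        G.Adj v l ∧ G.Adj v m ∧ ¬ G.Adj l m ∧ e G {l} Z = 0 ∧ e G {m} Z = 0 ∧ e G {v} Z = 1 ∧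
        e G {l} (Y \ {l}) = 2 ∧ e G {m} (Y \ {m}) = 2 ∧ e G Z (Y \ Z) = 3 := by
  cases hX with
  | single x => exact Or.inl ⟨x, rfl⟩
  | block X h => exact Or.inr (Or.inl h)
  | join v X₁ X₂ X₃ h₁ h₂ h₃ v₁ v₂ v₃ d₁₂ d₁₃ d₂₃ e₁₂ e₁₃ e₂₃ e₁ e₂ e₃ =>
    right; right
    have hbd := Bad.join_bd hG v₁ v₂ v₃ d₁₂ d₁₃ d₂₃ e₁₂ e₁₃ e₂₃ e₁ e₂ e₃ hXY
    have s1 : X₁ ⊆ Y := fun z hz => hXY (by simp [hz])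
    have s2 : X₂ ⊆ Y := fun z hz => hXY (by simp [hz])
    have s3 : X₃ ⊆ Y := fun z hz => hXY (by simp [hz])
    have hv : v ∈ Y := hXY (by simp)
    have n1 : X₁ ≠ Y := by rintro rfl; exact v₁ hv
    have n2 : X₂ ≠ Y := by rintro rfl; exact v₂ hv
    have n3 : X₃ ≠ Y := by rintro rfl; exact v₃ hv
    have c1 := h₁.card_mod
    have c2 := h₂.card_mod
    have c3 := h₃.card_mod
    have b1 := hBL X₁ s1 (Finset.card_pos.1 (by omega)) n1
    have b2 := hBL X₂ s2 (Finset.card_pos.1 (by omega)) n2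
    have b3 := hBL X₃ s3 (Finset.card_pos.1 (by omega)) n3
    have main : ∀ P Q R : Finset W, P ⊆ Y → Q ⊆ Y → P ≠ Y → Q ≠ Y → P.card % 3 = 1 →
        Q.card % 3 = 1 → Bad G R →
        v ∉ R → Disjoint P Q → Disjoint P R → Disjoint Q R → e G P Q = 0 → e G P R = 0 →
        e G Q R = 0 → e G {v} P = 1 → e G {v} Q = 1 → e G {v} R = 1 → e G P (Y \ P) = 2 →
        e G Q (Y \ Q) = 2 → e G R (Y \ R) = 3 → ∃ v' l m Z, insert v (P ∪ Q ∪ R) = insert v' ({l} ∪ {m} ∪ Z) ∧ Bad G Z ∧ v' ∉ Z ∧ l ∉ Z ∧ m ∉ Z ∧ l ≠ m ∧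
        G.Adj v' l ∧ G.Adj v' m ∧ ¬ G.Adj l m ∧ e G {l} Z = 0 ∧ e G {m} Z = 0 ∧ e G {v'} Z = 1 ∧
        e G {l} (Y \ {l}) = 2 ∧ e G {m} (Y \ {m}) = 2 ∧ e G Z (Y \ Z) = 3 := by
      intro P Q R sP sQ nP nQ cP cQ hR vR dPQ dPR dQR ePQ ePR eQR eP eQ eR bP bQ bR
      obtain ⟨l, rfl⟩ := twocut hG hY ih hBL hdY P sP nP (by omega) cP
      obtain ⟨m, rfl⟩ := twocut hG hY ih hBL hdY Q sQ nQ (by omega) cQ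
      exact ⟨v, l, m, R, rfl, hR, vR, by simpa using dPR, by simpa using dQR, by simpa using dPQ,
        e_single_mem eP, e_single_mem eQ, e_single_not ePQ, ePR, eQR, eR, bP, bQ, bR⟩
    have : e G X₁ (Y \ X₁) = 3 ∨ e G X₂ (Y \ X₂) = 3 ∨ e G X₃ (Y \ X₃) = 3 := by omega
    rcases this with h | h | h
    · have := main X₂ X₃ X₁ s2 s3 n2 n3 c2 c3 h₁ v₁ d₂₃ d₁₂.symm d₁₃.symm e₂₃ (by rw [e_comm]; exact e₁₂)
        (by rw [e_comm]; exact e₁₃) e₂ e₃ e₁ (by omega) (by omega) h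
      rwa [show X₂ ∪ X₃ ∪ X₁ = X₁ ∪ X₂ ∪ X₃ by rw [Finset.union_assoc X₁, Finset.union_comm X₁]] at this
    · have := main X₁ X₃ X₂ s1 s3 n1 n3 c1 c3 h₂ v₂ d₁₃ d₁₂ d₂₃.symm e₁₃ e₁₂
        (by rw [e_comm]; exact e₂₃) e₁ e₃ e₂ (by omega) (by omega) h
      rwa [show X₁ ∪ X₃ ∪ X₂ = X₁ ∪ X₂ ∪ X₃ by rw [Finset.union_right_comm]] at this
    · exact main X₁ X₂ X₃ s1 s2 n1 n2 c1 c2 h₃ v₃ d₁₂ d₁₃ d₂₃ e₁₂ e₁₃ e₂₃ e₁ e₂ e₃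
        (by omega) (by omega) h

end Struct2

section Config
open Classical
variable {W : Type} {G : SimpleGraph W}

lemma Realizes.add1 {g : List (List ℕ)} {f : ℕ → W} {X : Finset W} (h : Realizes G g f X)
    {t : W} {i : ℕ} (ht : t ∉ X) (hi : i < g.length) (ha : G.Adj t (f i))
    (hn : ∀ z ∈ X, G.Adj t z → z = f i) :
    ∃ f', Realizes G (g ++ [[i]]) f' (insert t X) ∧ f' g.length = t ∧
      ∀ i < g.length, f' i = f i := by
  refine h.add [i] ht (by simpa using hi) ?_
  intro z hz
  simp only [List.mem_singleton, exists_eq_left]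
  exact ⟨fun hh => (hn z hz hh).symm, fun hh => hh ▸ ha⟩

lemma Realizes.add2 {g : List (List ℕ)} {f : ℕ → W} {X : Finset W} (h : Realizes G g f X)
    {t : W} {i j : ℕ} (ht : t ∉ X) (hi : i < g.length) (hj : j < g.length) (ha : G.Adj t (f i))
    (hb : G.Adj t (f j)) (hn : ∀ z ∈ X, G.Adj t z → z = f i ∨ z = f j) :
    ∃ f', Realizes G (g ++ [[i, j]]) f' (insert t X) ∧ f' g.length = t ∧
      ∀ i < g.length, f' i = f i := by
  refine h.add [i, j] ht (by simp [hi, hj]) ?_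
  intro z hz
  simp only [List.mem_cons, List.not_mem_nil, or_false, exists_eq_or_imp, exists_eq_left]
  constructor
  · intro hh; rcases hn z hz hh with h | h <;> simp [h]
  · rintro (rfl | rfl) <;> assumption

lemma Realizes.add3 {g : List (List ℕ)} {f : ℕ → W} {X : Finset W} (h : Realizes G g f X)
    {t : W} {i j k : ℕ} (ht : t ∉ X) (hi : i < g.length) (hj : j < g.length) (hk : k < g.length)
    (ha : G.Adj t (f i)) (hb : G.Adj t (f j)) (hc : G.Adj t (f k))
    (hn : ∀ z ∈ X, G.Adj t z → z = f i ∨ z = f j ∨ z = f k) :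
    ∃ f', Realizes G (g ++ [[i, j, k]]) f' (insert t X) ∧ f' g.length = t ∧
      ∀ i < g.length, f' i = f i := by
  refine h.add [i, j, k] ht (by simp [hi, hj, hk]) ?_
  intro z hz
  simp only [List.mem_cons, List.not_mem_nil, or_false, exists_eq_or_imp, exists_eq_left]
  constructor
  · intro hh; rcases hn z hz hh with h | h | h <;> simp [h]
  · rintro (rfl | rfl | rfl) <;> assumption

lemma Realizes.idx (hG : Sub5 G) {g : List (List ℕ)} {f : ℕ → W} {X : Finset W} (h : Realizes G g f X)
    {z y : W} (hz : z ∈ X) (hy : y ∉ X) (ha : G.Adj y z) : ∃ i ∈ av g, i < g.length ∧ f i = z := by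
  obtain ⟨i, hi, rfl⟩ := (h.mem z).1 hz
  refine ⟨i, ?_, hi, rfl⟩
  simp only [av, List.mem_filter, List.mem_range, Nat.ble_eq]
  refine ⟨hi, ?_⟩
  rw [h.degEq hi]
  exact deg_le_two hG ha.symm hy

lemma Realizes.not_comm (hG : Sub5 G) {g : List (List ℕ)} {f : ℕ → W} {X : Finset W}
    (h : Realizes G g f X) {i j : ℕ} (hi : i < g.length) (hj : j < g.length) (hij : i ≠ j) {v : W}
    (hv : v ∉ X) (h1 : G.Adj v (f i)) (h2 : G.Adj v (f j)) : comm g i j = false := by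
  by_contra hcon
  simp only [Bool.not_eq_false, comm, List.any_eq_true, List.mem_range, Bool.and_eq_true] at hcon
  obtain ⟨k, hk, k1, k2⟩ := hcon
  rcases hG.c4 v (f i) (f k) (f j) h1 ((h.adj i k hi hk).2 k1) ((h.adj j k hj hk).2 k2).symm h2.symm
    with hh | hh
  · exact hv (hh ▸ h.mem' hk)
  · exact hij (h.inj i j hi hj hh)

lemma P3_idx (hG : Sub5 G) {g : List (List ℕ)} (hg : g ∈ cores) {f : ℕ → W} {X Y : Finset W}
    (h : Realizes G g f X) {v w u : W} (hv : v ∉ X) (hw : w ∉ X) (hu : u ∉ X)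
    (hY : Y = insert u (insert w (insert v X))) (hvw : v ≠ w) (huv : G.Adj u v) (huw : G.Adj u w)
    {a b c : ℕ} (ha : a ∈ av g) (hb : b ∈ av g) (hc : c ∈ av g) (hab : a < b) (hca : c ≠ a)
    (hcb : c ≠ b) (la : a < g.length) (lb : b < g.length) (lc : c < g.length)
    (va : G.Adj v (f a)) (vb : G.Adj v (f b)) (wc : G.Adj w (f c))
    (Nu : ∀ z ∈ Y, G.Adj u z → z = v ∨ z = w)
    (Nv : ∀ z ∈ Y, G.Adj v z → z = u ∨ z = f a ∨ z = f b)
    (Nw : ∀ z ∈ Y, G.Adj w z → z = u ∨ z = f c) : d G Y ≤ 0 ∨ IsBlk G Y := by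
  have hcomm := h.not_comm hG la lb hab.ne hv va vb
  have hok : okG blocks (gP3 g a b c) = true := by
    have := chkP3_true
    simp only [chkP3, List.all_eq_true] at this
    have := this g hg a ha b hb c hc
    have h1 : Nat.ble b a = false := by
      rw [← Bool.not_eq_true, Nat.ble_eq]; omega
    have h2 : (c == a) = false := by simpa using hca
    have h3 : (c == b) = false := by simpa using hcb
    simpa [h1, h2, h3, hcomm] using this
  have uv := huv.ne
  have uw := huw.ne
  obtain ⟨f1, r1, v1, o1⟩ := h.add2 (t := v) hv la lb va vb (by
    intro z hz hh
    rcases Nv z (by simp [hY, hz]) hh with h | h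
    · subst h; exact absurd hz hu
    · exact h)
  obtain ⟨f2, r2, v2, o2⟩ := r1.add1 (t := w) (i := c) (by simp [hw, hvw.symm])
    (by simp <;> omega) (by rw [o1 c lc]; exact wc) (by
      intro z hz hh
      rw [o1 c lc]
      rcases Nw z (by rw [hY]; simp at hz ⊢; tauto) hh with h | h
      · subst h; simp [hu, uv] at hz
      · exact h)
  have w1 : f2 g.length = v := by rw [o2 _ (by simp), v1]
  have w2 : f2 (g.length + 1) = w := by simpa using v2
  obtain ⟨f3, r3, -, -⟩ := r2.add2 (t := u) (i := g.length) (j := g.length + 1)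
    (by simp [hu, uv, uw]) (by simp) (by simp) (by rw [w1]; exact huv) (by rw [w2]; exact huw) (by
      intro z hz hh
      rw [w1, w2]
      exact Nu z (by rw [hY]; exact Finset.mem_insert_of_mem hz) hh)
  rw [← hY] at r3
  rcases okG_sound (g := gP3 g a b c) r3 hok with h | ⟨t, ht, f', h⟩
  · exact Or.inl h
  · exact Or.inr ⟨t, ht, f', h⟩

lemma P4_idx (hG : Sub5 G) {g : List (List ℕ)} (hg : g ∈ blocks) {f : ℕ → W} {X Y : Finset W}
    (h : Realizes G g f X) {v w u : W} (hv : v ∉ X) (hw : w ∉ X) (hu : u ∉ X)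
    (hY : Y = insert u (insert w (insert v X))) (hvw : v ≠ w) (huv : G.Adj u v) (huw : G.Adj u w)
    {a b c c' : ℕ} (ha : a ∈ av g) (hb : b ∈ av g) (hc : c ∈ av g) (hc' : c' ∈ av g)
    (hab : a < b) (hac : a < c) (hcb : c ≠ b) (hcc : c < c') (hcb' : c' ≠ b)
    (la : a < g.length) (lb : b < g.length) (lc : c < g.length) (lc' : c' < g.length)
    (va : G.Adj v (f a)) (vb : G.Adj v (f b)) (wc : G.Adj w (f c)) (wc' : G.Adj w (f c'))
    (Nu : ∀ z ∈ Y, G.Adj u z → z = v ∨ z = w)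
    (Nv : ∀ z ∈ Y, G.Adj v z → z = u ∨ z = f a ∨ z = f b)
    (Nw : ∀ z ∈ Y, G.Adj w z → z = u ∨ z = f c ∨ z = f c') : d G Y ≤ 0 ∨ IsBlk G Y := by
  have hcomm := h.not_comm hG la lb hab.ne hv va vb
  have hcomm2 := h.not_comm hG lc lc' hcc.ne hw wc wc'
  have hok : okG blocks (gP4 g a b c c') = true := by
    have := chkP4_true
    simp only [chkP4, List.all_eq_true, Bool.or_eq_true] at this
    have := this g hg a ha b hb
    have h1 : ¬ Nat.ble b a = true := by rw [Nat.ble_eq]; omega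
    have h1' : ¬ Nat.ble c a = true := by rw [Nat.ble_eq]; omega
    have h1'' : ¬ Nat.ble c' c = true := by rw [Nat.ble_eq]; omega
    have h2 : ¬ (c == b) = true := by simpa using hcb
    have h3 : ¬ (c' == b) = true := by simpa using hcb'
    have h4 : ¬ comm g a b = true := by simp [hcomm]
    have h5 : ¬ comm g c c' = true := by simp [hcomm2]
    have := ((this.resolve_left (by tauto)) c hc).resolve_left (by tauto) c' hc'
    exact this.resolve_left (by tauto)
  have uv := huv.ne
  have uw := huw.ne
  obtain ⟨f1, r1, v1, o1⟩ := h.add2 (t := v) hv la lb va vb (by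
    intro z hz hh
    rcases Nv z (by simp [hY, hz]) hh with h | h
    · subst h; exact absurd hz hu
    · exact h)
  obtain ⟨f2, r2, v2, o2⟩ := r1.add2 (t := w) (i := c) (j := c') (by simp [hw, hvw.symm])
    (by simp <;> omega) (by simp <;> omega) (by rw [o1 c lc]; exact wc) (by rw [o1 c' lc']; exact wc') (by
      intro z hz hh
      rw [o1 c lc, o1 c' lc']
      rcases Nw z (by rw [hY]; simp at hz ⊢; tauto) hh with h | h
      · subst h; simp [hu, uv] at hz
      · exact h)
  have w1 : f2 g.length = v := by rw [o2 _ (by simp), v1]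
  have w2 : f2 (g.length + 1) = w := by simpa using v2
  obtain ⟨f3, r3, -, -⟩ := r2.add2 (t := u) (i := g.length) (j := g.length + 1)
    (by simp [hu, uv, uw]) (by simp) (by simp) (by rw [w1]; exact huv) (by rw [w2]; exact huw) (by
      intro z hz hh
      rw [w1, w2]
      exact Nu z (by rw [hY]; exact Finset.mem_insert_of_mem hz) hh)
  rw [← hY] at r3
  rcases okG_sound (g := gP4 g a b c c') r3 hok with h | ⟨t, ht, f', h⟩
  · exact Or.inl h
  · exact Or.inr ⟨t, ht, f', h⟩

lemma Hex_idx {g : List (List ℕ)} (hg : g ∈ cores) {f : ℕ → W} {X Y : Finset W}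
    (h : Realizes G g f X) {p q r x y s : W} (hp : p ∉ X) (hq : q ∉ X) (hr : r ∉ X)
    (hx : x ∉ X) (hy : y ∉ X) (hs : s ∉ X) (hnd : [p, q, r, x, y, s].Nodup)
    (hY : ∀ z, z ∈ Y ↔ z = s ∨ z = y ∨ z = x ∨ z = r ∨ z = q ∨ z = p ∨ z ∈ X)
    {a b c : ℕ} (ha : a ∈ av g) (hb : b ∈ av g) (hc : c ∈ av g) (hab : a < b) (hbc : b < c)
    (la : a < g.length) (lb : b < g.length) (lc : c < g.length)
    (pa : G.Adj p (f a)) (qb : G.Adj q (f b)) (rc : G.Adj r (f c))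
    (xp : G.Adj x p) (xq : G.Adj x q) (yp : G.Adj y p) (yr : G.Adj y r) (sq : G.Adj s q)
    (sr : G.Adj s r)
    (Np : ∀ z ∈ Y, G.Adj p z → z = x ∨ z = y ∨ z = f a)
    (Nq : ∀ z ∈ Y, G.Adj q z → z = x ∨ z = s ∨ z = f b)
    (Nr : ∀ z ∈ Y, G.Adj r z → z = y ∨ z = s ∨ z = f c)
    (Nx : ∀ z ∈ Y, G.Adj x z → z = p ∨ z = q)
    (Ny : ∀ z ∈ Y, G.Adj y z → z = p ∨ z = r)
    (Ns : ∀ z ∈ Y, G.Adj s z → z = q ∨ z = r) : d G Y ≤ 0 ∨ IsBlk G Y := by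
  have hok : okG blocks (gHex g a b c) = true := by
    have := chkHex_true
    simp only [chkHex, List.all_eq_true, Bool.or_eq_true] at this
    have := this g hg a ha b hb
    have h1 : ¬ Nat.ble b a = true := by rw [Nat.ble_eq]; omega
    have h1' : ¬ Nat.ble c b = true := by rw [Nat.ble_eq]; omega
    exact (this.resolve_left h1 c hc).resolve_left h1'
  simp only [List.nodup_cons, List.mem_cons, List.not_mem_nil, or_false, not_or, List.nodup_nil,
    not_false_eq_true, and_true] at hnd
  obtain ⟨⟨pq, pr, px, py, ps⟩, ⟨qr, qx, qy, qs⟩, ⟨rx, ry, rs⟩, ⟨nxy, nxs⟩, nys⟩ := hnd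
  obtain ⟨f1, r1, v1, o1⟩ := h.add1 (t := p) hp la pa (by
    intro z hz hh
    rcases Np z ((hY z).2 (by simp [hz])) hh with rfl | rfl | h
    · exact absurd hz hx
    · exact absurd hz hy
    · exact h)
  obtain ⟨f2, r2, v2, o2⟩ := r1.add1 (t := q) (i := b) (by simp [hq, pq, Ne.symm pq])
    (by simp <;> omega) (by rw [o1 b lb]; exact qb) (by
    intro z hz hh
    rw [o1 b lb]
    rw [Finset.mem_insert] at hz
    rcases Nq z ((hY z).2 (by simp [hz])) hh with rfl | rfl | h
    · exact absurd hz (by simp [Ne.symm px, hx])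
    · exact absurd hz (by simp [Ne.symm ps, hs])
    · exact h)
  have w2 : f2 (g.length + 1) = q := by simpa using v2
  have w1 : f2 g.length = p := by rw [o2 _ (by simp), v1]
  have wc : f2 c = f c := by rw [o2 _ (by simp <;> omega), o1 _ lc]
  obtain ⟨f3, r3, v3, o3⟩ := r2.add1 (t := r) (i := c) (by simp [hr, Ne.symm pr, Ne.symm qr])
    (by simp <;> omega) (by rw [wc]; exact rc) (by
    intro z hz hh
    rw [wc]
    simp only [Finset.mem_insert] at hz
    rcases Nr z ((hY z).2 (by rcases hz with h | h | h <;> simp [h])) hh with rfl | rfl | h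
    · exact absurd hz (by simp [Ne.symm py, Ne.symm qy, hy])
    · exact absurd hz (by simp [Ne.symm ps, Ne.symm qs, hs])
    · exact h)
  have x1 : f3 g.length = p := by rw [o3 _ (by simp <;> omega), w1]
  have x2 : f3 (g.length + 1) = q := by rw [o3 _ (by simp), w2]
  have x3 : f3 (g.length + 2) = r := by simpa using v3
  obtain ⟨f4, r4, v4, o4⟩ := r3.add2 (t := x) (i := g.length) (j := g.length + 1)
    (by simp [hx, Ne.symm px, Ne.symm qx, Ne.symm rx])
    (by simp <;> omega) (by simp <;> omega) (by rw [x1]; exact xp) (by rw [x2]; exact xq) (by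
    intro z hz hh
    rw [x1, x2]
    simp only [Finset.mem_insert] at hz
    exact Nx z ((hY z).2 (by rcases hz with h | h | h | h <;> simp [h])) hh)
  have y1 : f4 g.length = p := by rw [o4 _ (by simp <;> omega), x1]
  have y2 : f4 (g.length + 1) = q := by rw [o4 _ (by simp <;> omega), x2]
  have y3 : f4 (g.length + 2) = r := by rw [o4 _ (by simp), x3]
  obtain ⟨f5, r5, v5, o5⟩ := r4.add2 (t := y) (i := g.length) (j := g.length + 2)
    (by simp [hy, Ne.symm py, Ne.symm qy, Ne.symm ry, Ne.symm nxy])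
    (by simp <;> omega) (by simp <;> omega) (by rw [y1]; exact yp) (by rw [y3]; exact yr) (by
    intro z hz hh
    rw [y1, y3]
    simp only [Finset.mem_insert] at hz
    exact Ny z ((hY z).2 (by rcases hz with h | h | h | h | h <;> simp [h])) hh)
  have z2 : f5 (g.length + 1) = q := by rw [o5 _ (by simp <;> omega), y2]
  have z3 : f5 (g.length + 2) = r := by rw [o5 _ (by simp <;> omega), y3]
  obtain ⟨f6, r6, -, -⟩ := r5.add2 (t := s) (i := g.length + 1) (j := g.length + 2)
    (by simp [hs, Ne.symm ps, Ne.symm qs, Ne.symm rs, Ne.symm nxs, Ne.symm nys])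
    (by simp <;> omega) (by simp <;> omega) (by rw [z2]; exact sq) (by rw [z3]; exact sr) (by
    intro z hz hh
    rw [z2, z3]
    simp only [Finset.mem_insert] at hz
    exact Ns z ((hY z).2 (by rcases hz with h | h | h | h | h | h <;> simp [h])) hh)
  have hYe : Y = insert s (insert y (insert x (insert r (insert q (insert p X))))) := by
    ext z; rw [hY]; simp
  rw [← hYe] at r6
  rcases okG_sound (g := gHex g a b c) r6 hok with h | ⟨t, ht, f', h⟩
  · exact Or.inl h
  · exact Or.inr ⟨t, ht, f', h⟩

end Config

section Cases
open Classical
variable {W : Type} {G : SimpleGraph W}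

lemma nb3 (hG : Sub5 G) {v a b c : W} (ha : G.Adj v a) (hb : G.Adj v b) (hc : G.Adj v c)
    (ab : a ≠ b) (ac : a ≠ c) (bc : b ≠ c) {z : W} (hz : G.Adj v z) : z = a ∨ z = b ∨ z = c := by
  by_contra hcon
  push Not at hcon
  have := hG.deg v (insert z (insert a (insert b (insert c ∅))))
  rw [e_single_insert_adj (by simp [hcon]) hz, e_single_insert_adj (by simp [ab, ac]) ha,
    e_single_insert_adj (by simp [bc]) hb, e_single_insert_adj (by simp) hc] at this
  omega

lemma nb2 {l a b : W} {Y : Finset W} (h : e G {l} Y ≤ 2) (ha : a ∈ Y) (hb : b ∈ Y) (ab : a ≠ b)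
    (la : G.Adj l a) (lb : G.Adj l b) {z : W} (hz : z ∈ Y) (lz : G.Adj l z) : z = a ∨ z = b := by
  by_contra hcon
  push Not at hcon
  have h1 := e_mono (G := G) (subset_refl {l}) (show insert z (insert a (insert b ∅)) ⊆ Y by
    intro t ht; simp at ht; rcases ht with rfl | rfl | rfl <;> assumption)
  rw [e_single_insert_adj (by simp [hcon]) lz, e_single_insert_adj (by simp [ab]) la,
    e_single_insert_adj (by simp) lb] at h1
  omega

lemma nb1 {v : W} {X : Finset W} (h : e G {v} X = 1) :
    ∃ a ∈ X, G.Adj v a ∧ ∀ z ∈ X, G.Adj v z → z = a := by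
  rw [e_single] at h
  obtain ⟨a, ha⟩ := Finset.card_eq_one.1 h
  have key : ∀ z, (z ∈ X ∧ G.Adj v z) ↔ z = a := fun z => by
    simpa using Finset.ext_iff.1 ha z
  have := (key a).2 rfl
  exact ⟨a, this.1, this.2, fun z h1 h2 => (key z).1 ⟨h1, h2⟩⟩

lemma nbTwo {v : W} {X : Finset W} (h : 2 ≤ e G {v} X) :
    ∃ a ∈ X, ∃ b ∈ X, a ≠ b ∧ G.Adj v a ∧ G.Adj v b := by
  rw [e_single] at h
  obtain ⟨a, ha, b, hb, hab⟩ := Finset.one_lt_card.1 h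
  simp only [Finset.mem_filter] at ha hb
  exact ⟨a, ha.1, b, hb.1, hab, ha.2, hb.2⟩

lemma nbThree {v : W} {X : Finset W} (h : 3 ≤ e G {v} X) :
    ∃ a ∈ X, ∃ b ∈ X, ∃ c ∈ X, a ≠ b ∧ a ≠ c ∧ b ≠ c ∧ G.Adj v a ∧ G.Adj v b ∧ G.Adj v c := by
  rw [e_single] at h
  obtain ⟨a, b, c, ha, hb, hc, h1, h2, h3⟩ := Finset.two_lt_card_iff.1 h
  simp only [Finset.mem_filter] at ha hb hc
  exact ⟨a, ha.1, b, hb.1, c, hc.1, h1, h2, h3, ha.2, hb.2, hc.2⟩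

lemma P3_case (hG : Sub5 G) {X Y : Finset W} (hX : Core G X) {v w u : W} (hv : v ∉ X) (hw : w ∉ X)
    (hu : u ∉ X) (hY : Y = insert u (insert w (insert v X))) (hvw : v ≠ w) (huv : G.Adj u v)
    (huw : G.Adj u w) (Nu : ∀ z ∈ Y, G.Adj u z → z = v ∨ z = w)
    (h2 : e G {v} X = 2) (h1 : e G {w} X = 1) : d G Y ≤ 0 ∨ IsBlk G Y := by
  obtain ⟨g, hg, f, h⟩ := hX
  have nvw : ¬ G.Adj w v := fun hh => hG.tri u w v huw hh huv
  obtain ⟨a, ha, b, hb, hab, va, vb⟩ := nbTwo h2.ge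
  obtain ⟨c, hc, wc, huniq⟩ := nb1 h1
  have hua : u ≠ a := fun hh => hu (hh ▸ ha)
  have hub : u ≠ b := fun hh => hu (hh ▸ hb)
  have noC : ∀ p, p ≠ u → G.Adj v p → G.Adj w p → False := by
    intro p hp k1 k2
    rcases hG.c4 u v p w huv k1 k2.symm huw.symm with hh | hh
    · exact hp hh.symm
    · exact hvw hh
  obtain ⟨i, hi, li, rfl⟩ := h.idx hG ha hv va
  obtain ⟨j, hj, lj, rfl⟩ := h.idx hG hb hv vb
  obtain ⟨k, hk, lk, rfl⟩ := h.idx hG hc hw wc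
  have hki : k ≠ i := by rintro rfl; exact noC _ hua.symm va wc
  have hkj : k ≠ j := by rintro rfl; exact noC _ hub.symm vb wc
  have hij : i ≠ j := by rintro rfl; exact hab rfl
  have Nw : ∀ z ∈ Y, G.Adj w z → z = u ∨ z = f k := by
    intro z hz hwz
    rw [hY] at hz; simp only [Finset.mem_insert] at hz
    rcases hz with rfl | rfl | rfl | hz
    · exact Or.inl rfl
    · exact absurd hwz (G.loopless.irrefl _)
    · exact absurd hwz nvw
    · exact Or.inr (huniq z hz hwz)
  rcases lt_or_gt_of_ne hij with hlt | hlt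
  · exact P3_idx hG hg h hv hw hu hY hvw huv huw hi hj hk hlt hki hkj li lj lk va vb wc Nu
      (fun z _ hz => nb3 hG huv.symm va vb hua hub hab hz) Nw
  · exact P3_idx hG hg h hv hw hu hY hvw huv huw hj hi hk hlt hkj hki lj li lk vb va wc Nu
      (fun z _ hz => nb3 hG huv.symm vb va hub hua hab.symm hz) Nw

lemma P4_case (hG : Sub5 G) {X Y : Finset W} (hX : IsBlk G X) {v w u : W} (hv : v ∉ X) (hw : w ∉ X)
    (hu : u ∉ X) (hY : Y = insert u (insert w (insert v X))) (hvw : v ≠ w) (huv : G.Adj u v)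
    (huw : G.Adj u w) (Nu : ∀ z ∈ Y, G.Adj u z → z = v ∨ z = w)
    (h2 : e G {v} X = 2) (h1 : e G {w} X = 2) : d G Y ≤ 0 ∨ IsBlk G Y := by
  obtain ⟨g, hg, f, h⟩ := hX
  have noC : ∀ p, p ≠ u → G.Adj v p → G.Adj w p → False := by
    intro p hp k1 k2
    rcases hG.c4 u v p w huv k1 k2.symm huw.symm with hh | hh
    · exact hp hh.symm
    · exact hvw hh
  have sorted : ∀ t, t ∉ X → e G {t} X = 2 → ∃ i j, i ∈ av g ∧ j ∈ av g ∧ i < j ∧ i < g.length ∧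
      j < g.length ∧ G.Adj t (f i) ∧ G.Adj t (f j) := by
    intro t ht h2
    obtain ⟨a, ha, b, hb, hab, va, vb⟩ := nbTwo h2.ge
    obtain ⟨i, hi, li, rfl⟩ := h.idx hG ha ht va
    obtain ⟨j, hj, lj, rfl⟩ := h.idx hG hb ht vb
    have hij : i ≠ j := by rintro rfl; exact hab rfl
    rcases lt_or_gt_of_ne hij with hlt | hlt
    · exact ⟨i, j, hi, hj, hlt, li, lj, va, vb⟩
    · exact ⟨j, i, hj, hi, hlt, lj, li, vb, va⟩
  obtain ⟨a, b, ha, hb, hab, la, lb, va, vb⟩ := sorted v hv h2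
  obtain ⟨c, c', hc, hc', hcc, lc, lc', wc, wc'⟩ := sorted w hw h1
  have hne : ∀ i < g.length, f i ≠ u := fun i hi hh => hu (hh ▸ h.mem' hi)
  have hac : a ≠ c := by rintro rfl; exact noC _ (hne _ la) va wc
  have hac' : a ≠ c' := by rintro rfl; exact noC _ (hne _ la) va wc'
  have hbc : b ≠ c := by rintro rfl; exact noC _ (hne _ lb) vb wc
  have hbc' : b ≠ c' := by rintro rfl; exact noC _ (hne _ lb) vb wc'
  have Nv : ∀ z ∈ Y, G.Adj v z → z = u ∨ z = f a ∨ z = f b := fun z _ hz =>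
    nb3 hG huv.symm va vb (hne a la).symm (hne b lb).symm (fun hh => hab.ne (h.inj _ _ la lb hh)) hz
  have Nw : ∀ z ∈ Y, G.Adj w z → z = u ∨ z = f c ∨ z = f c' := fun z _ hz =>
    nb3 hG huw.symm wc wc' (hne c lc).symm (hne c' lc').symm
      (fun hh => hcc.ne (h.inj _ _ lc lc' hh)) hz
  rcases lt_or_gt_of_ne hac with hlt | hlt
  · exact P4_idx hG hg h hv hw hu hY hvw huv huw ha hb hc hc' hab hlt hbc.symm hcc hbc'.symm
      la lb lc lc' va vb wc wc' Nu Nv Nw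
  · exact P4_idx hG hg h hw hv hu (by rw [hY, Finset.insert_comm w v]) hvw.symm huw huv hc hc' ha hb hcc hlt hac' hab hbc'
      lc lc' la lb wc wc' va vb (fun z hz hh => (Nu z hz hh).symm) Nw Nv

lemma Hex_case (hG : Sub5 G) {Z Y : Finset W} (hZ : Core G Z) {p q r x y s : W} (hp : p ∉ Z)
    (hq : q ∉ Z) (hr : r ∉ Z)
    (hx : x ∉ Z) (hy : y ∉ Z) (hs : s ∉ Z) (hnd : [p, q, r, x, y, s].Nodup)
    (hY : ∀ z, z ∈ Y ↔ z = s ∨ z = y ∨ z = x ∨ z = r ∨ z = q ∨ z = p ∨ z ∈ Z)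
    {a b c : W} (ha : a ∈ Z) (hb : b ∈ Z) (hc : c ∈ Z)
    (pa : G.Adj p a) (qb : G.Adj q b) (rc : G.Adj r c)
    (xp : G.Adj x p) (xq : G.Adj x q) (yp : G.Adj y p) (yr : G.Adj y r) (sq : G.Adj s q)
    (sr : G.Adj s r)
    (Nx : ∀ z ∈ Y, G.Adj x z → z = p ∨ z = q)
    (Ny : ∀ z ∈ Y, G.Adj y z → z = p ∨ z = r)
    (Ns : ∀ z ∈ Y, G.Adj s z → z = q ∨ z = r) : d G Y ≤ 0 ∨ IsBlk G Y := by
  obtain ⟨g, hg, f, h⟩ := hZ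
  have hnd' := hnd
  simp only [List.nodup_cons, List.mem_cons, List.not_mem_nil, or_false, not_or, List.nodup_nil,
    not_false_eq_true, and_true] at hnd'
  obtain ⟨⟨pq, pr, px, py, ps⟩, ⟨qr, qx, qy, qs⟩, ⟨rx, ry, rs⟩, ⟨nxy, nxs⟩, nys⟩ := hnd'
  have nZ : ∀ t ∉ Z, ∀ z ∈ Z, t ≠ z := fun t ht z hz hh => ht (hh ▸ hz)
  have ab : a ≠ b := by
    rintro rfl
    rcases hG.c4 a p x q pa.symm xp.symm xq qb with hh | hh
    · exact nZ x hx a ha hh.symm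
    · exact pq hh
  have ac : a ≠ c := by
    rintro rfl
    rcases hG.c4 a p y r pa.symm yp.symm yr rc with hh | hh
    · exact nZ y hy a ha hh.symm
    · exact pr hh
  have bc : b ≠ c := by
    rintro rfl
    rcases hG.c4 b q s r qb.symm sq.symm sr rc with hh | hh
    · exact nZ s hs b hb hh.symm
    · exact qr hh
  have Np : ∀ z ∈ Y, G.Adj p z → z = x ∨ z = y ∨ z = a := fun z _ hz =>
    nb3 hG xp.symm yp.symm pa nxy (nZ x hx a ha) (nZ y hy a ha) hz
  have Nq : ∀ z ∈ Y, G.Adj q z → z = x ∨ z = s ∨ z = b := fun z _ hz =>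
    nb3 hG xq.symm sq.symm qb nxs (nZ x hx b hb) (nZ s hs b hb) hz
  have Nr : ∀ z ∈ Y, G.Adj r z → z = y ∨ z = s ∨ z = c := fun z _ hz =>
    nb3 hG yr.symm sr.symm rc nys (nZ y hy c hc) (nZ s hs c hc) hz
  obtain ⟨i, hi, li, rfl⟩ := h.idx hG ha hp pa
  obtain ⟨j, hj, lj, rfl⟩ := h.idx hG hb hq qb
  obtain ⟨k, hk, lk, rfl⟩ := h.idx hG hc hr rc
  have hij : i ≠ j := by rintro rfl; exact ab rfl
  have hik : i ≠ k := by rintro rfl; exact ac rfl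
  have hjk : j ≠ k := by rintro rfl; exact bc rfl
  have sw2 : ∀ {P Q : W → Prop}, (∀ z ∈ Y, G.Adj x z → P z ∨ Q z) → ∀ z ∈ Y, G.Adj x z → Q z ∨ P z :=
    fun hh z h1 h2 => (hh z h1 h2).symm
  have hcases : (i < j ∧ j < k) ∨ (i < k ∧ k < j) ∨ (j < i ∧ i < k) ∨ (j < k ∧ k < i) ∨
    (k < i ∧ i < j) ∨ (k < j ∧ j < i) := by omega
  clear sw2 ab ac bc
  have rot : ∀ {t α β γ : W}, (∀ z ∈ Y, G.Adj t z → z = α ∨ z = β ∨ z = γ) →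
      ∀ z ∈ Y, G.Adj t z → z = β ∨ z = α ∨ z = γ := fun hh z h1 h2 => by
    rcases hh z h1 h2 with h | h | h
    · exact Or.inr (Or.inl h)
    · exact Or.inl h
    · exact Or.inr (Or.inr h)
  have sw : ∀ {t α β : W}, (∀ z ∈ Y, G.Adj t z → z = α ∨ z = β) →
      ∀ z ∈ Y, G.Adj t z → z = β ∨ z = α := fun hh z h1 h2 => (hh z h1 h2).symm
  rcases hcases with ⟨h1, h2⟩ | ⟨h1, h2⟩ | ⟨h1, h2⟩ | ⟨h1, h2⟩ | ⟨h1, h2⟩ | ⟨h1, h2⟩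
  · exact Hex_idx hg h hp hq hr hx hy hs hnd hY hi hj hk h1 h2 li lj lk pa qb rc
      xp xq yp yr sq sr Np Nq Nr Nx Ny Ns
  · -- p r q ; y x s
    exact Hex_idx hg h hp hr hq hy hx hs (by clear * - hnd; simp at hnd ⊢; grind)
      (by clear * - hY; intro z; rw [hY]; tauto) hi hk hj h1 h2 li lk lj pa rc qb
      yp yr xp xq sr sq (rot Np) Nr Nq Ny Nx (sw Ns)
  · -- q p r ; x s y
    exact Hex_idx hg h hq hp hr hx hs hy (by clear * - hnd; simp at hnd ⊢; grind)
      (by clear * - hY; intro z; rw [hY]; tauto) hj hi hk h1 h2 lj li lk qb pa rc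
      xq xp sq sr yp yr Nq Np (rot Nr) (sw Nx) Ns Ny
  · -- q r p ; s x y
    exact Hex_idx hg h hq hr hp hs hx hy (by clear * - hnd; simp at hnd ⊢; grind)
      (by clear * - hY; intro z; rw [hY]; tauto) hj hk hi h1 h2 lj lk li qb rc pa
      sq sr xq xp yr yp (rot Nq) (rot Nr) Np Ns (sw Nx) (sw Ny)
  · -- r p q ; y s x
    exact Hex_idx hg h hr hp hq hy hs hx (by clear * - hnd; simp at hnd ⊢; grind)
      (by clear * - hY; intro z; rw [hY]; tauto) hk hi hj h1 h2 lk li lj rc pa qb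
      yr yp sr sq xp xq Nr (rot Np) (rot Nq) (sw Ny) (sw Ns) Nx
  · -- r q p ; s y x
    exact Hex_idx hg h hr hq hp hs hy hx (by clear * - hnd; simp at hnd ⊢; grind)
      (by clear * - hY; intro z; rw [hY]; tauto) hk hj hi h1 h2 lk lj li rc qb pa
      sr sq yr yp xq xp (rot Nr) (rot Nq) (rot Np) (sw Ns) (sw Ny) (sw Nx)

lemma R_idx (hG : Sub5 G) {X Y : Finset W} (hX : Core G X) {r : W} (hr : r ∉ X)
    (hY : Y = insert r X) (h3 : e G {r} X = 3) (hcub : ∀ y ∈ Y, e G {y} Y = 3) :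
    d G Y ≤ 0 ∨ ∃ t ∈ [bH1, bH2], ∃ f', Realizes G t f' Y := by
  obtain ⟨g, hg, f, h⟩ := hX
  obtain ⟨a, ha, b, hb, c, hc, ab, ac, bc, ra, rb, rc⟩ := nbThree h3.ge
  have main : ∀ i j k : ℕ, i ∈ av g → j ∈ av g → k ∈ av g → i < j → j < k → i < g.length →
      j < g.length → k < g.length → G.Adj r (f i) → G.Adj r (f j) → G.Adj r (f k) →
      d G Y ≤ 0 ∨ ∃ t ∈ [bH1, bH2], ∃ f', Realizes G t f' Y := by
    intro i j k hi hj hk hij hjk li lj lk ri rj rk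
    obtain ⟨f1, r1, -, -⟩ := h.add3 (t := r) hr li lj lk ri rj rk
      (fun z _ hz => nb3 hG ri rj rk (fun hh => hij.ne (h.inj _ _ li lj hh))
        (fun hh => (hij.trans hjk).ne (h.inj _ _ li lk hh)) (fun hh => hjk.ne (h.inj _ _ lj lk hh)) hz)
    rw [← hY] at r1
    refine okG_sound (g := gR g i j k) r1 ?_
    have := chkR_true
    simp only [chkR, List.all_eq_true, Bool.or_eq_true] at this
    have := this g hg i hi j hj
    have h1 : ¬ Nat.ble j i = true := by rw [Nat.ble_eq]; omega
    have h1' : ¬ Nat.ble k j = true := by rw [Nat.ble_eq]; omega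
    have h4 : ¬ comm g i j = true := by simp [h.not_comm hG li lj hij.ne hr ri rj]
    have h5 : ¬ (!cubicB (gR g i j k)) = true := by
      simp only [Bool.not_eq_true', Bool.not_eq_false, cubicB, List.all_eq_true, List.mem_range, beq_iff_eq]
      intro t ht
      rw [Realizes.degEq (g := gR g i j k) r1 ht]
      exact hcub _ (r1.mem' ht)
    exact ((this.resolve_left h1) k hk).resolve_left (by tauto)
  obtain ⟨i, hi, li, rfl⟩ := h.idx hG ha hr ra
  obtain ⟨j, hj, lj, rfl⟩ := h.idx hG hb hr rb
  obtain ⟨k, hk, lk, rfl⟩ := h.idx hG hc hr rc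
  have hij : i ≠ j := by rintro rfl; exact ab rfl
  have hik : i ≠ k := by rintro rfl; exact ac rfl
  have hjk : j ≠ k := by rintro rfl; exact bc rfl
  have hcases : (i < j ∧ j < k) ∨ (i < k ∧ k < j) ∨ (j < i ∧ i < k) ∨ (j < k ∧ k < i) ∨
    (k < i ∧ i < j) ∨ (k < j ∧ j < i) := by omega
  rcases hcases with ⟨h1, h2⟩ | ⟨h1, h2⟩ | ⟨h1, h2⟩ | ⟨h1, h2⟩ | ⟨h1, h2⟩ | ⟨h1, h2⟩
  · exact main i j k hi hj hk h1 h2 li lj lk ra rb rc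
  · exact main i k j hi hk hj h1 h2 li lk lj ra rc rb
  · exact main j i k hj hi hk h1 h2 lj li lk rb ra rc
  · exact main j k i hj hk hi h1 h2 lj lk li rb rc ra
  · exact main k i j hk hi hj h1 h2 lk li lj rc ra rb
  · exact main k j i hk hj hi h1 h2 lk lj li rc rb ra

end Cases

section ThmA
open Classical
variable {W : Type} {G : SimpleGraph W}

lemma hex_wrap (hG : Sub5 G) {Y : Finset W} (hY : Conn G Y) (ih : IHyp G Y.card) (hBL : BL G Y)
    (hdY : 1 ≤ d G Y) {u v w a l m : W} {Z : Finset W}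
    (hYe : Y = insert u (insert w (insert v (insert a ({l} ∪ {m} ∪ Z)))))
    (hX : ∀ x ∈ insert a ({l} ∪ {m} ∪ Z), x ≠ u ∧ x ≠ v ∧ x ≠ w)
    (huv : G.Adj u v) (huw : G.Adj u w) (hvw : v ≠ w)
    (Nu : ∀ z ∈ Y, G.Adj u z → z = v ∨ z = w) (hZ : Bad G Z) (hZ3 : e G Z (Y \ Z) = 3)
    (ev : e G {v} (insert a ({l} ∪ {m} ∪ Z)) = 2) (ew : e G {w} (insert a ({l} ∪ {m} ∪ Z)) = 2)
    (aZ : a ∉ Z) (lZ : l ∉ Z) (mZ : m ∉ Z) (lm : l ≠ m) (al : G.Adj a l) (am : G.Adj a m)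
    (eaZ : e G {a} Z = 1)
    (lv : G.Adj l v) (mw : G.Adj m w)
    (el : e G {l} (Y \ {l}) = 2) (em : e G {m} (Y \ {m}) = 2) : IsBlk G Y := by
  have noC : ∀ p, p ≠ u → G.Adj v p → G.Adj w p → False := by
    intro p hp k1 k2
    rcases hG.c4 u v p w huv k1 k2.symm huw.symm with hh | hh
    · exact hp hh.symm
    · exact hvw hh
  have ha := hX a (by simp)
  have hl := hX l (by simp)
  have hm := hX m (by simp)
  obtain ⟨t, htZ, at', tu⟩ := nb1 eaZ
  have ht := hX t (by simp [htZ])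
  have uZ : u ∉ Z := fun h => (hX u (by simp [h])).1 rfl
  have vZ : v ∉ Z := fun h => (hX v (by simp [h])).2.1 rfl
  have wZ : w ∉ Z := fun h => (hX w (by simp [h])).2.2 rfl
  have hlt : l ≠ t := fun h => lZ (h ▸ htZ)
  have hmt : m ≠ t := fun h => mZ (h ▸ htZ)
  have hna : ∀ z, G.Adj a z → z = l ∨ z = m ∨ z = t := fun z hz => nb3 hG al am at' lm hlt hmt hz
  have hYm : ∀ z, z ∈ Y ↔ z = u ∨ z = m ∨ z = l ∨ z = w ∨ z = v ∨ z = a ∨ z ∈ Z := by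
    intro z; rw [hYe]; simp only [Finset.mem_insert, Finset.mem_union, Finset.mem_singleton]
    clear * -
    tauto
  have noself : ∀ z z' : W, G.Adj z z' → z' ∈ Y → z' ∈ Y \ {z} := by
    intro z z' h h'; simp [h', h.ne']
  have Nl : ∀ z ∈ Y, G.Adj l z → z = a ∨ z = v := fun z hz hlz =>
    nb2 el.le (noself _ _ al.symm (by simp [hYm])) (noself _ _ lv (by simp [hYm])) ha.2.1 al.symm lv
      (noself _ _ hlz hz) hlz
  have Nm : ∀ z ∈ Y, G.Adj m z → z = a ∨ z = w := fun z hz hlz =>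
    nb2 em.le (noself _ _ am.symm (by simp [hYm])) (noself _ _ mw (by simp [hYm])) ha.2.2 am.symm mw
      (noself _ _ hlz hz) hlz
  have hvn : ∃ b ∈ Z, G.Adj v b := by
    obtain ⟨b, hb, c, hc, hbc, vb, vc⟩ := nbTwo ev.ge
    have key : ∀ z ∈ insert a ({l} ∪ {m} ∪ Z), G.Adj v z → z = l ∨ z ∈ Z := by
      intro z hz h
      simp only [Finset.mem_insert, Finset.mem_union, Finset.mem_singleton] at hz
      rcases hz with rfl | (rfl | rfl) | hz
      · rcases hna v h.symm with h' | h' | h'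
        · exact absurd h'.symm hl.2.1
        · exact absurd h'.symm hm.2.1
        · exact absurd h'.symm ht.2.1
      · simp
      · exact (noC z hm.1 h mw.symm).elim
      · exact Or.inr hz
    rcases key b hb vb with rfl | h
    · rcases key c hc vc with rfl | h
      · exact absurd rfl hbc
      · exact ⟨c, h, vc⟩
    · exact ⟨b, h, vb⟩
  have hwn : ∃ b ∈ Z, G.Adj w b := by
    obtain ⟨b, hb, c, hc, hbc, vb, vc⟩ := nbTwo ew.ge
    have key : ∀ z ∈ insert a ({l} ∪ {m} ∪ Z), G.Adj w z → z = m ∨ z ∈ Z := by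
      intro z hz h
      simp only [Finset.mem_insert, Finset.mem_union, Finset.mem_singleton] at hz
      rcases hz with rfl | (rfl | rfl) | hz
      · rcases hna w h.symm with h' | h' | h'
        · exact absurd h'.symm hl.2.2
        · exact absurd h'.symm hm.2.2
        · exact absurd h'.symm ht.2.2
      · exact (noC z hl.1 lv.symm h).elim
      · simp
      · exact Or.inr hz
    rcases key b hb vb with rfl | h
    · rcases key c hc vc with rfl | h
      · exact absurd rfl hbc
      · exact ⟨c, h, vc⟩
    · exact ⟨b, h, vb⟩
  obtain ⟨b, hb, vb⟩ := hvn
  obtain ⟨c, hc, wc⟩ := hwn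
  have hb' := hX b (by simp [hb])
  rcases e3 hG hY ih hBL hdY hZ (fun z hz => by simp [hYm, hz])
    (fun h => uZ (h ▸ by simp [hYm])) hZ3.le with ⟨p, rfl⟩ | hC
  · simp at hb hc
    subst hb; subst hc
    exact (noC _ hb'.1 vb wc).elim
  · have := Hex_case hG hC (p := a) (q := v) (r := w) (x := l) (y := m) (s := u) aZ vZ wZ lZ mZ uZ
      (by simp [ha, hl, hm, hvw, al.ne, am.ne, lm, huv.ne', huw.ne', hl.2.1.symm, hm.2.1.symm, hl.2.2.symm, hm.2.2.symm])
      hYm htZ hb hc at' vb wc al.symm lv am.symm mw huv huw Nl Nm Nu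
    rcases this with h | h
    · omega
    · exact h

lemma noncubic_BL (hG : Sub5 G) {Y : Finset W} (hY : Conn G Y) (ih : IHyp G Y.card) (hBL : BL G Y)
    (hdY : 1 ≤ d G Y) {u : W} (huY : u ∈ Y) (hu2 : e G {u} Y ≤ 2) (hYu : ({u} : Finset W) ≠ Y) :
    d G Y ≤ 1 ∧ IsBlk G Y := by
  have h0 := hBL {u} (by simpa using huY) (by simp) hYu
  obtain ⟨v, hv, w, hw, hvw, huv, huw⟩ := nbTwo h0
  have hvY := (Finset.mem_sdiff.1 hv).1
  have hwY := (Finset.mem_sdiff.1 hw).1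
  have Nu : ∀ z ∈ Y, G.Adj u z → z = v ∨ z = w := fun z hz h => nb2 hu2 hvY hwY hvw huv huw hz h
  have noC : ∀ p, p ≠ u → G.Adj v p → G.Adj w p → False := by
    intro p hp k1 k2
    rcases hG.c4 u v p w huv k1 k2.symm huw.symm with hh | hh
    · exact hp hh.symm
    · exact hvw hh
  have nvw : ¬ G.Adj v w := fun h => hG.tri u v w huv h huw
  obtain ⟨X, hXd⟩ : ∃ X, X = Y \ {u, v, w} := ⟨_, rfl⟩
  have hXm : ∀ z, z ∈ X ↔ z ∈ Y ∧ z ≠ u ∧ z ≠ v ∧ z ≠ w := by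
    intro z; rw [hXd]; simp
  have uX : u ∉ X := by simp [hXm]
  have vX : v ∉ X := by simp [hXm]
  have wX : w ∉ X := by simp [hXm]
  have hXY : X ⊆ Y := fun z hz => ((hXm z).1 hz).1
  have hXne : X ≠ Y := fun h => uX (h ▸ huY)
  have hYe : Y = insert u (insert w (insert v X)) := by
    ext z; simp only [Finset.mem_insert, hXm]
    constructor
    · intro hz; tauto
    · rintro (rfl | rfl | rfl | h) <;> tauto
  have huXn : ∀ s ∈ X, ¬ G.Adj u s := by
    intro s hs h
    have := (hXm s).1 hs
    rcases Nu s this.1 h with h | h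
    · exact this.2.2.1 h
    · exact this.2.2.2 h
  have hcard : Y.card = X.card + 3 := by
    rw [hYe, Finset.card_insert_of_notMem (by simp [uX, huv.ne, huw.ne]),
      Finset.card_insert_of_notMem (by simp [wX, hvw.symm]), Finset.card_insert_of_notMem vX]
  have hdX : d G Y ≤ d G X := by
    have := nuS_pendant uX vX huY hvY hXY huv huXn
    unfold d; omega
  have hbd : e G X (Y \ X) = e G {v} X + e G {w} X := by
    have : Y \ X = {u} ∪ ({v} ∪ {w}) := by
      ext z; simp only [Finset.mem_sdiff, hXm, Finset.mem_union, Finset.mem_singleton]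
      constructor
      · tauto
      · rintro (rfl | rfl | rfl) <;> tauto
    rw [this, e_comm, e_union_left _ (by simp [huv.ne, huw.ne]), e_union_left _ (by simp [hvw]),
      e_eq_zero.2 (fun a ha => by rw [Finset.mem_singleton.1 ha]; exact huXn)]
    omega
  have ev2 : e G {v} X ≤ 2 := deg_le_two hG huv.symm uX
  have ew2 : e G {w} X ≤ 2 := deg_le_two hG huw.symm uX
  have noIso : ∀ p ∈ X, (∀ z ∈ X, ¬ G.Adj p z) → False := by
    intro p hp hn
    have hp' := (hXm p).1 hp
    have := hBL {p} (by simpa using hp'.1) (by simp) (fun h => by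
      rw [← h] at huY; simp at huY; exact hp'.2.1 huY.symm)
    have := single_two (x := v) (y := w) this (by
      intro z hz h
      by_contra hcon
      push Not at hcon
      refine hn z ((hXm z).2 ⟨hz, ?_, hcon⟩) h
      rintro rfl
      exact huXn p hp h.symm)
    exact noC p hp'.2.1 this.1.symm this.2.symm
  obtain ⟨A, hAX, hAc, hA0, hAd, hAB⟩ := extract hG hY ih X hXY hXne (by omega)
  have hAX' : A = X := by
    by_contra hcon
    have hAY : A ≠ Y := fun h => uX (hAX (h ▸ huY))
    have h1 := hBL A (hAX.trans hXY) hAc.1 hAY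
    have h2 := hBL (X \ A) (Finset.sdiff_subset.trans hXY)
      (by rw [Finset.sdiff_nonempty]; exact fun h => hcon (subset_antisymm hAX h))
      (fun h => uX (Finset.sdiff_subset (h ▸ huY)))
    have h3 := bd_add hAX hXY hA0
    obtain ⟨p, rfl⟩ := twocut hG hY ih hBL hdY A (hAX.trans hXY) hAY (by omega) hAB.card_mod
    refine noIso p (hAX (by simp)) ?_
    intro z hz h
    exact e_eq_zero.1 hA0 p (by simp) z (by simp [hz, h.ne']) h
  subst hAX'
  refine ⟨by omega, ?_⟩
  have noS : ¬ ∃ p, A = {p} := by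
    rintro ⟨p, rfl⟩
    refine noIso p (by simp) ?_
    intro z hz h
    simp at hz; exact h.ne hz.symm
  have hb2 := hBL A hXY hAc.1 hXne
  have done : (d G Y ≤ 0 ∨ IsBlk G Y) → IsBlk G Y := by
    rintro (h | h)
    · omega
    · exact h
  have hYe' : Y = insert u (insert v (insert w A)) := by rw [hYe, Finset.insert_comm w v]
  have Nu' : ∀ z ∈ Y, G.Adj u z → z = w ∨ z = v := fun z hz h => (Nu z hz h).symm
  by_cases h4 : e G A (Y \ A) = 4
  · have k1 : e G {v} A = 2 := by omega
    have k2 : e G {w} A = 2 := by omega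
    rcases e4 hG hY ih hBL hdY hAB hXY hXne h4 with h | h | ⟨a, l, m, Z, rfl, hZ, aZ, lZ, mZ, lm, al, am, nlm, elZ, emZ, eaZ, el, em, hZ3⟩
    · exact absurd h noS
    · exact done (P4_case hG h vX wX uX hYe hvw huv huw Nu k1 k2)
    · have hX3 : ∀ x ∈ insert a ({l} ∪ {m} ∪ Z), x ≠ u ∧ x ≠ v ∧ x ≠ w := fun x hx => ((hXm x).1 hx).2
      have hmX : m ∈ insert a ({l} ∪ {m} ∪ Z) := by simp
      have hlX : l ∈ insert a ({l} ∪ {m} ∪ Z) := by simp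
      have other : ∀ x ∈ insert a ({l} ∪ {m} ∪ Z), e G {x} (Y \ {x}) = 2 → 
          (∀ z ∈ insert a ({l} ∪ {m} ∪ Z), G.Adj x z → z = a) → G.Adj x v ∨ G.Adj x w := by
        intro x hx h2 hN
        obtain ⟨b, hb, c, hc, hbc, xb, xc⟩ := nbTwo h2.ge
        have key : ∀ z ∈ Y \ {x}, G.Adj x z → z = a ∨ z = v ∨ z = w := by
          intro z hz h
          by_contra hcon
          push Not at hcon
          refine hcon.1 (hN z ((hXm z).2 ⟨(Finset.mem_sdiff.1 hz).1, ?_, hcon.2⟩) h)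
          rintro rfl
          exact huXn x hx h.symm
        rcases key b hb xb with rfl | rfl | rfl
        · rcases key c hc xc with rfl | rfl | rfl
          · exact absurd rfl hbc
          · exact Or.inl xc
          · exact Or.inr xc
        · exact Or.inl xb
        · exact Or.inr xb
      have ol := other l hlX el (by
        intro z hz h
        simp only [Finset.mem_insert, Finset.mem_union, Finset.mem_singleton] at hz
        rcases hz with rfl | (rfl | rfl) | hz
        · rfl
        · exact absurd rfl h.ne
        · exact absurd h nlm
        · exact absurd h (e_eq_zero.1 elZ _ (by simp) z hz))
      have om := other m hmX em (by
        intro z hz h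
        simp only [Finset.mem_insert, Finset.mem_union, Finset.mem_singleton] at hz
        rcases hz with rfl | (rfl | rfl) | hz
        · rfl
        · exact absurd h.symm nlm
        · exact absurd rfl h.ne
        · exact absurd h (e_eq_zero.1 emZ _ (by simp) z hz))
      have haX := hX3 a (by simp)
      have nb : ∀ x, x ≠ a → G.Adj l x → G.Adj m x → False := by
        intro x hxa h1 h2
        rcases hG.c4 a l x m al h1 h2.symm am.symm with h | h
        · exact hxa h.symm
        · exact lm h
      rcases ol with ol | ol <;> rcases om with om | om
      · exact (nb v haX.2.1.symm ol om).elim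
      · exact hex_wrap hG hY ih hBL hdY hYe hX3 huv huw hvw Nu hZ hZ3 k1 k2 aZ lZ mZ lm al am eaZ ol om el em
      · exact hex_wrap hG hY ih hBL hdY hYe' (fun x hx => ⟨(hX3 x hx).1, (hX3 x hx).2.2, (hX3 x hx).2.1⟩)
          huw huv hvw.symm Nu' hZ hZ3 k2 k1 aZ lZ mZ lm al am eaZ ol om el em
      · exact (nb w haX.2.2.symm ol om).elim
  · have h3 : e G A (Y \ A) ≤ 3 := by omega
    rcases e3 hG hY ih hBL hdY hAB hXY hXne h3 with h | hC
    · exact absurd h noS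
    · by_cases h2 : e G A (Y \ A) ≤ 2
      · exact absurd (twocut hG hY ih hBL hdY A hXY hXne h2 hAB.card_mod) noS
      · by_cases hv2 : e G {v} A = 2
        · exact done (P3_case hG hC vX wX uX hYe hvw huv huw Nu hv2 (by omega))
        · exact done (P3_case hG hC wX vX uX hYe' hvw.symm huw huv Nu' (by omega) (by omega))

theorem thmA (hG : Sub5 G) (N : ℕ) : IHyp G N := by
  induction N with
  | zero => intro Z h; omega
  | succ N ih0 =>
    intro Y hN hY ⟨u, huY, hu2⟩
    have ih : IHyp G Y.card := ih0.mono (by omega)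
    by_cases h1 : ({u} : Finset W) = Y
    · subst h1
      exact ⟨(d_single u).le, fun _ => Bad.single u⟩
    by_cases hBL : BL G Y
    · by_cases hdY : 1 ≤ d G Y
      · have := noncubic_BL hG hY ih hBL hdY huY hu2 h1
        exact ⟨this.1, fun _ => Bad.block Y this.2⟩
      · exact ⟨by omega, fun h => absurd h.ge hdY⟩
    · unfold BL at hBL
      push Not at hBL
      obtain ⟨A, a1, a2, a3, a4⟩ := hBL
      exact bridge_lemma hG hY ih a1 a2 a3 (by omega)

theorem thmB (hG : Sub5 G) {Y : Finset W} (hY : Conn G Y) (hcub : ∀ y ∈ Y, e G {y} Y = 3) :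
    d G Y ≤ 2 ∧ (d G Y = 2 → ∃ t ∈ [bH1, bH2], ∃ f', Realizes G t f' Y) := by
  have ih := thmA hG Y.card
  by_cases hBL : BL G Y
  · obtain ⟨r, hr⟩ := hY.1
    obtain ⟨X, hX⟩ : ∃ X, X = Y.erase r := ⟨_, rfl⟩
    have hXY : X ⊆ Y := hX ▸ Finset.erase_subset _ _
    have rX : r ∉ X := by simp [hX]
    have hXne : X ≠ Y := fun h => rX (h ▸ hr)
    have hbd : e G X (Y \ X) = 3 := by rw [hX, erase_bd hr, hcub r hr]
    have hYe : Y = insert r X := by rw [hX, Finset.insert_erase hr]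
    have hc : Y.card = X.card + 1 := by rw [hYe, Finset.card_insert_of_notMem rX]
    have hd : d G Y ≤ d G X + 1 := by
      have := nuS_mono (G := G) hXY
      unfold d; omega
    have hct := count hG hY ih 2 hBL X hXY hXne
    rw [hbd] at hct
    refine ⟨by omega, fun hd2 => ?_⟩
    obtain ⟨A, hAX, hAc, hA0, hAd, hAB⟩ := extract hG hY ih X hXY hXne (by omega)
    have hAX' : A = X := by
      by_contra hcon
      have h1 := hBL A (hAX.trans hXY) hAc.1 (fun h => rX (hAX (h ▸ hr)))
      have h2 := hBL (X \ A) (Finset.sdiff_subset.trans hXY)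
        (by rw [Finset.sdiff_nonempty]; exact fun h => hcon (subset_antisymm hAX h))
        (fun h => rX (Finset.sdiff_subset (h ▸ hr)))
      have h3 := bd_add hAX hXY hA0
      omega
    subst hAX'
    have e3r : e G {r} A = 3 := by
      have := hcub r hr
      rw [hYe, Finset.insert_eq, e_union_right _ (by simpa using rX), e_single_single] at this
      simpa using this
    rcases e3 hG hY ih hBL (by omega) hAB hXY hXne hbd.le with ⟨p, rfl⟩ | hC
    · rw [e_single_single] at e3r; split_ifs at e3r <;> omega
    · rcases R_idx hG hC rX hYe e3r hcub with h | h
      · omega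
      · exact h
  · unfold BL at hBL
    push Not at hBL
    obtain ⟨A, a1, a2, a3, a4⟩ := hBL
    have := bridge_lemma hG hY ih a1 a2 a3 (by omega)
    exact ⟨by omega, fun h => by omega⟩
end ThmA

section HostTree
open Classical
variable {W : Type} {G : SimpleGraph W}

variable (G) in
structure HR (X : Finset W) (π : W → W) (A : Finset W) : Prop where
  AX : A ⊆ X
  mapX : ∀ x ∈ X, π x ∈ X
  Afix : ∀ a ∈ A, π a = a
  Asing : ∀ x ∈ X, ∀ a ∈ A, π x = a → x = a
  fib : ∀ x ∈ X, (∀ y ∈ X, π y = π x → y = x) ∨ IsBlk G (X.filter (fun y => π y = π x))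
  cross : ∀ x ∈ X, ∀ y ∈ X, G.Adj x y → π x ≠ π y → (x ∈ A ∧ y ∉ A) ∨ (x ∉ A ∧ y ∈ A)
  deg : ∀ a ∈ A, ∃ b ∈ X, ∃ c ∈ X, ∃ t ∈ X, π b ≠ π c ∧ π b ≠ π t ∧ π c ≠ π t ∧
    G.Adj a b ∧ G.Adj a c ∧ G.Adj a t
  card : (X.image π).card = 3 * A.card + 1
  mat : ∀ r ∈ X, r ∉ A → ∃ m : W → W, (∀ a ∈ A, m a ∈ X ∧ G.Adj a (m a) ∧ π (m a) ≠ π r) ∧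
    ∀ a ∈ A, ∀ b ∈ A, π (m a) = π (m b) → a = b

lemma HR.join (hG : Sub5 G) {X : Fin 3 → Finset W} {π : Fin 3 → W → W} {A : Fin 3 → Finset W}
    (h : ∀ i, HR G (X i) (π i) (A i)) {v : W} (hv : ∀ i, v ∉ X i)
    (dj : ∀ i j, i ≠ j → ∀ x ∈ X i, x ∉ X j)
    (ne : ∀ i j, i ≠ j → ∀ x ∈ X i, ∀ y ∈ X j, ¬ G.Adj x y)
    {b : Fin 3 → W} (hb : ∀ i, b i ∈ X i) (vb : ∀ i, G.Adj v (b i)) :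
    ∃ π' A', HR G (insert v (Finset.univ.biUnion X)) π' A' := by
  obtain ⟨π', hπ, hπv⟩ : ∃ π' : W → W, (∀ i, ∀ x ∈ X i, π' x = π i x) ∧ π' v = v := by
    refine ⟨fun x => if hx : ∃ i, x ∈ X i then π hx.choose x else x, ?_, ?_⟩
    · intro i x hx
      have hex : ∃ i, x ∈ X i := ⟨i, hx⟩
      simp only [dif_pos hex]
      have : hex.choose = i := by
        by_contra hc
        exact dj _ _ hc x hex.choose_spec hx
      rw [this]
    · simp [hv]
  have inj : ∀ i j x, x ∈ X i → x ∈ X j → i = j := by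
    intro i j x h1 h2
    by_contra hc
    exact dj _ _ hc x h1 h2
  have memX : ∀ x, x ∈ insert v (Finset.univ.biUnion X) ↔ x = v ∨ ∃ i, x ∈ X i := by
    intro x; simp
  have memA : ∀ x, x ∈ insert v (Finset.univ.biUnion A) ↔ x = v ∨ ∃ i, x ∈ A i := by
    intro x; simp
  have hvA : ∀ i, v ∉ A i := fun i hh => hv i ((h i).AX hh)
  have AinX : ∀ i x, x ∈ X i → (x ∈ insert v (Finset.univ.biUnion A) ↔ x ∈ A i) := by
    intro i x hx
    rw [memA]
    constructor
    · rintro (rfl | ⟨j, hj⟩)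
      · exact absurd hx (hv i)
      · rw [inj i j x hx ((h j).AX hj)]; exact hj
    · exact fun hh => Or.inr ⟨i, hh⟩
  have bA : ∀ i, b i ∉ A i := by
    intro i hh
    obtain ⟨x, hx, y, hy, z, hz, k1, k2, k3, a1, a2, a3⟩ := (h i).deg _ hh
    rcases nb3 hG a1 a2 a3 (fun h => k1 (h ▸ rfl)) (fun h => k2 (h ▸ rfl)) (fun h => k3 (h ▸ rfl))
      (vb i).symm with rfl | rfl | rfl
    · exact hv i hx
    · exact hv i hy
    · exact hv i hz
  have same : ∀ x, (∃ i, x ∈ X i) → ∀ i y, y ∈ X i → π' y = π' x → x ∈ X i ∧ π i y = π i x := by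
    rintro x ⟨j, hj⟩ i y hy hxy
    rw [hπ i y hy, hπ j x hj] at hxy
    have : i = j := inj i j _ ((h i).mapX y hy) (hxy ▸ (h j).mapX x hj)
    subst this
    exact ⟨hj, hxy⟩
  have vsame : ∀ i x, x ∈ X i → π' x ≠ v := by
    intro i x hx hh
    rw [hπ i x hx] at hh
    exact hv i (hh ▸ (h i).mapX x hx)
  have neb : ∀ i j, i ≠ j → π' (b i) ≠ π' (b j) := by
    intro i j hij hh
    have := same (b j) ⟨j, hb j⟩ i (b i) (hb i) hh
    exact hij (inj i j _ this.1 (hb j))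
  have nbv : ∀ z, G.Adj v z → ∃ i, z = b i := by
    intro z hz
    rcases nb3 hG (vb 0) (vb 1) (vb 2) (fun hh => neb 0 1 (by decide) (hh ▸ rfl))
      (fun hh => neb 0 2 (by decide) (hh ▸ rfl)) (fun hh => neb 1 2 (by decide) (hh ▸ rfl)) hz with h | h | h
    · exact ⟨_, h⟩
    · exact ⟨_, h⟩
    · exact ⟨_, h⟩
  have bA' : ∀ i, b i ∉ insert v (Finset.univ.biUnion A) := fun i => by
    rw [AinX i _ (hb i)]; exact bA i
  refine ⟨π', insert v (Finset.univ.biUnion A), ?_, ?_, ?_, ?_, ?_, ?_, ?_, ?_, ?_⟩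
  · intro x hx
    rw [memX]
    rcases (memA x).1 hx with rfl | ⟨i, hi⟩
    · simp
    · exact Or.inr ⟨i, (h i).AX hi⟩
  · intro x hx
    rw [memX]
    rcases (memX x).1 hx with rfl | ⟨i, hi⟩
    · simp [hπv]
    · exact Or.inr ⟨i, by rw [hπ i x hi]; exact (h i).mapX x hi⟩
  · intro a ha
    rcases (memA a).1 ha with rfl | ⟨i, hi⟩
    · exact hπv
    · rw [hπ i a ((h i).AX hi)]; exact (h i).Afix a hi
  · intro x hx a ha hxa
    rcases (memX x).1 hx with rfl | ⟨j, hj⟩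
    · rw [← hxa, hπv]
    rcases (memA a).1 ha with rfl | ⟨i, hi⟩
    · exact absurd hxa (vsame j x hj)
    · have hiX := (h i).AX hi
      have := same a ⟨i, hiX⟩ j x hj (by rw [hxa, hπ i a hiX, (h i).Afix a hi])
      have hij := inj i j a hiX this.1
      subst hij
      exact (h i).Asing x hj a hi (by rw [this.2, (h i).Afix a hi])
  · intro x hx
    rcases (memX x).1 hx with rfl | ⟨i, hi⟩
    · left
      intro y hy hyx
      rcases (memX y).1 hy with rfl | ⟨i, hi⟩
      · rfl
      · rw [hπv] at hyx; exact absurd hyx (vsame i y hi)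
    · have key : ∀ y ∈ insert v (Finset.univ.biUnion X), π' y = π' x → y ∈ X i ∧ π i y = π i x := by
        intro y hy hyx
        rcases (memX y).1 hy with rfl | ⟨j, hj⟩
        · rw [hπv] at hyx; exact absurd hyx.symm (vsame i x hi)
        · have := same x ⟨i, hi⟩ j y hj hyx
          have hij := inj i j x hi this.1
          subst hij
          exact ⟨hj, this.2⟩
      rcases (h i).fib x hi with h1 | h1
      · left
        intro y hy hyx
        exact h1 y (key y hy hyx).1 (key y hy hyx).2
      · right
        convert h1 using 1
        ext y
        rw [Finset.mem_filter, Finset.mem_filter]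
        constructor
        · rintro ⟨a1, a2⟩; exact key y a1 a2
        · rintro ⟨a1, a2⟩
          exact ⟨(memX y).2 (Or.inr ⟨i, a1⟩), by rw [hπ i y a1, hπ i x hi, a2]⟩
  · intro x hx y hy hxy hne
    rcases (memX x).1 hx with rfl | ⟨i, hi⟩
    · obtain ⟨i, rfl⟩ := nbv y hxy
      exact Or.inl ⟨(memA _).2 (Or.inl rfl), bA' i⟩
    rcases (memX y).1 hy with rfl | ⟨j, hj⟩
    · obtain ⟨i, rfl⟩ := nbv x hxy.symm
      exact Or.inr ⟨bA' i, (memA _).2 (Or.inl rfl)⟩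
    have hij : i = j := by
      by_contra hc
      exact ne i j hc x hi y hj hxy
    subst hij
    rw [AinX i x hi, AinX i y hj]
    exact (h i).cross x hi y hj hxy (by rwa [← hπ i x hi, ← hπ i y hj])
  · intro a ha
    have up : ∀ i x, x ∈ X i → x ∈ insert v (Finset.univ.biUnion X) := fun i x hx => (memX x).2 (Or.inr ⟨i, hx⟩)
    rcases (memA a).1 ha with rfl | ⟨i, hi⟩
    · exact ⟨b 0, up 0 _ (hb 0), b 1, up 1 _ (hb 1), b 2, up 2 _ (hb 2), neb 0 1 (by decide), neb 0 2 (by decide),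
        neb 1 2 (by decide), vb 0, vb 1, vb 2⟩
    · obtain ⟨x, hx, y, hy, z, hz, k⟩ := (h i).deg a hi
      refine ⟨x, up i _ hx, y, up i _ hy, z, up i _ hz, ?_⟩
      rw [hπ i x hx, hπ i y hy, hπ i z hz]; exact k
  · have e1 : (insert v (Finset.univ.biUnion X)).image π' =
        insert v (Finset.univ.biUnion fun i => (X i).image (π i)) := by
      rw [Finset.image_insert, hπv, Finset.biUnion_image]
      congr 1
      refine Finset.biUnion_congr rfl (fun i _ => Finset.image_congr (fun x hx => hπ i x hx))
    have sub : ∀ i, (X i).image (π i) ⊆ X i := by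
      intro i x hx
      obtain ⟨y, hy, rfl⟩ := Finset.mem_image.1 hx
      exact (h i).mapX y hy
    rw [e1, Finset.card_insert_of_notMem, Finset.card_insert_of_notMem, Finset.card_biUnion, Finset.card_biUnion,
      Finset.sum_congr rfl (fun i _ => (h i).card)]
    · simp [Fin.sum_univ_three]; ring
    · intro i _ j _ hij
      exact Finset.disjoint_left.2 (fun x h1 h2 => dj i j hij x ((h i).AX h1) ((h j).AX h2))
    · intro i _ j _ hij
      exact Finset.disjoint_left.2 (fun x h1 h2 => dj i j hij x (sub i h1) (sub j h2))
    · simp [hvA]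
    · simp only [Finset.mem_biUnion, not_exists, not_and]
      exact fun i _ hh => hv i (sub i hh)
  · intro r hr hrA
    rcases (memX r).1 hr with rfl | ⟨j, hj⟩
    · exact absurd ((memA _).2 (Or.inl rfl)) hrA
    have hrAj : r ∉ A j := by rwa [AinX j r hj] at hrA
    have hM : ∀ i, ∃ m : W → W, (∀ a ∈ A i, m a ∈ X i ∧ G.Adj a (m a) ∧ π i (m a) ≠ π i (if i = j then r else b i)) ∧
        ∀ a ∈ A i, ∀ b ∈ A i, π i (m a) = π i (m b) → a = b := by
      intro i
      by_cases hij : i = j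
      · subst hij; simp only [if_true]; exact (h i).mat r hj hrAj
      · simp only [if_neg hij]; exact (h i).mat _ (hb i) (bA i)
    choose m hm1 hm2 using hM
    obtain ⟨k, hk⟩ : ∃ k : Fin 3, k ≠ j := ⟨j + 1, by clear * -; revert j; decide⟩
    obtain ⟨m', hm', hmv⟩ : ∃ m' : W → W, (∀ i, ∀ x ∈ X i, m' x = m i x) ∧ m' v = b k := by
      refine ⟨fun x => if hx : ∃ i, x ∈ X i then m hx.choose x else b k, ?_, ?_⟩
      · intro i x hx
        have hex : ∃ i, x ∈ X i := ⟨i, hx⟩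
        simp only [dif_pos hex]
        rw [inj _ _ x hex.choose_spec hx]
      · simp [hv]
    have val : ∀ i, ∀ a ∈ A i, m' a ∈ X i ∧ π' (m' a) = π i (m i a) := by
      intro i a ha
      rw [hm' i a ((h i).AX ha)]
      exact ⟨(hm1 i a ha).1, hπ i _ (hm1 i a ha).1⟩
    have vk : ∀ i, ∀ a ∈ A i, π' (m' a) ≠ π' (b k) := by
      intro i a ha hh
      have := same (b k) ⟨k, hb k⟩ i _ (val i a ha).1 hh
      have hik := inj i k _ this.1 (hb k)
      subst hik
      rw [hm' i a ((h i).AX ha)] at this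
      have := (hm1 i a ha).2.2
      simp only [if_neg hk] at this
      simp_all
    refine ⟨m', ?_, ?_⟩
    · intro a ha
      rcases (memA a).1 ha with rfl | ⟨i, hi⟩
      · rw [hmv]
        refine ⟨(memX _).2 (Or.inr ⟨k, hb k⟩), vb k, fun hh => ?_⟩
        have := same r ⟨j, hj⟩ k _ (hb k) hh
        exact hk (inj k j r this.1 hj)
      · refine ⟨(memX _).2 (Or.inr ⟨i, (val i a hi).1⟩), ?_, fun hh => ?_⟩
        · rw [hm' i a ((h i).AX hi)]; exact (hm1 i a hi).2.1
        · have := same r ⟨j, hj⟩ i _ (val i a hi).1 hh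
          have hij := inj i j _ this.1 hj
          subst hij
          rw [hm' i a ((h i).AX hi)] at this
          have h3 := (hm1 i a hi).2.2
          simp only [if_true] at h3
          exact h3 this.2
    · intro a ha c hc hac
      rcases (memA a).1 ha with rfl | ⟨i, hi⟩ <;> rcases (memA c).1 hc with rfl | ⟨i', hi'⟩
      · rfl
      · rw [hmv] at hac; exact absurd hac.symm (vk i' c hi')
      · rw [hmv] at hac; exact absurd hac (vk i a hi)
      · have := same (m' c) ⟨i', (val i' c hi').1⟩ i _ (val i a hi).1 hac
        have hij := inj i i' _ this.1 (val i' c hi').1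
        subst hij
        refine hm2 i a hi c hi' ?_
        rw [← hm' i a ((h i).AX hi), ← hm' i c ((h i).AX hi')]; exact this.2

lemma Bad.HR (hG : Sub5 G) {X : Finset W} (h : Bad G X) : ∃ π A, HR G X π A := by
  induction h with
  | single x =>
    refine ⟨id, ∅, ?_⟩
    constructor <;> simp
    exact Or.inr ⟨x⟩
  | block X h =>
    have hne : X.Nonempty := by
      rw [← Finset.card_pos]
      have := (Bad.block X h).card_mod
      omega
    obtain ⟨x, hx⟩ := hne
    refine ⟨fun _ => x, ∅, ?_⟩
    constructor <;> try simp
    · intro _ _; exact hx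
    · intro _ _; exact Or.inr h
    · rw [Finset.image_const ⟨x, hx⟩]; simp
    · intro _ _; exact Or.inr ⟨x⟩
  | join v X₁ X₂ X₃ h₁ h₂ h₃ v₁ v₂ v₃ d₁₂ d₁₃ d₂₃ e₁₂ e₁₃ e₂₃ e₁ e₂ e₃ i₁ i₂ i₃ =>
    obtain ⟨π₁, A₁, i₁⟩ := i₁
    obtain ⟨π₂, A₂, i₂⟩ := i₂
    obtain ⟨π₃, A₃, i₃⟩ := i₃
    obtain ⟨b₁, hb₁, vb₁, -⟩ := nb1 e₁
    obtain ⟨b₂, hb₂, vb₂, -⟩ := nb1 e₂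
    obtain ⟨b₃, hb₃, vb₃, -⟩ := nb1 e₃
    have := HR.join hG (X := ![X₁, X₂, X₃]) (π := ![π₁, π₂, π₃]) (A := ![A₁, A₂, A₃]) (v := v)
      (b := ![b₁, b₂, b₃]) (by intro i; fin_cases i <;> assumption) (by intro i; fin_cases i <;> assumption)
      (by
        intro i j hij x hx hx'
        fin_cases i <;> fin_cases j
        · exact hij rfl
        · exact Finset.disjoint_left.1 d₁₂ hx hx'
        · exact Finset.disjoint_left.1 d₁₃ hx hx'
        · exact Finset.disjoint_left.1 d₁₂ hx' hx
        · exact hij rfl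
        · exact Finset.disjoint_left.1 d₂₃ hx hx'
        · exact Finset.disjoint_left.1 d₁₃ hx' hx
        · exact Finset.disjoint_left.1 d₂₃ hx' hx
        · exact hij rfl)
      (by
        intro i j hij x hx y hy hxy
        fin_cases i <;> fin_cases j
        · exact hij rfl
        · exact e_eq_zero.1 e₁₂ _ hx _ hy hxy
        · exact e_eq_zero.1 e₁₃ _ hx _ hy hxy
        · exact e_eq_zero.1 e₁₂ _ hy _ hx hxy.symm
        · exact hij rfl
        · exact e_eq_zero.1 e₂₃ _ hx _ hy hxy
        · exact e_eq_zero.1 e₁₃ _ hy _ hx hxy.symm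
        · exact e_eq_zero.1 e₂₃ _ hy _ hx hxy.symm
        · exact hij rfl)
      (by intro i; fin_cases i <;> assumption) (by intro i; fin_cases i <;> assumption)
    convert this using 5
    ext z
    simp [Fin.exists_fin_succ, or_assoc]
end HostTree

section Host2
open Classical
variable {W : Type} {G : SimpleGraph W}

lemma IsBlockB.of_iso {X Y : Type} {H : SimpleGraph X} {K : SimpleGraph Y} (i : H ≃g K)
    (h : IsBlockB _ K) : IsBlockB _ H := by
  unfold IsBlockB at *
  rcases h with h | h | h | h | h | h | h | h | h <;> obtain ⟨j⟩ := h <;> simp [Nonempty.intro (i.trans j)]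

variable (G) in
def host (X : Finset W) (π : W → W) : SimpleGraph (X.image π : Finset W) where
  Adj p q := p ≠ q ∧ ∃ x ∈ X, ∃ y ∈ X, π x = p ∧ π y = q ∧ G.Adj x y
  symm := by
    refine ⟨?_⟩
    rintro p q ⟨h, x, hx, y, hy, h1, h2, h3⟩
    exact ⟨h.symm, y, hy, x, hx, h2, h1, h3.symm⟩
  loopless := ⟨fun p h => h.1 rfl⟩

lemma HR.nbrs (hG : Sub5 G) {X A : Finset W} {π : W → W} (h : HR G X π A) {a x y : W} (ha : a ∈ A)
    (ax : G.Adj a x) (ay : G.Adj a y) (hxy : π x = π y) : x = y := by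
  obtain ⟨b, hb, c, hc, t, ht, k1, k2, k3, ab, ac, at'⟩ := h.deg a ha
  have n1 : b ≠ c := fun h => k1 (h ▸ rfl)
  have n2 : b ≠ t := fun h => k2 (h ▸ rfl)
  have n3 : c ≠ t := fun h => k3 (h ▸ rfl)
  rcases nb3 hG ab ac at' n1 n2 n3 ax with rfl | rfl | rfl <;>
    rcases nb3 hG ab ac at' n1 n2 n3 ay with rfl | rfl | rfl <;> first | rfl | exact absurd hxy ‹_› | exact absurd hxy.symm ‹_›

/-- T-adjacency has one end in `A` -/
lemma HR.host_adj {X A : Finset W} {π : W → W} (h : HR G X π A) {p q : (X.image π : Finset W)}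
    (hpq : (host G X π).Adj p q) : ((p : W) ∈ A ∧ (q : W) ∉ A) ∨ ((p : W) ∉ A ∧ (q : W) ∈ A) := by
  obtain ⟨hne, x, hx, y, hy, h1, h2, h3⟩ := hpq
  have key : ∀ x ∈ X, (π x ∈ A ↔ x ∈ A) := by
    intro x hx
    constructor
    · intro hh
      have := h.Asing x hx _ hh rfl
      exact this ▸ hh
    · intro hh; rw [h.Afix x hh]; exact hh
  rw [← h1, ← h2, key x hx, key y hy]
  refine h.cross x hx y hy h3 ?_
  rw [h1, h2]
  exact fun hh => hne (Subtype.ext hh)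

lemma HR.three (hG : Sub5 G) {X A : Finset W} {π : W → W} (h : HR G X π A) (p : (X.image π : Finset W))
    (hp : (p : W) ∈ A) : ∃ q : Fin 3 → (X.image π : Finset W), ∀ z, (host G X π).Adj p z → ∃ i, z = q i := by
  obtain ⟨b, hb, c, hc, t, ht, k1, k2, k3, ab, ac, at'⟩ := h.deg p hp
  have n1 : b ≠ c := fun h => k1 (h ▸ rfl)
  have n2 : b ≠ t := fun h => k2 (h ▸ rfl)
  have n3 : c ≠ t := fun h => k3 (h ▸ rfl)
  refine ⟨![⟨π b, Finset.mem_image_of_mem _ hb⟩, ⟨π c, Finset.mem_image_of_mem _ hc⟩,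
    ⟨π t, Finset.mem_image_of_mem _ ht⟩], ?_⟩
  rintro z ⟨hne, x, hx, y, hy, h1, h2, h3⟩
  have := h.Asing x hx _ hp h1
  subst this
  rcases nb3 hG ab ac at' n1 n2 n3 h3 with rfl | rfl | rfl
  · exact ⟨0, Subtype.ext h2.symm⟩
  · exact ⟨1, Subtype.ext h2.symm⟩
  · exact ⟨2, Subtype.ext h2.symm⟩

lemma HR.cardV {X A : Finset W} {π : W → W} (h : HR G X π A) :
    Nat.card (X.image π : Finset W) = 3 * A.card + 1 := by
  rw [Nat.card_eq_fintype_card, Fintype.card_coe, h.card]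

lemma HR.memV {X A : Finset W} {π : W → W} (h : HR G X π A) {a : W} (ha : a ∈ A) : a ∈ X.image π :=
  Finset.mem_image.2 ⟨a, h.AX ha, h.Afix a ha⟩

lemma HR.edges (hG : Sub5 G) {X A : Finset W} {π : W → W} (h : HR G X π A) :
    Nat.card (host G X π).edgeSet ≤ 3 * A.card := by
  have hch : ∀ a : A, ∃ q : Fin 3 → (X.image π : Finset W), ∀ z,
      (host G X π).Adj ⟨a, h.memV a.2⟩ z → ∃ i, z = q i := fun a => h.three hG ⟨a, h.memV a.2⟩ a.2
  choose q hq using hch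
  have h1 : Nat.card (host G X π).edgeSet ≤
      Nat.card (Set.range fun p : A × Fin 3 => s((⟨p.1, h.memV p.1.2⟩ : (X.image π : Finset W)), q p.1 p.2)) := by
    refine Nat.card_mono (Set.toFinite _) ?_
    intro ed
    refine Sym2.ind (fun x y hxy => ?_) ed
    rw [mem_edgeSet] at hxy
    rcases h.host_adj hxy with hh | hh
    · obtain ⟨i, hi⟩ := hq ⟨x, hh.1⟩ y hxy
      exact ⟨(⟨x, hh.1⟩, i), by simp [hi]⟩
    · obtain ⟨i, hi⟩ := hq ⟨y, hh.2⟩ x hxy.symm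
      exact ⟨(⟨y, hh.2⟩, i), by simp [hi, Sym2.eq_swap]⟩
  refine h1.trans ((Finite.card_range_le _).trans ?_)
  simp [Nat.card_eq_fintype_card, mul_comm]

lemma HR.match_le {X A : Finset W} {π : W → W} (h : HR G X π A) {M : Finset (Sym2 (X.image π : Finset W))}
    (hM : IsMatchingSet (host G X π) M) : M.card ≤ A.card := by
  have hex : ∀ ed ∈ M, ∃ p : (X.image π : Finset W), p ∈ ed ∧ (p : W) ∈ A := by
    intro ed
    refine Sym2.ind (fun x y hxy => ?_) ed
    have := hM.1 _ hxy
    rw [mem_edgeSet] at this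
    rcases h.host_adj this with hh | hh
    · exact ⟨x, by simp, hh.1⟩
    · exact ⟨y, by simp, hh.2⟩
  choose f hf using hex
  have := Finset.card_le_card_of_injOn (s := M.attach) (t := A) (fun ed => (f ed.1 ed.2 : W)) ?_ ?_
  · simpa using this
  · intro ed hed; exact (hf ed.1 ed.2).2
  · intro e1 _ e2 _ h12
    by_contra hc
    have := hM.2 e1 e1.2 e2 e2.2 (fun hh => hc (Subtype.ext hh)) (f e1 e1.2) (hf e1 e1.2).1
    rw [Subtype.ext h12] at this
    exact this (hf e2 e2.2).1

lemma HR.match_ex {X A : Finset W} {π : W → W} (h : HR G X π A) (r : (X.image π : Finset W))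
    (hr : (r : W) ∉ A) : ∃ M : Finset (Sym2 (X.image π : Finset W)), IsMatchingSet (host G X π) M ∧
      M.card = A.card ∧ r ∉ covered M := by
  obtain ⟨r', hr', hrr⟩ := Finset.mem_image.1 r.2
  have hrA : r' ∉ A := fun hh => hr (by rw [← hrr, h.Afix _ hh]; exact hh)
  obtain ⟨m, hm, hinj⟩ := h.mat r' hr' hrA
  let F : A → Sym2 (X.image π : Finset W) := fun a =>
    s(⟨a, h.memV a.2⟩, ⟨π (m a), Finset.mem_image_of_mem _ (hm a a.2).1⟩)
  have hadj : ∀ a : A, (host G X π).Adj ⟨a, h.memV a.2⟩ ⟨π (m a), Finset.mem_image_of_mem _ (hm a a.2).1⟩ := by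
    intro a
    refine ⟨fun hh => ?_, a, h.AX a.2, m a, (hm a a.2).1, h.Afix a a.2, rfl, (hm a a.2).2.1⟩
    have := h.Asing (m a) (hm a a.2).1 a a.2 (congrArg Subtype.val hh).symm
    exact (hm a a.2).2.1.ne this.symm
  have hmA : ∀ a : A, π (m a) ∉ A := by
    intro a hh
    rcases h.host_adj (hadj a) with h' | h'
    · exact h'.2 hh
    · exact h'.1 a.2
  have dis : ∀ a b : A, a ≠ b → ∀ z, z ∈ F a → z ∉ F b := by
    intro a b hab z hz hz'
    simp only [F, Sym2.mem_iff] at hz hz'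
    rcases hz with rfl | rfl <;> rcases hz' with hz' | hz' <;> simp only [Subtype.mk.injEq] at hz'
    · exact hab (Subtype.ext hz')
    · exact hmA b (hz' ▸ a.2)
    · exact hmA a (hz' ▸ b.2)
    · exact hab (Subtype.ext (hinj a a.2 b b.2 hz'))
  have Finj : Function.Injective F := by
    intro a b hab
    by_contra hc
    exact dis a b hc ⟨a, h.memV a.2⟩ (by simp [F]) (hab ▸ by simp [F])
  refine ⟨Finset.univ.image F, ⟨?_, ?_⟩, ?_, ?_⟩
  · intro ed hed
    obtain ⟨a, -, rfl⟩ := Finset.mem_image.1 hed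
    exact hadj a
  · intro e1 h1 e2 h2 hne z
    obtain ⟨a, -, rfl⟩ := Finset.mem_image.1 h1
    obtain ⟨b, -, rfl⟩ := Finset.mem_image.1 h2
    exact dis a b (fun hh => hne (hh ▸ rfl)) z
  · rw [Finset.card_image_of_injective _ Finj]; simp
  · rintro ⟨ed, hed, hrm⟩
    obtain ⟨a, -, rfl⟩ := Finset.mem_image.1 hed
    simp only [F, Sym2.mem_iff] at hrm
    rcases hrm with hh | hh
    · exact hr (by rw [hh]; exact a.2)
    · exact (hm a a.2).2.2 (by rw [hrr, hh])

lemma HR.nu_eq {X A : Finset W} {π : W → W} (h : HR G X π A) : nu (host G X π) = A.card := by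
  have : ∃ r : (X.image π : Finset W), (r : W) ∉ A := by
    by_contra hc
    push Not at hc
    have h1 : X.image π ⊆ A := fun x hx => hc ⟨x, hx⟩
    have := Finset.card_le_card h1
    rw [h.card] at this
    omega
  obtain ⟨r, hr⟩ := this
  obtain ⟨M, hM, hMc, -⟩ := h.match_ex r hr
  unfold nu
  apply le_antisymm
  · refine csSup_le ⟨_, M, hM, rfl⟩ ?_
    rintro k ⟨M', hM', rfl⟩
    exact h.match_le hM'
  · refine le_csSup ⟨A.card, ?_⟩ ⟨M, hM, hMc⟩
    rintro k ⟨M', hM', rfl⟩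
    exact h.match_le hM'

lemma HR.memT (hG : Sub5 G) {X A : Finset W} {π : W → W} (h : HR G X π A)
    (hc : (host G X π).Connected) : MemT (host G X π) := by
  refine ⟨?_, ?_, ?_⟩
  · rw [isTree_iff_connected_and_card]
    refine ⟨hc, le_antisymm ?_ hc.card_vert_le_card_edgeSet_add_one⟩
    have := h.edges hG
    rw [h.cardV]; omega
  · rintro v ⟨hv, -⟩
    have hvA : (v : W) ∈ A := by
      by_contra hh
      obtain ⟨M, h1, h2, h3⟩ := h.match_ex v hh
      exact hv ⟨M, h1, by rw [h.nu_eq, h2], h3⟩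
    obtain ⟨q, hq⟩ := h.three hG v hvA
    have : (host G X π).neighborSet v ⊆ Set.range q := by
      intro z hz
      obtain ⟨i, hi⟩ := hq z hz
      exact ⟨i, hi.symm⟩
    refine (Set.ncard_le_ncard this (Set.toFinite _)).trans ?_
    rw [← Nat.card_coe_set_eq]
    refine (Finite.card_range_le _).trans ?_
    simp
  · rw [h.nu_eq, h.cardV]

theorem HR.inCalG (hG : Sub5 G) {X A : Finset W} {π : W → W} (h : HR G X π A) {P : Set W}
    (hP : ∀ w, w ∈ P ↔ w ∈ X) (hc : (G.induce P).Connected) : InCalG (G.induce P) := by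
  let ρ : P → (X.image π : Finset W) := fun w => ⟨π w, Finset.mem_image_of_mem _ ((hP w).1 w.2)⟩
  have surj : Function.Surjective ρ := by
    rintro ⟨y, hy⟩
    obtain ⟨x, hx, rfl⟩ := Finset.mem_image.1 hy
    exact ⟨⟨x, (hP x).2 hx⟩, rfl⟩
  have step : ∀ x y : P, (G.induce P).Adj x y → ρ x ≠ ρ y → (host G X π).Adj (ρ x) (ρ y) := by
    intro x y hxy hne
    exact ⟨hne, x, (hP x).1 x.2, y, (hP y).1 y.2, rfl, rfl, hxy⟩
  have conn : (host G X π).Connected := by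
    have hre : ∀ x y : P, (host G X π).Reachable (ρ x) (ρ y) := by
      intro x y
      obtain ⟨w⟩ := hc.preconnected x y
      induction w with
      | nil => exact Reachable.refl _
      | cons hxy _ ih =>
        rename_i u v w _
        by_cases hne : ρ u = ρ v
        · rw [hne]; exact ih
        · exact (step u v hxy hne).reachable.trans ih
    obtain ⟨x⟩ := hc.nonempty
    have : Nonempty (X.image π : Finset W) := ⟨ρ x⟩
    refine ⟨fun p q => ?_⟩
    obtain ⟨x, rfl⟩ := surj p
    obtain ⟨y, rfl⟩ := surj q
    exact hre x y
  let S : Set (X.image π : Finset W) := {p | ∃ x ∈ X, ∃ y ∈ X, x ≠ y ∧ π x = p ∧ π y = p}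
  have SA : ∀ p ∈ S, (p : W) ∉ A := by
    rintro p ⟨x, hx, y, hy, hne, h1, h2⟩ hp
    exact hne ((h.Asing x hx _ hp h1).trans (h.Asing y hy _ hp h2).symm)
  have nS : ∀ p ∉ S, ∀ x ∈ X, ∀ y ∈ X, π x = p → π y = p → x = y := by
    intro p hp x hx y hy h1 h2
    by_contra hh
    exact hp ⟨x, hx, y, hy, hh, h1, h2⟩
  have rmem : ∀ x : P, (x : W) ∈ X := fun x => (hP x).1 x.2
  have notA : ∀ x : P, ρ x ∈ S → (x : W) ∉ A := by
    intro x hx hh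
    apply SA _ hx
    show π x ∈ A
    rw [h.Afix _ hh]; exact hh
  have ρeq : ∀ (x : P) (p : (X.image π : Finset W)), ρ x = p ↔ π x = p := fun x p => by
    rw [Subtype.ext_iff]
  have blk : ∀ p ∈ S, IsBlk G (X.filter (fun y => π y = p)) := by
    rintro p ⟨x, hx, y, hy, hne, h1, h2⟩
    rcases h.fib x hx with hh | hh
    · exact absurd (hh y hy (h2.trans h1.symm)).symm hne
    · rwa [h1] at hh
  have deg2 : ∀ p ∈ S, ∀ x : P, ρ x = p → 2 ≤ e G {(x : W)} (X.filter (fun y => π y = p)) := by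
    intro p hp x hx
    obtain ⟨g, hg, f, hf⟩ := blk p hp
    have hxm : (x : W) ∈ X.filter (fun y => π y = p) := by
      simp [rmem x, (ρeq x p).1 hx]
    obtain ⟨i, hi, hix⟩ := (hf.mem _).1 hxm
    rw [← hix, ← hf.degEq hi]
    exact blocks_deg g hg i hi
  refine ⟨_, host G X π, S, ρ, inferInstance, h.memT hG conn, ?_, surj, ?_, ?_, ?_, ?_, ?_, ?_, ?_, ?_⟩
  · intro p hp
    obtain ⟨M, h1, h2, h3⟩ := h.match_ex p (SA p hp)
    exact ⟨M, h1, by rw [h.nu_eq, h2], h3⟩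
  · intro p hp x y h1 h2
    exact Subtype.ext (nS p hp x (rmem x) y (rmem y) ((ρeq x p).1 h1) ((ρeq y p).1 h2))
  · intro x y hx hy
    constructor
    · intro hxy
      refine step x y hxy fun hh => ?_
      have := nS _ hx x (rmem x) y (rmem y) rfl ((ρeq y _).1 hh.symm)
      exact hxy.ne (Subtype.ext this)
    · rintro ⟨hne, x', hx', y', hy', h1, h2, h3⟩
      have e1 := nS _ hx x' hx' x (rmem x) h1 rfl
      have e2 := nS _ hy y' hy' y (rmem y) h2 rfl
      rw [e1, e2] at h3; exact h3
  · intro p hp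
    obtain ⟨g, hg, f, hf⟩ := blk p hp
    have := Realizes.isBlockB hg hf {w | ∃ hw : w ∈ P, (⟨w, hw⟩ : P) ∈ ρ ⁻¹' {p}} (by
      intro w
      simp only [Set.mem_ofPred_eq, Set.mem_preimage, Set.mem_singleton_iff, Finset.mem_filter, ρeq, exists_prop, hP])
    refine IsBlockB.of_iso ?_ this
    exact ⟨Equiv.subtypeSubtypeEquivSubtypeExists (· ∈ P) (· ∈ ρ ⁻¹' {p}), Iff.rfl⟩
  · rintro p hp q hq hpq x y rfl rfl hxy
    rcases h.cross x (rmem x) y (rmem y) hxy (fun hh => hpq (Subtype.ext hh)) with hh | hh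
    · exact notA x hp hh.1
    · exact notA y hq hh.2
  · rintro p hp q hq ⟨hne, x, hx, y, hy, h1, h2, h3⟩
    have hyA : ∀ x ∈ X, ∀ y ∈ X, π x = p → π y = q → G.Adj x y → y ∈ A := by
      intro x hx y hy h1 h2 h3
      rcases h.cross x hx y hy h3 (fun hh => hne (Subtype.ext (by rw [← h1, ← h2, hh]))) with hh | hh
      · exact absurd hh.1 (notA ⟨x, (hP x).2 hx⟩ (by rw [(ρeq _ p).2 h1]; exact hp))
      · exact hh.2
    refine ⟨(⟨x, (hP x).2 hx⟩, ⟨y, (hP y).2 hy⟩), ⟨(ρeq _ _).2 h1, (ρeq _ _).2 h2, h3⟩, ?_⟩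
    rintro ⟨x', y'⟩ ⟨k1, k2, k3⟩
    rw [ρeq] at k1 k2
    have ey := nS q hq y' (rmem y') y hy k2 h2
    have k3' : G.Adj x' y := ey ▸ k3
    have ex := h.nbrs hG (hyA x hx y hy h1 h2 h3) k3'.symm h3.symm (k1.trans h1.symm)
    exact Prod.ext (Subtype.ext ex) (Subtype.ext ey)
  · rintro p hp q hq hn x y rfl rfl hxy
    refine hn (step x y hxy fun hh => ?_)
    rw [hh] at hp
    exact hq hp
  · intro p hp x hx y z hy hz xy xz
    by_contra hne
    have h2 := deg2 p hp x hx
    have xy : G.Adj x y := xy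
    have xz : G.Adj x z := xz
    have h3 := hG.deg x (insert (y : W) (insert (z : W) (X.filter (fun y => π y = p))))
    rw [e_single_insert_adj _ xy, e_single_insert_adj _ xz] at h3
    · omega
    · simp only [Finset.mem_filter, not_and]; exact fun _ hh => hz ((ρeq z p).2 hh)
    · simp only [Finset.mem_insert, Finset.mem_filter, not_or, not_and]
      exact ⟨fun hh => hne (Subtype.ext hh), fun _ hh => hy ((ρeq y p).2 hh)⟩
  · intro p hp x hx y hy xy
    have h2 := deg2 p hp x hx
    have h3 := deg_le_two hG (A := X.filter (fun y => π y = p)) xy (by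
      simp only [Finset.mem_filter, not_and]; exact fun _ hh => hy ((ρeq y p).2 hh))
    have h4 : e G {(x : W)} (X.filter (fun y => π y = p)) = 2 := le_antisymm h3 h2
    rw [e_single] at h4
    rw [← h4, ← Set.ncard_image_of_injective _ Subtype.val_injective, ← Set.ncard_coe_finset]
    congr 1
    ext z
    simp only [Set.mem_image, Set.mem_inter_iff, mem_neighborSet, Set.mem_preimage, Set.mem_singleton_iff,
      Finset.coe_filter, Finset.mem_filter, Set.mem_ofPred_eq, ρeq]
    constructor
    · rintro ⟨w, ⟨h1, h2⟩, rfl⟩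
      exact ⟨⟨rmem w, h2⟩, h1⟩
    · rintro ⟨⟨h1, h2⟩, h3⟩
      exact ⟨⟨z, (hP z).2 h1⟩, ⟨h3, h2⟩, rfl⟩
end Host2

section Final
open Classical
variable {W : Type} {G : SimpleGraph W}

lemma UPM.toUR {S : Finset W} (h : UPM G S) :
    ∃ M : Finset (Sym2 W), IsURMatching G M ∧ S.card ≤ 2 * M.card := by
  obtain ⟨f, hf, huniq⟩ := h
  have hmem : ∀ ed, ed ∈ S.image (fun w => s(w, f w)) ↔ ∃ w ∈ S, s(w, f w) = ed := by
    intro ed; rw [Finset.mem_image]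
  have hz : ∀ w ∈ S, ∀ z ∈ s(w, f w), z ∈ S ∧ s(w, f w) = s(z, f z) := by
    intro w hw z hz
    rcases Sym2.mem_iff.1 hz with rfl | rfl
    · exact ⟨hw, rfl⟩
    · exact ⟨(hf w hw).1, by rw [(hf w hw).2.2, Sym2.eq_swap]⟩
  refine ⟨S.image (fun w => s(w, f w)), ⟨⟨?_, ?_⟩, ?_⟩, ?_⟩
  · intro ed hed
    obtain ⟨w, hw, rfl⟩ := (hmem _).1 hed
    exact (hf w hw).2.1
  · intro e1 h1 e2 h2 hne z k1 k2
    obtain ⟨w, hw, rfl⟩ := (hmem _).1 h1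
    obtain ⟨w', hw', rfl⟩ := (hmem _).1 h2
    exact hne ((hz w hw z k1).2.trans (hz w' hw' z k2).2.symm)
  · intro M' hM' hcov
    have hcS : ∀ z, (∃ y, s(z, y) ∈ M') ↔ z ∈ S := by
      intro z
      have h1 : z ∈ covered M' ↔ z ∈ covered (S.image (fun w => s(w, f w))) := by rw [hcov]
      have h2 : z ∈ covered M' ↔ ∃ y, s(z, y) ∈ M' := by
        constructor
        · rintro ⟨ed, he, hze⟩
          obtain ⟨y, rfl⟩ := Sym2.mem_iff_exists.1 hze
          exact ⟨y, he⟩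
        · rintro ⟨y, hy⟩
          exact ⟨_, hy, by simp⟩
      rw [← h2, h1]
      constructor
      · rintro ⟨ed, he, hze⟩
        obtain ⟨w, hw, rfl⟩ := (hmem _).1 he
        exact (hz w hw z hze).1
      · intro hzS
        exact ⟨_, (hmem _).2 ⟨z, hzS, rfl⟩, by simp⟩
    have hun : ∀ z y y', s(z, y) ∈ M' → s(z, y') ∈ M' → y = y' := by
      intro z y y' h1 h2
      by_contra hc
      exact hM'.2 _ h1 _ h2 (fun hh => hc (Sym2.congr_right.1 hh)) z (by simp) (by simp)
    obtain ⟨g, hg⟩ : ∃ g : W → W, ∀ z ∈ S, s(z, g z) ∈ M' := by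
      refine ⟨fun z => if hh : ∃ y, s(z, y) ∈ M' then hh.choose else z, fun z hz => ?_⟩
      have hh := (hcS z).2 hz
      simp only [dif_pos hh]
      exact hh.choose_spec
    have hgS : ∀ z ∈ S, g z ∈ S := fun z hz => (hcS _).1 ⟨z, by rw [Sym2.eq_swap]; exact hg z hz⟩
    have hgf := huniq g (fun z hz => ⟨hgS z hz, hM'.1 _ (hg z hz),
      hun (g z) _ _ (hg _ (hgS z hz)) (by rw [Sym2.eq_swap]; exact hg z hz)⟩)
    ext ed
    refine Sym2.ind (fun x y => ?_) ed
    constructor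
    · intro hxy
      have hx : x ∈ S := (hcS x).1 ⟨y, hxy⟩
      refine (hmem _).2 ⟨x, hx, ?_⟩
      rw [← hgf x hx, hun x _ _ (hg x hx) hxy]
    · intro hxy
      obtain ⟨w, hw, hwe⟩ := (hmem _).1 hxy
      rw [← hwe, ← hgf w hw]
      exact hg w hw
  · refine Finset.card_le_mul_card_image _ 2 ?_
    intro ed hed
    obtain ⟨w, hw, rfl⟩ := (hmem _).1 hed
    refine (Finset.card_le_card (t := {w, f w}) ?_).trans Finset.card_le_two
    intro z hz'
    have h2 := (Finset.mem_filter.1 hz').2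
    have : z ∈ s(z, f z) := by simp
    rw [h2] at this
    simpa using this

lemma nuS_le_nuUR [Fintype W] : nuS G Finset.univ ≤ nuUR G := by
  obtain ⟨S, -, h2, h3⟩ := exists_nuS (G := G) Finset.univ
  obtain ⟨M, hM, hc⟩ := h2.toUR
  have : M.card ≤ nuUR G := by
    refine le_csSup ⟨Fintype.card (Sym2 W), ?_⟩ ⟨M, hM, rfl⟩
    rintro k ⟨M', -, rfl⟩
    exact Finset.card_le_univ M'
  omega

lemma sub5_of [Fintype W] (h3 : ∀ v : W, (G.neighborSet v).ncard ≤ 3) (hg : 5 ≤ G.egirth) : Sub5 G := by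
  refine ⟨?_, ?_, ?_⟩
  · intro x B
    rw [e_single, ← Set.ncard_coe_finset]
    refine (Set.ncard_le_ncard ?_ (Set.toFinite _)).trans (h3 x)
    intro z hz
    simpa using (Finset.mem_filter.1 hz).2
  · intro a b c ab bc ac
    let w : G.Walk a a := .cons ab (.cons bc (.cons ac.symm .nil))
    have hw : w.IsCycle := by
      simp [w, Walk.isCycle_def, Walk.isTrail_def, ab.ne, bc.ne, ac.ne, ab.ne', bc.ne', ac.ne']
    have := hg.trans (egirth_le_length hw)
    simp [w] at this
    exact absurd this (by decide)
  · intro a b c t ab bc ct ta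
    by_contra hc
    push Not at hc
    let w : G.Walk a a := .cons ab (.cons bc (.cons ct (.cons ta .nil)))
    have hw : w.IsCycle := by
      simp [w, Walk.isCycle_def, Walk.isTrail_def, ab.ne, bc.ne, ct.ne, ta.ne, ab.ne', bc.ne', ct.ne', ta.ne', hc.1, hc.2,
        hc.1.symm, hc.2.symm]
    have := hg.trans (egirth_le_length hw)
    simp [w] at this
    exact absurd this (by decide)

lemma comp_conn [Fintype W] (c : G.ConnectedComponent) : Conn G (Finset.univ.filter (· ∈ c.supp)) := by
  refine ⟨?_, ?_⟩
  · obtain ⟨v, hv⟩ := c.nonempty_supp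
    exact ⟨v, by simpa using hv⟩
  · intro A hA ⟨a, ha⟩ hne
    obtain ⟨y, hy, hyA⟩ : ∃ y ∈ Finset.univ.filter (· ∈ c.supp), y ∉ A := by
      by_contra hc
      push Not at hc
      exact hne (subset_antisymm hA hc)
    have haS : a ∈ c.supp := (Finset.mem_filter.1 (hA ha)).2
    have hyS : y ∈ c.supp := (Finset.mem_filter.1 hy).2
    have hr : G.Reachable a y := by
      rw [ConnectedComponent.mem_supp_iff] at haS hyS
      exact ConnectedComponent.exact (haS.trans hyS.symm)
    obtain ⟨p⟩ := hr
    obtain ⟨dd, -, h1, h2⟩ := p.exists_boundary_dart (A : Set W) (by simpa using ha) (by simpa using hyA)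
    have h1' : dd.fst ∈ A := by simpa using h1
    have h2' : dd.snd ∉ A := by simpa using h2
    have hs : dd.snd ∈ c.supp := by
      have hf : dd.fst ∈ c.supp := (Finset.mem_filter.1 (hA h1')).2
      rw [ConnectedComponent.mem_supp_iff] at hf ⊢
      rw [← hf]
      exact ConnectedComponent.sound dd.adj.symm.reachable
    exact e_pos h1' (Finset.mem_sdiff.2 ⟨by simpa using hs, h2'⟩) dd.adj

lemma nuS_sum [Fintype W] (C : Finset G.ConnectedComponent) :
    ∑ c ∈ C, nuS G (Finset.univ.filter (· ∈ c.supp)) ≤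
      nuS G (C.biUnion fun c => Finset.univ.filter (· ∈ c.supp)) := by
  induction C using Finset.induction_on with
  | empty => simp
  | insert c C hc ih =>
    rw [Finset.sum_insert hc, Finset.biUnion_insert]
    refine (Nat.add_le_add_left ih _).trans ?_
    have key : ∀ x y, x ∈ Finset.univ.filter (· ∈ c.supp) →
        y ∈ C.biUnion (fun c => Finset.univ.filter (· ∈ c.supp)) → ¬ G.Reachable x y := by
      intro x y hx hy hr
      obtain ⟨c', hc', hy'⟩ := Finset.mem_biUnion.1 hy
      have h1 : x ∈ c.supp := (Finset.mem_filter.1 hx).2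
      have h2 : y ∈ c'.supp := (Finset.mem_filter.1 hy').2
      rw [ConnectedComponent.mem_supp_iff] at h1 h2
      have : c = c' := by rw [← h1, ← h2]; exact ConnectedComponent.sound hr
      exact hc (this ▸ hc')
    refine nuS_union ?_ subset_rfl ?_
    · rw [Finset.disjoint_left]
      exact fun x hx hy => key x x hx hy (Reachable.refl x)
    · rw [e_eq_zero.2 (fun a ha b hb hab => key a b ha hb hab.reachable)]
      omega

lemma kappa_eq [Fintype W] (P : ∀ (X : Type), SimpleGraph X → Prop) :
    kappa G P = ∑ c : G.ConnectedComponent, if P _ (G.induce c.supp) then 1 else 0 := by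
  unfold kappa
  rw [Nat.card_eq_fintype_card, Fintype.card_subtype, Finset.card_filter]

lemma per_comp [Fintype W] (h3 : ∀ v : W, (G.neighborSet v).ncard ≤ 3) (hg : 5 ≤ G.egirth)
    (c : G.ConnectedComponent) :
    (Finset.univ.filter (· ∈ c.supp)).card ≤ 3 * nuS G (Finset.univ.filter (· ∈ c.supp)) +
      (if InCalG (G.induce c.supp) then 1 else 0) + (if IsCubicGirth5 _ (G.induce c.supp) then 1 else 0) +
      (if IsH1orH2 _ (G.induce c.supp) then 1 else 0) := by
  have hG := sub5_of h3 hg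
  have hY := comp_conn c
  obtain ⟨Y, hYd⟩ : ∃ Y, Y = Finset.univ.filter (· ∈ c.supp) := ⟨_, rfl⟩
  rw [← hYd] at hY ⊢
  have hP : ∀ w, w ∈ c.supp ↔ w ∈ Y := by intro w; rw [hYd]; simp
  have hd : d G Y = Y.card - 3 * nuS G Y := rfl
  by_cases hcub : ∃ w ∈ Y, e G {w} Y ≤ 2
  · have := thmA hG (Y.card + 1) Y (by omega) hY hcub
    by_cases h1 : d G Y = 1
    · obtain ⟨π, A, hR⟩ := (this.2 h1).HR hG
      rw [if_pos (hR.inCalG hG hP c.connected_toSimpleGraph)]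
      omega
    · omega
  · push Not at hcub
    have hcub' : ∀ y ∈ Y, e G {y} Y = 3 := fun y hy => le_antisymm (hG.deg y Y) (hcub y hy)
    have hB := thmB hG hY hcub'
    have hcu : IsCubicGirth5 _ (G.induce c.supp) := by
      refine ⟨?_, ?_⟩
      · intro v
        have h := hcub' v ((hP v).1 v.2)
        rw [e_single] at h
        rw [← h, ← Set.ncard_image_of_injective _ Subtype.val_injective, ← Set.ncard_coe_finset]
        congr 1
        ext z
        simp only [Set.mem_image, mem_neighborSet, Finset.coe_filter, Set.mem_ofPred_eq]
        constructor
        · rintro ⟨w, h1, rfl⟩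
          exact ⟨(hP w).1 w.2, h1⟩
        · rintro ⟨h1, h2⟩
          exact ⟨⟨z, (hP z).2 h1⟩, h2, rfl⟩
      · exact hg.trans (IsContained.egirth_le ⟨(Embedding.induce _).toCopy⟩)
    rw [if_pos hcu]
    by_cases h2 : d G Y = 2
    · have hH : IsH1orH2 _ (G.induce c.supp) := by
        obtain ⟨t, ht, f, hf⟩ := hB.2 h2
        unfold IsH1orH2
        rw [eqH1, eqH2]
        simp only [List.mem_cons, List.not_mem_nil, or_false] at ht
        rcases ht with rfl | rfl
        · exact Or.inl (hf.iso rfl _ hP)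
        · exact Or.inr (hf.iso rfl _ hP)
      rw [if_pos hH]
      omega
    · omega
end Final

theorem statement17 {W : Type} [Fintype W] (G : SimpleGraph W)
    (hsubcubic : ∀ v : W, (G.neighborSet v).ncard ≤ 3)
    (hgirth : 5 ≤ G.egirth) :
    ((Nat.card W : ℝ) - kappa G (fun X H => InCalG H) -
        kappa G IsCubicGirth5 - kappa G IsH1orH2) / 3 ≤ nuUR G := by
  classical
  have key : Nat.card W ≤ 3 * nuUR G + kappa G (fun X H => InCalG H) + kappa G IsCubicGirth5 + kappa G IsH1orH2 := by
    have h1 := nuS_sum (G := G) Finset.univ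
    have hU : (Finset.univ.biUnion fun c : G.ConnectedComponent => Finset.univ.filter (· ∈ c.supp)) = Finset.univ := by
      ext x; simp
    rw [hU] at h1
    have h2 := nuS_le_nuUR (G := G)
    have h3 : Nat.card W = ∑ c : G.ConnectedComponent, (Finset.univ.filter (· ∈ c.supp)).card := by
      rw [← Finset.card_biUnion, hU, Finset.card_univ, Nat.card_eq_fintype_card]
      intro c _ c' _ hne
      refine Finset.disjoint_left.2 (fun x h1 h2 => hne ?_)
      simp only [Finset.mem_filter, ConnectedComponent.mem_supp_iff] at h1 h2
      rw [← h1.2, ← h2.2]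
    rw [h3, kappa_eq, kappa_eq, kappa_eq]
    have h4 := Finset.sum_le_sum (fun c (_ : c ∈ (Finset.univ : Finset G.ConnectedComponent)) => per_comp hsubcubic hgirth c)
    rw [Finset.sum_add_distrib, Finset.sum_add_distrib, Finset.sum_add_distrib, ← Finset.mul_sum] at h4
    have h5 := h1.trans h2
    have h6 := Nat.mul_le_mul_left 3 h5
    refine le_trans (le_of_eq ?_) (h4.trans (le_trans (Nat.add_le_add_right (Nat.add_le_add_right (Nat.add_le_add_right (le_trans (le_of_eq ?_) h6) _) _) _) (le_of_eq ?_)))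
    all_goals congr!
  have key' : (Nat.card W : ℝ) ≤ 3 * nuUR G + kappa G (fun X H => InCalG H) + kappa G IsCubicGirth5 + kappa G IsH1orH2 := by
    exact_mod_cast key
  linarith

end URPaper
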